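/- Let Σ be a complete connected translating graph contained in the slab {(x,y,z) : |x| ≤ w}, w > 0. Then Σ has quadratic area growth: there exists a constant C > 0, depending only on w, such that ℋ²(Σ ∩ B_R(p)) ≤ C·R² for every p ∈ ℝ³ and every R > 0, where B_R(p) is the Euclidean ball of radius R about p. In particular the entropy λ(Σ) is finite. -/

import Mathlib

open MeasureTheory Metric Real EuclideanSpace
open scoped RealInnerProductSpace ENNReal NNReal

noncomputable section

abbrev E3 : Type := EuclideanSpace ℝ (Fin 3)

def e1 : E3 := EuclideanSpace.single 0 1
def e2 : E3 := EuclideanSpace.single 1 1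
def e3 : E3 := EuclideanSpace.single 2 1

/-- First partial derivative of `u` in the first variable. -/
def pds (u : ℝ × ℝ → ℝ) (p : ℝ × ℝ) : ℝ := fderiv ℝ u p (1, 0)

/-- First partial derivative of `u` in the second variable. -/
def pdt (u : ℝ × ℝ → ℝ) (p : ℝ × ℝ) : ℝ := fderiv ℝ u p (0, 1)

/-- `S` is a translating graph in the direction of the unit vector `v`, with respect to the
orthonormal basis `(a, b, v)` of `ℝ³`, over the open connected domain `Ω ⊆ ℝ²`, given by the
smooth function `u : Ω → ℝ` solving the translator equation. -/
structure IsTranslatingGraph (a b v : E3) (Ω : Set (ℝ × ℝ)) (u : ℝ × ℝ → ℝ)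
    (S : Set E3) : Prop where
  norm_a : ‖a‖ = 1
  norm_b : ‖b‖ = 1
  norm_v : ‖v‖ = 1
  inner_ab : ⟪a, b⟫ = 0
  inner_av : ⟪a, v⟫ = 0
  inner_bv : ⟪b, v⟫ = 0
  isOpen_dom : IsOpen Ω
  isConnected_dom : IsConnected Ω
  smooth : ContDiffOn ℝ (⊤ : ℕ∞) u Ω
  pde : ∀ p ∈ Ω,
    (1 + (pdt u p) ^ 2) * pds (fun q => pds u q) p
      - 2 * pds u p * pdt u p * pdt (fun q => pds u q) p
      + (1 + (pds u p) ^ 2) * pdt (fun q => pdt u q) p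
    = (1 + (pds u p) ^ 2 + (pdt u p) ^ 2) *
        (⟪e3, v⟫ - pds u p * ⟪e3, a⟫ - pdt u p * ⟪e3, b⟫)
  graph_eq : S = {q : E3 | ∃ p ∈ Ω, q = p.1 • a + p.2 • b + u p • v}

/-- Entropy of a surface. -/
def entropy (S : Set E3) : ℝ≥0∞ :=
  ⨆ (x₀ : E3) (s₀ : ℝ) (_ : 0 < s₀),
    (ENNReal.ofReal (4 * π * s₀))⁻¹ *
      ∫⁻ q in S, ENNReal.ofReal (Real.exp (-‖q - x₀‖ ^ 2 / (4 * s₀))) ∂(μH[2])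

/-- Number of connected components (as a cardinal). -/
def numComponents (A : Set E3) : Cardinal := Cardinal.mk (ConnectedComponents A)

def vθ (θ : ℝ) : E3 := Real.sin θ • e3 + Real.cos θ • e2
def bθ (θ : ℝ) : E3 := Real.cos θ • e3 - Real.sin θ • e2

/-- The point of the translating graph over parameter `p`, for the basis `(e₁, b_θ, v_θ)`. -/
def graphPtθ (θ : ℝ) (u : ℝ × ℝ → ℝ) (p : ℝ × ℝ) : E3 :=
  p.1 • e1 + p.2 • bθ θ + u p • vθ θ

/-- The Gauss map of a translating graph in the direction `v_θ`, as a function of the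
parameter `p ∈ Ω`: `N = (v_θ − u_s e₁ − u_t b_θ)/√(1+u_s²+u_t²)`. -/
def gaussMapθ (θ : ℝ) (u : ℝ × ℝ → ℝ) (p : ℝ × ℝ) : E3 :=
  (Real.sqrt (1 + (pds u p) ^ 2 + (pdt u p) ^ 2))⁻¹ •
    (vθ θ - pds u p • e1 - pdt u p • bθ θ)

section Calculus

open Filter Topology

lemma HasFDerivAt.pds_eq {f : ℝ × ℝ → ℝ} {p : ℝ × ℝ} {L : ℝ × ℝ →L[ℝ] ℝ}
    (h : HasFDerivAt f L p) : pds f p = L (1, 0) := by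
  rw [pds, h.fderiv]

lemma HasFDerivAt.pdt_eq {f : ℝ × ℝ → ℝ} {p : ℝ × ℝ} {L : ℝ × ℝ →L[ℝ] ℝ}
    (h : HasFDerivAt f L p) : pdt f p = L (0, 1) := by
  rw [pdt, h.fderiv]

lemma fderiv_apply_eq_pds_pdt (f : ℝ × ℝ → ℝ) (p ξ : ℝ × ℝ) :
    fderiv ℝ f p ξ = ξ.1 * pds f p + ξ.2 * pdt f p := by
  have h : ξ = ξ.1 • ((1, 0) : ℝ × ℝ) + ξ.2 • ((0, 1) : ℝ × ℝ) := by ext <;> simp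
  conv_lhs => rw [h]
  simp only [map_add, map_smul, smul_eq_mul, pds, pdt]

lemma ContDiffAt.pds {f : ℝ × ℝ → ℝ} {p : ℝ × ℝ} {m n : WithTop ℕ∞} (h : ContDiffAt ℝ n f p)
    (hmn : m + 1 ≤ n) : ContDiffAt ℝ m (pds f) p :=
  (h.fderiv_right hmn).clm_apply contDiffAt_const

lemma ContDiffAt.pdt {f : ℝ × ℝ → ℝ} {p : ℝ × ℝ} {m n : WithTop ℕ∞} (h : ContDiffAt ℝ n f p)
    (hmn : m + 1 ≤ n) : ContDiffAt ℝ m (pdt f) p :=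
  (h.fderiv_right hmn).clm_apply contDiffAt_const

lemma pds_pdt_comm {f : ℝ × ℝ → ℝ} {p : ℝ × ℝ} (h : ContDiffAt ℝ 2 f p) :
    pds (pdt f) p = pdt (pds f) p := by
  have hs : IsSymmSndFDerivAt ℝ f p := h.isSymmSndFDerivAt (by simp)
  have hd : DifferentiableAt ℝ (fderiv ℝ f) p :=
    (h.fderiv_right (m := 1) (by norm_num)).differentiableAt (by norm_num)
  have key : ∀ a b : ℝ × ℝ, fderiv ℝ (fun q => fderiv ℝ f q a) p b
      = fderiv ℝ (fderiv ℝ f) p b a := by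
    intro a b
    rw [fderiv_clm_apply hd (differentiableAt_const _)]
    simp
  change fderiv ℝ (fun q => fderiv ℝ f q (0, 1)) p (1, 0)
    = fderiv ℝ (fun q => fderiv ℝ f q (1, 0)) p (0, 1)
  rw [key, key]
  exact hs _ _

lemma deriv_deriv_nonpos_of_isLocalMax {φ : ℝ → ℝ} {x : ℝ} (h : IsLocalMax φ x)
    (hc : ContinuousAt φ x) : deriv (deriv φ) x ≤ 0 := by
  by_contra! hpos
  have hmin := isLocalMin_of_deriv_deriv_pos hpos h.deriv_eq_zero hc
  have hconst : φ =ᶠ[𝓝 x] fun _ => φ x := by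
    filter_upwards [h, hmin] with y h1 h2 using le_antisymm h1 h2
  have : deriv (deriv φ) x = 0 := by
    rw [hconst.deriv.deriv_eq]; simp
  linarith

/-- At a local maximum the Hessian is negative semidefinite. -/
lemma hessian_nonpos_of_isLocalMax {Φ : ℝ × ℝ → ℝ} {x : ℝ × ℝ} (hΦ : ContDiffAt ℝ 2 Φ x)
    (hmax : IsLocalMax Φ x) (a b : ℝ) :
    a ^ 2 * pds (pds Φ) x + 2 * (a * b) * pdt (pds Φ) x + b ^ 2 * pdt (pdt Φ) x ≤ 0 := by
  set c : ℝ → ℝ × ℝ := fun τ => x + τ • (a, b) with hcdef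
  have hc : ∀ τ, HasDerivAt c (a, b) τ := by
    intro τ
    have := ((hasDerivAt_id τ).smul_const ((a, b) : ℝ × ℝ)).const_add x
    rwa [one_smul] at this
  have hc0 : c 0 = x := by simp [hcdef]
  have hcc : ContinuousAt c 0 := (hc 0).continuousAt
  have hmax' : IsLocalMax (fun τ => Φ (c τ)) 0 := by
    have : Tendsto c (𝓝 0) (𝓝 x) := by rw [← hc0]; exact hcc
    have := this.eventually hmax
    rw [← hc0] at this
    exact this
  have hcont : ContinuousAt (fun τ => Φ (c τ)) 0 := by
    refine ContinuousAt.comp (f := c) ?_ hcc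
    rw [hc0]; exact hΦ.continuousAt
  have hev : ∀ᶠ τ in 𝓝 (0 : ℝ), deriv (fun τ => Φ (c τ)) τ
      = a * pds Φ (c τ) + b * pdt Φ (c τ) := by
    have h1 : ∀ᶠ y in 𝓝 x, ContDiffAt ℝ 2 Φ y := hΦ.eventually (by norm_num)
    have : Tendsto c (𝓝 0) (𝓝 x) := by rw [← hc0]; exact hcc
    filter_upwards [this.eventually h1] with τ hτ
    have hd := (hτ.differentiableAt (by norm_num)).hasFDerivAt.comp_hasDerivAt τ (hc τ)
    have := hd.deriv
    rw [Function.comp_def] at this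
    rw [this, fderiv_apply_eq_pds_pdt]
  have h2 : deriv (deriv (fun τ => Φ (c τ))) 0
      = a ^ 2 * pds (pds Φ) x + 2 * (a * b) * pdt (pds Φ) x + b ^ 2 * pdt (pdt Φ) x := by
    have e : deriv (fun τ => Φ (c τ)) =ᶠ[𝓝 0] fun τ => a * pds Φ (c τ) + b * pdt Φ (c τ) := hev
    rw [e.deriv_eq]
    have hs : DifferentiableAt ℝ (pds Φ) (c 0) := by
      rw [hc0]; exact (hΦ.pds (m := 1) (by norm_num)).differentiableAt (by norm_num)
    have ht : DifferentiableAt ℝ (pdt Φ) (c 0) := by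
      rw [hc0]; exact (hΦ.pdt (m := 1) (by norm_num)).differentiableAt (by norm_num)
    have d1 := (hs.hasFDerivAt.comp_hasDerivAt 0 (hc 0)).const_mul a
    have d2 := (ht.hasFDerivAt.comp_hasDerivAt 0 (hc 0)).const_mul b
    have := (d1.add d2).deriv
    simp only [Function.comp_def, Pi.add_def] at this
    rw [this, fderiv_apply_eq_pds_pdt, fderiv_apply_eq_pds_pdt, hc0, pds_pdt_comm hΦ]
    simp only
    ring
  rw [← h2]
  exact deriv_deriv_nonpos_of_isLocalMax hmax' hcont

end Calculus

section MaximumPrinciple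

open Filter Topology

/-- The planar data of a complete translating graph: the velocity `e₃` has components
`(α₁, α₂, γ)` in the basis of the graph, and completeness says that the part of the graph over a
compact set and between two heights is compact. -/
structure PlanarTranslator (α₁ α₂ γ : ℝ) (Ω : Set (ℝ × ℝ)) (u : ℝ × ℝ → ℝ) : Prop where
  isOpen : IsOpen Ω
  isConnected : IsConnected Ω
  smooth : ContDiffOn ℝ (⊤ : ℕ∞) u Ω
  pde : ∀ p ∈ Ω,
    (1 + (pdt u p) ^ 2) * pds (pds u) p - 2 * pds u p * pdt u p * pdt (pds u) p
      + (1 + (pds u p) ^ 2) * pdt (pdt u) p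
    = (1 + (pds u p) ^ 2 + (pdt u p) ^ 2) * (γ - pds u p * α₁ - pdt u p * α₂)
  norm_le : α₁ ^ 2 + α₂ ^ 2 + γ ^ 2 ≤ 1
  isCompact_slice : ∀ K : Set (ℝ × ℝ), IsCompact K → ∀ h l : ℝ,
    IsCompact {x | x ∈ K ∧ x ∈ Ω ∧ |u x - h| ≤ l}

/-- `|∇G|³` times the excess of the curvature of the level sets of `G` over that of translating
curves with velocity `(α₁, α₂)`. -/
def levelOp (α₁ α₂ : ℝ) (G : ℝ × ℝ → ℝ) (x : ℝ × ℝ) : ℝ :=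
  pds (pds G) x * pdt G x ^ 2 - 2 * pdt (pds G) x * pds G x * pdt G x
    + pdt (pdt G) x * pds G x ^ 2
    + (pds G x ^ 2 + pdt G x ^ 2) * (α₁ * pds G x + α₂ * pdt G x)

variable {α₁ α₂ γ : ℝ} {Ω : Set (ℝ × ℝ)} {u : ℝ × ℝ → ℝ}

lemma PlanarTranslator.contDiffAt (h : PlanarTranslator α₁ α₂ γ Ω u) {x : ℝ × ℝ} (hx : x ∈ Ω) :
    ContDiffAt ℝ (⊤ : ℕ∞) u x :=
  h.smooth.contDiffAt (h.isOpen.mem_nhds hx)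

lemma PlanarTranslator.continuousOn (h : PlanarTranslator α₁ α₂ γ Ω u) : ContinuousOn u Ω :=
  h.smooth.continuousOn

lemma levelOp_algebra {μ κ p q Gs Gt Gss Gst Gtt uss ust utt α₁ α₂ γ : ℝ}
    (hs : Gs = 2 * κ * p) (ht : Gt = 2 * κ * q)
    (h1 : Gss - 2 * μ * p ^ 2 - 2 * κ * uss ≤ 0)
    (h2 : Gtt - 2 * μ * q ^ 2 - 2 * κ * utt ≤ 0)
    (h3 : q ^ 2 * (Gss - 2 * μ * p ^ 2 - 2 * κ * uss)
      + 2 * (q * (-p)) * (Gst - 2 * μ * (p * q) - 2 * κ * ust)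
      + (-p) ^ 2 * (Gtt - 2 * μ * q ^ 2 - 2 * κ * utt) ≤ 0)
    (hp : (1 + q ^ 2) * uss - 2 * p * q * ust + (1 + p ^ 2) * utt
      = (1 + p ^ 2 + q ^ 2) * (γ - p * α₁ - q * α₂)) :
    Gss * Gt ^ 2 - 2 * Gst * Gs * Gt + Gtt * Gs ^ 2 + (Gs ^ 2 + Gt ^ 2) * (α₁ * Gs + α₂ * Gt)
      ≤ 2 * μ * (Gs ^ 2 + Gt ^ 2) + 2 * κ * γ * (4 * κ ^ 2 + (Gs ^ 2 + Gt ^ 2))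
        - 4 * κ ^ 2 * (Gss + Gtt + (α₁ * Gs + α₂ * Gt)) := by
  subst hs ht
  have hk : 0 ≤ 4 * κ ^ 2 := by positivity
  have := mul_nonpos_of_nonneg_of_nonpos hk (add_nonpos (add_nonpos h1 h2) h3)
  have e : 8 * κ ^ 3 * ((1 + q ^ 2) * uss - 2 * p * q * ust + (1 + p ^ 2) * utt)
      = 8 * κ ^ 3 * ((1 + p ^ 2 + q ^ 2) * (γ - p * α₁ - q * α₂)) := by rw [hp]
  linarith

/-- The differential inequality at an interior maximum of `G - μ (u - n)²`. -/
lemma PlanarTranslator.levelOp_le_of_isLocalMax (h : PlanarTranslator α₁ α₂ γ Ω u)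
    {G : ℝ × ℝ → ℝ} (hG : ContDiff ℝ (⊤ : ℕ∞) G) {x : ℝ × ℝ} (hx : x ∈ Ω) (μ n : ℝ)
    (hmax : IsLocalMax (fun y => G y - μ * (u y - n) ^ 2) x) :
    levelOp α₁ α₂ G x ≤ 2 * μ * (pds G x ^ 2 + pdt G x ^ 2)
      + 2 * (μ * (u x - n)) * γ * (4 * (μ * (u x - n)) ^ 2 + (pds G x ^ 2 + pdt G x ^ 2))
      - 4 * (μ * (u x - n)) ^ 2 *
        (pds (pds G) x + pdt (pdt G) x + (α₁ * pds G x + α₂ * pdt G x)) := by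
  have hu := h.contDiffAt hx
  have hΦ : ContDiffAt ℝ (⊤ : ℕ∞) (fun y => G y - μ * (u y - n) ^ 2) x :=
    hG.contDiffAt.sub (contDiffAt_const.mul ((hu.sub contDiffAt_const).pow 2))
  have hΦ2 : ContDiffAt ℝ 2 (fun y => G y - μ * (u y - n) ^ 2) x :=
    contDiffAt_infty.1 hΦ 2
  have first : ∀ y ∈ Ω, HasFDerivAt (fun y => G y - μ * (u y - n) ^ 2)
      (fderiv ℝ G y - (2 * μ * (u y - n)) • fderiv ℝ u y) y := by
    intro y hy
    have h1 := (hG.differentiable (by simp) y).hasFDerivAt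
    have h2 := ((h.contDiffAt hy).differentiableAt (by simp)).hasFDerivAt
    refine (h1.sub (((h2.sub_const n).pow 2).const_mul μ)).congr_fderiv ?_
    ext <;> simp <;> ring
  have fs : ∀ y ∈ Ω, pds (fun y => G y - μ * (u y - n) ^ 2) y
      = pds G y - 2 * μ * (u y - n) * pds u y := fun y hy => by
    rw [(first y hy).pds_eq]; simp [pds]
  have ft : ∀ y ∈ Ω, pdt (fun y => G y - μ * (u y - n) ^ 2) y
      = pdt G y - 2 * μ * (u y - n) * pdt u y := fun y hy => by
    rw [(first y hy).pdt_eq]; simp [pdt]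
  have hnx : ∀ᶠ y in 𝓝 x, y ∈ Ω := h.isOpen.mem_nhds hx
  have es : pds (fun y => G y - μ * (u y - n) ^ 2) =ᶠ[𝓝 x]
      fun y => pds G y - 2 * μ * (u y - n) * pds u y := hnx.mono fs
  have et : pdt (fun y => G y - μ * (u y - n) ^ 2) =ᶠ[𝓝 x]
      fun y => pdt G y - 2 * μ * (u y - n) * pdt u y := hnx.mono ft
  have dG : ∀ {f : ℝ × ℝ → ℝ}, ContDiffAt ℝ (⊤ : ℕ∞) f x →
      DifferentiableAt ℝ (pds f) x ∧ DifferentiableAt ℝ (pdt f) x := by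
    intro f hf
    have hf2 : ContDiffAt ℝ 2 f x := contDiffAt_infty.1 hf 2
    exact ⟨(hf2.pds (m := 1) (by norm_num)).differentiableAt (by norm_num),
      (hf2.pdt (m := 1) (by norm_num)).differentiableAt (by norm_num)⟩
  have hdu := (hu.differentiableAt (by simp)).hasFDerivAt
  have second : ∀ {g w : ℝ × ℝ → ℝ}, DifferentiableAt ℝ g x → DifferentiableAt ℝ w x →
      HasFDerivAt (fun y => g y - 2 * μ * (u y - n) * w y)
        (fderiv ℝ g x - ((2 * μ * (u x - n)) • fderiv ℝ w x
          + w x • ((2 * μ) • fderiv ℝ u x))) x := by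
    intro g w hg hw
    exact hg.hasFDerivAt.sub (((hdu.sub_const n).const_mul (2 * μ)).mul hw.hasFDerivAt)
  have hGx := dG (hG.contDiffAt (x := x))
  have hux := dG hu
  have ess : pds (pds (fun y => G y - μ * (u y - n) ^ 2)) x
      = pds (pds G) x - 2 * μ * pds u x ^ 2 - 2 * (μ * (u x - n)) * pds (pds u) x := by
    rw [show pds (pds (fun y => G y - μ * (u y - n) ^ 2)) x = _ from
      congrArg (fun L : ℝ × ℝ →L[ℝ] ℝ => L (1, 0)) es.fderiv_eq, (second hGx.1 hux.1).fderiv]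
    simp [pds]; ring
  have est : pdt (pds (fun y => G y - μ * (u y - n) ^ 2)) x
      = pdt (pds G) x - 2 * μ * (pds u x * pdt u x) - 2 * (μ * (u x - n)) * pdt (pds u) x := by
    rw [show pdt (pds (fun y => G y - μ * (u y - n) ^ 2)) x = _ from
      congrArg (fun L : ℝ × ℝ →L[ℝ] ℝ => L (0, 1)) es.fderiv_eq, (second hGx.1 hux.1).fderiv]
    simp [pdt]; ring
  have ett : pdt (pdt (fun y => G y - μ * (u y - n) ^ 2)) x
      = pdt (pdt G) x - 2 * μ * pdt u x ^ 2 - 2 * (μ * (u x - n)) * pdt (pdt u) x := by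
    rw [show pdt (pdt (fun y => G y - μ * (u y - n) ^ 2)) x = _ from
      congrArg (fun L : ℝ × ℝ →L[ℝ] ℝ => L (0, 1)) et.fderiv_eq, (second hGx.2 hux.2).fderiv]
    simp [pdt]; ring
  have h0 : ∀ ξ, fderiv ℝ (fun y => G y - μ * (u y - n) ^ 2) x ξ = 0 := by
    intro ξ; rw [hmax.fderiv_eq_zero]; simp
  have hs := h0 (1, 0)
  have ht := h0 (0, 1)
  change pds (fun y => G y - μ * (u y - n) ^ 2) x = 0 at hs
  change pdt (fun y => G y - μ * (u y - n) ^ 2) x = 0 at ht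
  rw [fs x hx] at hs
  rw [ft x hx] at ht
  have hess := hessian_nonpos_of_isLocalMax hΦ2 hmax
  simp only [ess, est, ett] at hess
  refine levelOp_algebra (p := pds u x) (q := pdt u x) (uss := pds (pds u) x)
    (ust := pdt (pds u) x) (utt := pdt (pdt u) x) ?_ ?_ ?_ ?_ ?_ (h.pde x hx)
  · linarith
  · linarith
  · have := hess 1 0; linarith
  · have := hess 0 1; linarith
  · exact hess (pdt u x) (-pds u x)

lemma levelOp_continuous {G : ℝ × ℝ → ℝ} (hG : ContDiff ℝ (⊤ : ℕ∞) G) :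
    Continuous (pds G) ∧ Continuous (pdt G) ∧ Continuous (pds (pds G)) ∧
      Continuous (pdt (pdt G)) ∧ Continuous (levelOp α₁ α₂ G) := by
  have ps : ∀ {f : ℝ × ℝ → ℝ}, ContDiff ℝ (⊤ : ℕ∞) f → ContDiff ℝ (⊤ : ℕ∞) (pds f) :=
    fun hf => contDiff_iff_contDiffAt.2 fun x => hf.contDiffAt.pds le_rfl
  have pt : ∀ {f : ℝ × ℝ → ℝ}, ContDiff ℝ (⊤ : ℕ∞) f → ContDiff ℝ (⊤ : ℕ∞) (pdt f) :=
    fun hf => contDiff_iff_contDiffAt.2 fun x => hf.contDiffAt.pdt le_rfl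
  have a := (ps hG).continuous
  have b := (pt hG).continuous
  have c := (ps (ps hG)).continuous
  have d := (pt (pt hG)).continuous
  have e := (pt (ps hG)).continuous
  refine ⟨a, b, c, d, ?_⟩
  unfold levelOp
  fun_prop

/-- Maximum principle at infinity: if the level sets of `G` are strictly more curved than
translating curves, then `G` restricted to the complement of the domain of a complete translating
graph has no peak in the interior of a compact set. -/
lemma PlanarTranslator.false_of_peak (h : PlanarTranslator α₁ α₂ γ Ω u)
    {G : ℝ × ℝ → ℝ} (hG : ContDiff ℝ (⊤ : ℕ∞) G) {K : Set (ℝ × ℝ)} (hK : IsCompact K)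
    (hpos : ∀ x ∈ K, 0 < levelOp α₁ α₂ G x) {z : ℝ × ℝ} (hzK : z ∈ K) (hzΩ : z ∉ Ω)
    (hfr : ∀ y ∈ K, y ∉ interior K → y ∉ Ω → G y < G z) : False := by
  obtain ⟨cs, ct, css, ctt, cop⟩ := levelOp_continuous (α₁ := α₁) (α₂ := α₂) hG
  have hGc : Continuous G := hG.continuous
  obtain ⟨z₁, ⟨hz₁K, hz₁Ω⟩, hz₁max⟩ := (hK.diff h.isOpen).exists_isMaxOn ⟨z, hzK, hzΩ⟩
    hGc.continuousOn
  have hzz₁ : G z ≤ G z₁ := hz₁max ⟨hzK, hzΩ⟩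
  have hz₁int : z₁ ∈ interior K := by
    by_contra hn
    linarith [hfr z₁ hz₁K hn hz₁Ω]
  have hFr : IsCompact (K \ interior K) := hK.diff isOpen_interior
  obtain ⟨c, hcz₁, hc⟩ : ∃ c < G z₁, ∀ y ∈ (K \ interior K) \ Ω, G y < c := by
    rcases ((K \ interior K) \ Ω).eq_empty_or_nonempty with he | hne
    · exact ⟨G z₁ - 1, by linarith, by simp [he]⟩
    · obtain ⟨y₁, hy₁, hy₁max⟩ := (hFr.diff h.isOpen).exists_isMaxOn hne hGc.continuousOn
      have h1 : G y₁ < G z₁ := (hfr y₁ hy₁.1.1 hy₁.1.2 hy₁.2).trans_le hzz₁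
      refine ⟨(G y₁ + G z₁) / 2, by linarith, fun y hy => ?_⟩
      have : G y ≤ G y₁ := hy₁max hy
      linarith
  have hA : IsCompact ((K \ interior K) ∩ {y | c ≤ G y}) :=
    hFr.inter_right (isClosed_le continuous_const hGc)
  have hAΩ : (K \ interior K) ∩ {y | c ≤ G y} ⊆ Ω := by
    rintro y ⟨hy, hcy⟩
    by_contra hn
    exact absurd (hc y ⟨hy, hn⟩) (not_lt.2 hcy)
  obtain ⟨M, hM⟩ := hA.exists_bound_of_continuousOn (h.continuousOn.mono hAΩ)
  obtain ⟨x₀, hx₀, hx₀min⟩ := hK.exists_isMinOn ⟨z, hzK⟩ cop.continuousOn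
  have hc₀ := hpos x₀ hx₀
  obtain ⟨B₁, hB₁⟩ := hK.exists_bound_of_continuousOn
    (f := fun x => pds G x ^ 2 + pdt G x ^ 2) (by fun_prop)
  obtain ⟨B₂, hB₂⟩ := hK.exists_bound_of_continuousOn
    (f := fun x => pds (pds G) x + pdt (pdt G) x + (α₁ * pds G x + α₂ * pdt G x))
    (by fun_prop)
  obtain ⟨B₀, hB₀⟩ := hK.exists_bound_of_continuousOn hGc.continuousOn
  set B : ℝ := |B₀ - c| + 1 with hB
  have hBpos : 0 < B := by positivity
  obtain ⟨t, ht0, ht⟩ : ∃ t : ℝ, 0 < t ∧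
      2 * (t ^ 2 / B) * B₁ + 2 * t * (4 * t ^ 2 + B₁) + 4 * t ^ 2 * B₂
        < levelOp α₁ α₂ G x₀ := by
    have hcont : Continuous fun t : ℝ =>
        2 * (t ^ 2 / B) * B₁ + 2 * t * (4 * t ^ 2 + B₁) + 4 * t ^ 2 * B₂ := by fun_prop
    have h0 := hcont.tendsto 0
    norm_num at h0
    have := (h0.eventually (gt_mem_nhds hc₀)).filter_mono (nhdsWithin_le_nhds (s := Set.Ioi 0))
    obtain ⟨t, h1, h2⟩ := (this.and self_mem_nhdsWithin).exists
    exact ⟨t, h2, h1⟩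
  set μ : ℝ := t ^ 2 / B with hμ
  have hμpos : 0 < μ := by positivity
  set l : ℝ := B / t with hl
  have hlpos : 0 < l := by positivity
  have hμl : μ * l = t := by rw [hμ, hl]; field_simp
  have hμll : μ * l ^ 2 = B := by rw [hμ, hl]; field_simp
  have hcl : ∃ x ∈ Ω, x ∈ interior K ∧ c < G x ∧ M + l < |u x| := by
    by_contra! hcon
    have hnb : interior K ∩ {x | c < G x} ∩
        {x | x ∈ K ∧ x ∈ Ω ∧ |u x - 0| ≤ M + l}ᶜ ∈ 𝓝 z₁ := by
      refine inter_mem (inter_mem (isOpen_interior.mem_nhds hz₁int) ?_) ?_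
      · exact (isOpen_lt continuous_const hGc).mem_nhds hcz₁
      · exact (h.isCompact_slice K hK 0 (M + l)).isClosed.isOpen_compl.mem_nhds
          fun hz => hz₁Ω hz.2.1
    have hmax : IsLocalMax G z₁ := by
      filter_upwards [hnb] with x hx
      refine hz₁max ⟨interior_subset hx.1.1, fun hxΩ => ?_⟩
      refine hx.2 ⟨interior_subset hx.1.1, hxΩ, ?_⟩
      rw [sub_zero]
      exact hcon x hxΩ hx.1.1 hx.1.2
    have h0 := hmax.fderiv_eq_zero
    have := hpos z₁ hz₁K
    simp [levelOp, pds, pdt, h0] at this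
  obtain ⟨x₁, hx₁Ω, hx₁K, hx₁c, hx₁u⟩ := hcl
  set n : ℝ := u x₁ with hn
  have hY := h.isCompact_slice K hK n l
  have hYΩ : {x | x ∈ K ∧ x ∈ Ω ∧ |u x - n| ≤ l} ⊆ Ω := fun x hx => hx.2.1
  have huY := h.continuousOn.mono hYΩ
  have hx₁Y : x₁ ∈ {x | x ∈ K ∧ x ∈ Ω ∧ |u x - n| ≤ l} :=
    ⟨interior_subset hx₁K, hx₁Ω, by simp [hn, hlpos.le]⟩
  obtain ⟨x, hxY, hxmax⟩ := hY.exists_isMaxOn (f := fun y => G y - μ * (u y - n) ^ 2)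
    ⟨x₁, hx₁Y⟩ (by fun_prop)
  have hxge : G x₁ - μ * (u x₁ - n) ^ 2 ≤ G x - μ * (u x - n) ^ 2 := hxmax hx₁Y
  rw [← hn, sub_self] at hxge
  have hGx : c < G x := by nlinarith [mul_nonneg hμpos.le (sq_nonneg (u x - n))]
  have hGB : G x ≤ B₀ := (le_abs_self _).trans (hB₀ x hxY.1)
  have hul : |u x - n| < l := by
    refine abs_lt_of_sq_lt_sq ?_ hlpos.le
    have : μ * (u x - n) ^ 2 < μ * l ^ 2 := by
      rw [hμll, hB]
      nlinarith [le_abs_self (B₀ - c)]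
    exact lt_of_mul_lt_mul_left this hμpos.le
  have hxint : x ∈ interior K := by
    by_contra hni
    have h1 := hM x ⟨⟨hxY.1, hni⟩, hGx.le⟩
    rw [Real.norm_eq_abs] at h1
    have h2 : |n| ≤ |u x| + |u x - n| := by
      have := abs_sub (u x) (u x - n)
      rwa [sub_sub_cancel] at this
    linarith
  have hloc : IsLocalMax (fun y => G y - μ * (u y - n) ^ 2) x := by
    have hcu : ContinuousAt u x := (h.contDiffAt hxY.2.1).continuousAt
    have hlt : ∀ᶠ y in 𝓝 x, |u y - n| < l :=
      ((hcu.sub continuousAt_const).abs).eventually (gt_mem_nhds hul)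
    filter_upwards [isOpen_interior.mem_nhds hxint, h.isOpen.mem_nhds hxY.2.1, hlt]
      with y h1 h2 h3
    exact hxmax ⟨interior_subset h1, h2, h3.le⟩
  have key := h.levelOp_le_of_isLocalMax hG hxY.2.1 μ n hloc
  set κ : ℝ := μ * (u x - n) with hκ
  have hκt : |κ| ≤ t := by
    rw [hκ, abs_mul, abs_of_pos hμpos, ← hμl]
    gcongr
  have hγ : |γ| ≤ 1 := by
    rw [← sq_le_one_iff_abs_le_one]
    nlinarith [h.norm_le, sq_nonneg α₁, sq_nonneg α₂]
  have b1 := (le_abs_self _).trans (hB₁ x hxY.1)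
  have b2 := hB₂ x hxY.1
  rw [Real.norm_eq_abs] at b2
  have bm := hx₀min hxY.1
  set D := pds G x ^ 2 + pdt G x ^ 2 with hD
  set E := pds (pds G) x + pdt (pdt G) x + (α₁ * pds G x + α₂ * pdt G x) with hE
  have hD0 : 0 ≤ D := by positivity
  have hκ2 : κ ^ 2 ≤ t ^ 2 := sq_le_sq' (by linarith [neg_abs_le κ]) ((le_abs_self κ).trans hκt)
  have t1 : 2 * μ * D ≤ 2 * (t ^ 2 / B) * B₁ := by gcongr
  have t2 : 2 * κ * γ * (4 * κ ^ 2 + D) ≤ 2 * t * (4 * t ^ 2 + B₁) := by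
    have : κ * γ ≤ t := by
      calc κ * γ ≤ |κ * γ| := le_abs_self _
        _ = |κ| * |γ| := abs_mul _ _
        _ ≤ t * 1 := by gcongr
        _ = t := mul_one t
    calc 2 * κ * γ * (4 * κ ^ 2 + D) = 2 * (κ * γ) * (4 * κ ^ 2 + D) := by ring
      _ ≤ 2 * t * (4 * κ ^ 2 + D) := by gcongr
      _ ≤ 2 * t * (4 * t ^ 2 + B₁) := by gcongr
  have t3 : -(4 * κ ^ 2 * E) ≤ 4 * t ^ 2 * B₂ := by
    calc -(4 * κ ^ 2 * E) = 4 * κ ^ 2 * (-E) := by ring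
      _ ≤ 4 * κ ^ 2 * B₂ := by gcongr; exact (neg_le_abs E).trans b2
      _ ≤ 4 * t ^ 2 * B₂ := by gcongr; exact (abs_nonneg E).trans b2
  have bm' : levelOp α₁ α₂ G x₀ ≤ levelOp α₁ α₂ G x := bm
  linarith

end MaximumPrinciple

section Charts

open Filter Topology Set

/-- A flat chart for translating curves: in the chart, the functions `A x + B y + D (x² + y²)`
with `D > 0` are strict subsolutions of the level set equation away from their critical point. -/
def IsFlatChart (α₁ α₂ : ℝ) (e : OpenPartialHomeomorph (ℝ × ℝ) ℂ) : Prop :=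
  ∀ A B D : ℝ, 0 < D → ∃ G : ℝ × ℝ → ℝ, ContDiff ℝ (⊤ : ℕ∞) G ∧ ∀ x ∈ e.source,
    G x = A * (e x).re + B * (e x).im + D * ((e x).re ^ 2 + (e x).im ^ 2) ∧
    ((A + 2 * D * (e x).re ≠ 0 ∨ B + 2 * D * (e x).im ≠ 0) → 0 < levelOp α₁ α₂ G x)

variable {α₁ α₂ γ : ℝ} {Ω : Set (ℝ × ℝ)} {u : ℝ × ℝ → ℝ}

/-- The closed standard triangle in the plane. -/
def stdTriangle : Set (ℝ × ℝ) := {x | 0 ≤ x.1 ∧ 0 ≤ x.2 ∧ x.1 + x.2 ≤ 1}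

lemma isCompact_stdTriangle : IsCompact stdTriangle := by
  have h1 : IsClosed stdTriangle := by
    refine (isClosed_le continuous_const continuous_fst).inter
      ((isClosed_le continuous_const continuous_snd).inter
        (isClosed_le (continuous_fst.add continuous_snd) continuous_const))
  refine (isCompact_Icc (a := ((0, 0) : ℝ × ℝ)) (b := (1, 1))).of_isClosed_subset h1 ?_
  rintro ⟨s, t⟩ ⟨hs, ht, hst⟩
  simp only at hs ht hst
  exact ⟨⟨hs, ht⟩, ⟨by simp only; linarith, by simp only; linarith⟩⟩

/-- Affine coordinates of the complex plane with origin `a` and independent axes `P`, `Q`. -/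
def affineCoord (a P Q : ℂ) (hPQ : P.re * Q.im - P.im * Q.re ≠ 0) : (ℝ × ℝ) ≃ₜ ℂ where
  toFun x := a + (x.1 * P + x.2 * Q)
  invFun X := (((X - a).re * Q.im - (X - a).im * Q.re) / (P.re * Q.im - P.im * Q.re),
    (P.re * (X - a).im - P.im * (X - a).re) / (P.re * Q.im - P.im * Q.re))
  left_inv x := by
    ext
    · simp only [add_sub_cancel_left, Complex.add_re, Complex.add_im, Complex.re_ofReal_mul,
        Complex.im_ofReal_mul]
      rw [div_eq_iff hPQ]
      ring
    · simp only [add_sub_cancel_left, Complex.add_re, Complex.add_im, Complex.re_ofReal_mul,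
        Complex.im_ofReal_mul]
      rw [div_eq_iff hPQ]
      ring
  right_inv X := by
    apply Complex.ext
    · simp only [Complex.add_re, Complex.re_ofReal_mul, Complex.sub_re, Complex.sub_im]
      rw [div_mul_eq_mul_div, div_mul_eq_mul_div, ← add_div, ← eq_sub_iff_add_eq', div_eq_iff hPQ]
      ring
    · simp only [Complex.add_im, Complex.im_ofReal_mul, Complex.sub_re, Complex.sub_im]
      rw [div_mul_eq_mul_div, div_mul_eq_mul_div, ← add_div, ← eq_sub_iff_add_eq', div_eq_iff hPQ]
      ring
  continuous_toFun := by fun_prop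
  continuous_invFun := by fun_prop

lemma affineCoord_apply (a P Q : ℂ) (hPQ : P.re * Q.im - P.im * Q.re ≠ 0) (x : ℝ × ℝ) :
    affineCoord a P Q hPQ x = a + (x.1 * P + x.2 * Q) := rfl

lemma PlanarTranslator.mem_of_triangle_of_edges (h : PlanarTranslator α₁ α₂ γ Ω u)
    {e : OpenPartialHomeomorph (ℝ × ℝ) ℂ} (he : IsFlatChart α₁ α₂ e) {a P Q : ℂ}
    (hPQ : P.re * Q.im - P.im * Q.re ≠ 0)
    (hT : ∀ x ∈ stdTriangle, affineCoord a P Q hPQ x ∈ e.target)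
    (h0 : ∀ x ∈ stdTriangle, x.1 = 0 ∨ x.2 = 0 → e.symm (affineCoord a P Q hPQ x) ∈ Ω)
    {x : ℝ × ℝ} (hx : x ∈ stdTriangle) (hx1 : x.1 + x.2 < 1) :
    e.symm (affineCoord a P Q hPQ x) ∈ Ω := by
  set F := affineCoord a P Q hPQ with hF
  set Δ := P.re * Q.im - P.im * Q.re with hΔ
  by_contra hxΩ
  set A := -(Q.im - P.im) / Δ with hA
  set B := -(P.re - Q.re) / Δ with hB
  have hAB : A ^ 2 + B ^ 2 ≠ 0 := by
    intro h
    have h1 : A = 0 := by nlinarith [sq_nonneg A, sq_nonneg B]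
    have h2 : B = 0 := by nlinarith [sq_nonneg A, sq_nonneg B]
    rw [hA, div_eq_zero_iff, or_iff_left hPQ] at h1
    rw [hB, div_eq_zero_iff, or_iff_left hPQ] at h2
    apply hPQ
    have h3 : Q.im = P.im := by linarith
    have h4 : P.re = Q.re := by linarith
    rw [hΔ, h3, h4]; ring
  have hlin : ∀ y : ℝ × ℝ,
      A * (F y).re + B * (F y).im = A * a.re + B * a.im - (y.1 + y.2) := by
    intro y
    rw [hF, affineCoord_apply, hA, hB]
    simp
    field_simp
    rw [hΔ]
    ring
  obtain ⟨R, hR⟩ := isCompact_stdTriangle.exists_bound_of_continuousOn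
    (f := fun y => (F y).re ^ 2 + (F y).im ^ 2) (by
      have := F.continuous
      fun_prop)
  have hR0 : 0 ≤ R := (norm_nonneg _).trans (hR x hx)
  obtain ⟨D, hD, hD1, hD2⟩ : ∃ D : ℝ, 0 < D ∧ D * R < 1 - (x.1 + x.2) ∧
      4 * D ^ 2 * R < A ^ 2 + B ^ 2 := by
    have c1 : Continuous fun D : ℝ => D * R := by fun_prop
    have c2 : Continuous fun D : ℝ => 4 * D ^ 2 * R := by fun_prop
    have e1 : ∀ᶠ D : ℝ in 𝓝 0, D * R < 1 - (x.1 + x.2) :=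
      (c1.tendsto 0).eventually_lt_const (by rw [zero_mul]; linarith)
    have e2 : ∀ᶠ D : ℝ in 𝓝 0, 4 * D ^ 2 * R < A ^ 2 + B ^ 2 :=
      (c2.tendsto 0).eventually_lt_const (by
        have : 0 < A ^ 2 + B ^ 2 := lt_of_le_of_ne (by positivity) hAB.symm
        simpa using this)
    obtain ⟨D, ⟨h1, h2⟩, h3⟩ := (((e1.and e2).filter_mono
      (nhdsWithin_le_nhds (s := Set.Ioi 0))).and self_mem_nhdsWithin).exists
    exact ⟨D, h3, h1, h2⟩
  obtain ⟨G, hG, hGe⟩ := he A B D hD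
  have hsrc : ∀ y ∈ stdTriangle, e.symm (F y) ∈ e.source := fun y hy => e.map_target (hT y hy)
  have hright : ∀ y ∈ stdTriangle, e (e.symm (F y)) = F y := fun y hy => e.right_inv (hT y hy)
  have hGF : ∀ y ∈ stdTriangle, G (e.symm (F y)) =
      A * a.re + B * a.im - (y.1 + y.2) + D * ((F y).re ^ 2 + (F y).im ^ 2) := by
    intro y hy
    rw [(hGe _ (hsrc y hy)).1, hright y hy, hlin]
  have hcomp : IsCompact ((fun y => e.symm (F y)) '' stdTriangle) :=
    isCompact_stdTriangle.image_of_continuousOn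
      (e.continuousOn_symm.comp F.continuous.continuousOn hT)
  refine h.false_of_peak hG hcomp ?_ (z := e.symm (F x)) ⟨x, hx, rfl⟩ hxΩ ?_
  · rintro _ ⟨y, hy, rfl⟩
    refine (hGe _ (hsrc y hy)).2 ?_
    rw [hright y hy]
    by_contra! hcon
    have h1 : A ^ 2 + B ^ 2 = 4 * D ^ 2 * ((F y).re ^ 2 + (F y).im ^ 2) := by
      rw [show A = -(2 * D * (F y).re) by linarith [hcon.1],
        show B = -(2 * D * (F y).im) by linarith [hcon.2]]
      ring
    have h2 := (le_abs_self _).trans (hR y hy)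
    have : 4 * D ^ 2 * ((F y).re ^ 2 + (F y).im ^ 2) ≤ 4 * D ^ 2 * R := by gcongr
    linarith
  · rintro _ ⟨y, hy, rfl⟩ hyi hyΩ
    have hy1 : y.1 + y.2 = 1 := by
      by_contra hne
      have hlt : y.1 + y.2 < 1 := lt_of_le_of_ne hy.2.2 hne
      have hp : 0 < y.1 ∧ 0 < y.2 := by
        constructor
        · exact lt_of_le_of_ne hy.1 fun h' => hyΩ (h0 y hy (Or.inl h'.symm))
        · exact lt_of_le_of_ne hy.2.1 fun h' => hyΩ (h0 y hy (Or.inr h'.symm))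
      apply hyi
      have hop : IsOpen {y : ℝ × ℝ | 0 < y.1 ∧ 0 < y.2 ∧ y.1 + y.2 < 1} :=
        (isOpen_lt continuous_const continuous_fst).inter
          ((isOpen_lt continuous_const continuous_snd).inter
            (isOpen_lt (continuous_fst.add continuous_snd) continuous_const))
      have hsub : {y : ℝ × ℝ | 0 < y.1 ∧ 0 < y.2 ∧ y.1 + y.2 < 1} ⊆ stdTriangle :=
        fun y hy => ⟨hy.1.le, hy.2.1.le, hy.2.2.le⟩
      have hop2 : IsOpen (e.symm '' (F '' {y : ℝ × ℝ | 0 < y.1 ∧ 0 < y.2 ∧ y.1 + y.2 < 1})) := by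
        refine e.isOpen_image_symm_of_subset_target (F.isOpenMap _ hop) ?_
        rintro _ ⟨y, hy, rfl⟩
        exact hT y (hsub hy)
      refine mem_interior.2 ⟨_, ?_, hop2, ⟨F y, ⟨y, ⟨hp.1, hp.2, hlt⟩, rfl⟩, rfl⟩⟩
      rintro _ ⟨_, ⟨y, hy, rfl⟩, rfl⟩
      exact ⟨y, hsub hy, rfl⟩
    change G (e.symm (F y)) < G (e.symm (F x))
    rw [hGF y hy, hGF x hx, hy1]
    have h2 := (le_abs_self _).trans (hR y hy)
    have : D * ((F y).re ^ 2 + (F y).im ^ 2) ≤ D * R := by gcongr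
    have : 0 ≤ D * ((F x).re ^ 2 + (F x).im ^ 2) := by positivity
    linarith

lemma segment_subset_union_of_collinear {a p b : ℂ}
    (hd : (p - a).re * (b - a).im - (p - a).im * (b - a).re = 0) :
    segment ℝ p b ⊆ segment ℝ a p ∪ segment ℝ a b := by
  by_cases hpa : p = a
  · subst hpa; exact subset_union_right
  obtain ⟨k, hk⟩ : ∃ k : ℝ, b - a = k * (p - a) := by
    have hn : (p - a).re ^ 2 + (p - a).im ^ 2 ≠ 0 := by
      intro h
      apply hpa
      apply sub_eq_zero.1
      apply Complex.ext
      · simp only [Complex.zero_re]; nlinarith [sq_nonneg (p - a).re, sq_nonneg (p - a).im]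
      · simp only [Complex.zero_im]; nlinarith [sq_nonneg (p - a).re, sq_nonneg (p - a).im]
    refine ⟨((b - a).re * (p - a).re + (b - a).im * (p - a).im)
      / ((p - a).re ^ 2 + (p - a).im ^ 2), ?_⟩
    set P := p - a
    set Q := b - a
    apply Complex.ext
    · rw [Complex.re_ofReal_mul]
      field_simp
      linear_combination (-P.im) * hd
    · rw [Complex.im_ofReal_mul]
      field_simp
      linear_combination P.re * hd
  have hb : b = a + k * (p - a) := by rw [← hk]; ring
  rw [segment_eq_image' ℝ p b, segment_eq_image' ℝ a p, segment_eq_image' ℝ a b]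
  rintro _ ⟨τ, ⟨h0, h1⟩, rfl⟩
  set m : ℝ := 1 - τ + τ * k with hm
  have hval : p + τ • (b - p) = a + m • (p - a) := by
    rw [hb, hm]
    simp only [Complex.real_smul]
    push_cast
    ring
  simp only [hval]
  rcases lt_or_ge m 0 with hm0 | hm0
  · right
    have hk0 : k < 0 := by
      by_contra! hk0
      nlinarith [mul_nonneg h0 hk0]
    have hkm : k ≤ m := by nlinarith
    refine ⟨m / k, ⟨div_nonneg_of_nonpos hm0.le hk0.le, (div_le_one_of_neg hk0).2 hkm⟩, ?_⟩
    have : (k : ℂ) ≠ 0 := by exact_mod_cast hk0.ne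
    simp only [hk, Complex.real_smul]
    push_cast
    field_simp
  · rcases le_or_gt m 1 with hm1 | hm1
    · exact Or.inl ⟨m, ⟨hm0, hm1⟩, rfl⟩
    · right
      have hk1 : 1 < k := by
        by_contra! hk1
        nlinarith [mul_nonneg h0 (sub_nonneg.2 hk1)]
      have hkm : m ≤ k := by nlinarith
      have hk0 : 0 < k := by linarith
      refine ⟨m / k, ⟨div_nonneg hm0 hk0.le, (div_le_one hk0).2 hkm⟩, ?_⟩
      have : (k : ℂ) ≠ 0 := by exact_mod_cast hk0.ne'
      simp only [hk, Complex.real_smul]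
      push_cast
      field_simp

/-- If two sides of a flat triangle lie in the domain of a complete translating graph, then so does
the third one. -/
lemma PlanarTranslator.segment_subset_of_triangle (h : PlanarTranslator α₁ α₂ γ Ω u)
    {e : OpenPartialHomeomorph (ℝ × ℝ) ℂ} (he : IsFlatChart α₁ α₂ e) {a p b : ℂ}
    (hT : ∀ x ∈ stdTriangle, a + (x.1 * (p - a) + x.2 * (b - a)) ∈ e.target)
    (hp : segment ℝ a p ⊆ e.target ∩ e.symm ⁻¹' Ω)
    (hb : segment ℝ a b ⊆ e.target ∩ e.symm ⁻¹' Ω) :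
    segment ℝ p b ⊆ e.target ∩ e.symm ⁻¹' Ω := by
  by_cases hd : (p - a).re * (b - a).im - (p - a).im * (b - a).re = 0
  · exact (segment_subset_union_of_collinear hd).trans (union_subset hp hb)
  have hO : IsOpen (e.target ∩ e.symm ⁻¹' Ω) := e.isOpen_inter_preimage_symm h.isOpen
  set F : ℝ → ℝ × ℝ → ℂ := fun η x =>
    a + (x.1 * (((1 + η : ℝ) : ℂ) * (p - a)) + x.2 * (((1 + η : ℝ) : ℂ) * (b - a))) with hF
  have hFc : Continuous (Function.uncurry F) := by
    rw [hF]; unfold Function.uncurry; fun_prop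
  have hE1 : IsCompact (stdTriangle ∩ {x | x.1 = 0}) :=
    isCompact_stdTriangle.inter_right (isClosed_eq continuous_fst continuous_const)
  have hE2 : IsCompact (stdTriangle ∩ {x | x.2 = 0}) :=
    isCompact_stdTriangle.inter_right (isClosed_eq continuous_snd continuous_const)
  have ev : ∀ {K : Set (ℝ × ℝ)} {V : Set ℂ}, IsCompact K → IsOpen V →
      (∀ x ∈ K, F 0 x ∈ V) → ∀ᶠ η in 𝓝 (0 : ℝ), ∀ x ∈ K, F η x ∈ V := by
    intro K V hK hV hx
    refine hK.eventually_forall_of_forall_eventually fun x hxK => ?_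
    exact (hFc.tendsto (0, x)).eventually (hV.mem_nhds (hx x hxK))
  have a1 := ev isCompact_stdTriangle e.open_target (by
    intro x hx; simpa [hF] using hT x hx)
  have a2 := ev hE1 hO (by
    rintro x ⟨hx, hx0⟩
    apply hb
    rw [segment_eq_image']
    refine ⟨x.2, ⟨hx.2.1, by linarith [hx.1, hx.2.2]⟩, ?_⟩
    rw [mem_ofPred_eq] at hx0
    simp [hF, hx0])
  have a3 := ev hE2 hO (by
    rintro x ⟨hx, hx0⟩
    apply hp
    rw [segment_eq_image']
    refine ⟨x.1, ⟨hx.1, by linarith [hx.2.1, hx.2.2]⟩, ?_⟩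
    rw [mem_ofPred_eq] at hx0
    simp [hF, hx0])
  obtain ⟨η, ⟨h1, h2, h3⟩, hη⟩ := (((a1.and (a2.and a3)).filter_mono
      (nhdsWithin_le_nhds (s := Set.Ioi 0))).and self_mem_nhdsWithin).exists
  change 0 < η at hη
  have hd' : (((1 + η : ℝ) : ℂ) * (p - a)).re * (((1 + η : ℝ) : ℂ) * (b - a)).im
      - (((1 + η : ℝ) : ℂ) * (p - a)).im * (((1 + η : ℝ) : ℂ) * (b - a)).re ≠ 0 := by
    simp only [Complex.re_ofReal_mul, Complex.im_ofReal_mul]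
    intro h0
    have : (1 + η) ^ 2 * ((p - a).re * (b - a).im - (p - a).im * (b - a).re) = 0 := by
      linear_combination h0
    exact (mul_ne_zero (by positivity) hd) this
  rw [segment_eq_image' ℝ p b]
  rintro _ ⟨τ, ⟨ht0, ht1⟩, rfl⟩
  have hx : (((1 - τ) / (1 + η), τ / (1 + η)) : ℝ × ℝ) ∈ stdTriangle := by
    refine ⟨div_nonneg (by linarith) (by linarith), div_nonneg ht0 (by linarith), ?_⟩
    simp only
    rw [← add_div, div_le_one (by linarith)]
    linarith
  have hval : p + τ • (b - p) = F η (((1 - τ) / (1 + η), τ / (1 + η)) : ℝ × ℝ) := by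
    have : (1 + η : ℂ) ≠ 0 := by exact_mod_cast (by linarith : (1 + η) ≠ 0)
    simp only [hF, Complex.real_smul]
    push_cast
    field_simp
    ring
  simp only [hval]
  refine ⟨h1 _ hx, h.mem_of_triangle_of_edges he hd' h1 ?_ hx ?_⟩
  · rintro y hy (hy0 | hy0)
    · exact (h2 y ⟨hy, hy0⟩).2
    · exact (h3 y ⟨hy, hy0⟩).2
  · simp only
    rw [← add_div, div_lt_one (by linarith)]
    linarith

/-- A connected part of the domain inside a flat chart that is star-shaped about one of its points
spans flat segments from that point inside the domain. -/
lemma PlanarTranslator.segment_subset_of_isPreconnected (h : PlanarTranslator α₁ α₂ γ Ω u)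
    {e : OpenPartialHomeomorph (ℝ × ℝ) ℂ} (he : IsFlatChart α₁ α₂ e) {C : Set (ℝ × ℝ)}
    (hC : IsPreconnected C) (hCs : C ⊆ e.source) (hCΩ : C ⊆ Ω) {p q : ℝ × ℝ} (hp : p ∈ C)
    (hq : q ∈ C) (hst : StarConvex ℝ (e p) e.target) :
    segment ℝ (e p) (e q) ⊆ e.target ∩ e.symm ⁻¹' Ω := by
  have hO : IsOpen (e.target ∩ e.symm ⁻¹' Ω) := e.isOpen_inter_preimage_symm h.isOpen
  have hCO : e '' C ⊆ e.target ∩ e.symm ⁻¹' Ω := by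
    rintro _ ⟨c, hc, rfl⟩
    refine ⟨e.map_source (hCs hc), ?_⟩
    rw [mem_preimage, e.left_inv (hCs hc)]
    exact hCΩ hc
  have hpre : IsPreconnected (e '' C) := hC.image e (e.continuousOn.mono hCs)
  set W : Set ℂ := {X | segment ℝ (e p) X ⊆ e.target ∩ e.symm ⁻¹' Ω} with hW
  have hWo : IsOpen W := by
    rw [isOpen_iff_eventually]
    intro X hX
    have : ∀ᶠ Y in 𝓝 X, ∀ τ ∈ Icc (0 : ℝ) 1,
        e p + τ • (Y - e p) ∈ e.target ∩ e.symm ⁻¹' Ω := by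
      refine isCompact_Icc.eventually_forall_of_forall_eventually fun τ hτ => ?_
      have hc : Continuous fun z : ℂ × ℝ => e p + z.2 • (z.1 - e p) := by fun_prop
      refine (hc.tendsto (X, τ)).eventually (hO.mem_nhds (hX ?_))
      rw [segment_eq_image']
      exact ⟨τ, hτ, rfl⟩
    filter_upwards [this] with Y hY
    rw [hW, mem_ofPred_eq, segment_eq_image']
    rintro _ ⟨τ, hτ, rfl⟩
    exact hY τ hτ
  have hpW : e p ∈ W := by
    rw [hW, mem_ofPred_eq, segment_same]
    exact singleton_subset_iff.2 (hCO ⟨p, hp, rfl⟩)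
  have hsub : e '' C ⊆ W := by
    refine hpre.subset_of_closure_inter_subset hWo ⟨e p, ⟨p, hp, rfl⟩, hpW⟩ ?_
    rintro X ⟨hXcl, hXC⟩
    obtain ⟨ε, hε, hball⟩ := Metric.isOpen_iff.1 hO X (hCO hXC)
    obtain ⟨a, haW, haX⟩ := Metric.mem_closure_iff.1 hXcl ε hε
    have haB : a ∈ Metric.ball X ε := by rwa [Metric.mem_ball, dist_comm]
    have hseg : segment ℝ a X ⊆ Metric.ball X ε :=
      (convex_ball X ε).segment_subset haB (Metric.mem_ball_self hε)
    refine h.segment_subset_of_triangle he (a := a) ?_ ?_ (hseg.trans hball)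
    · rintro ⟨s, t⟩ ⟨hs, ht, hst'⟩
      simp only at hs ht hst' ⊢
      rcases (show s ≤ 1 by linarith).eq_or_lt with rfl | hs1
      · have : t = 0 := by linarith
        subst this
        simpa using (hCO ⟨p, hp, rfl⟩).1
      · have hy : a + (t / (1 - s)) • (X - a) ∈ e.target := by
          refine (hball (hseg ?_)).1
          rw [segment_eq_image']
          refine ⟨_, ⟨div_nonneg ht (by linarith), ?_⟩, rfl⟩
          rw [div_le_one (by linarith)]; linarith
        have := hst hy hs (by linarith : 0 ≤ 1 - s) (by ring)
        convert this using 1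
        have : (1 - s : ℂ) ≠ 0 := by exact_mod_cast (by linarith : (1 - s) ≠ 0)
        simp only [Complex.real_smul]
        push_cast
        field_simp
        ring
    · rw [segment_symm]; exact haW
  exact hsub ⟨q, hq, rfl⟩

end Charts

section FlatCharts

open Filter Topology Set

variable {α₁ α₂ γ : ℝ} {Ω : Set (ℝ × ℝ)} {u : ℝ × ℝ → ℝ}

/-- The homeomorphism `(s, t) ↦ (α₁ s + α₂ t) + i (α₂ s - α₁ t) - p`. -/
def logCoord (hα : α₁ ^ 2 + α₂ ^ 2 ≠ 0) (p : ℂ) : (ℝ × ℝ) ≃ₜ ℂ :=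
  affineCoord (-p) ⟨α₁, α₂⟩ ⟨α₂, -α₁⟩ (by simp only; intro h; apply hα; linarith)

lemma logCoord_re (hα : α₁ ^ 2 + α₂ ^ 2 ≠ 0) (p : ℂ) (x : ℝ × ℝ) :
    (logCoord hα p x).re = α₁ * x.1 + α₂ * x.2 - p.re := by
  rw [logCoord, affineCoord_apply]
  simp
  ring

lemma logCoord_im (hα : α₁ ^ 2 + α₂ ^ 2 ≠ 0) (p : ℂ) (x : ℝ × ℝ) :
    (logCoord hα p x).im = α₂ * x.1 - α₁ * x.2 - p.im := by
  rw [logCoord, affineCoord_apply]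
  simp
  ring

lemma logCoord_eq_sub (hα : α₁ ^ 2 + α₂ ^ 2 ≠ 0) (p : ℂ) (x : ℝ × ℝ) :
    logCoord hα p x = logCoord hα 0 x - p := by
  apply Complex.ext <;> simp [logCoord_re, logCoord_im]

/-- The model functions of the exponential chart. -/
def expModel (α₁ α₂ a b A B D : ℝ) (x : ℝ × ℝ) : ℝ :=
  Real.exp (α₁ * x.1 + α₂ * x.2 - a) * (A * Real.cos (α₂ * x.1 - α₁ * x.2 - b)
    + B * Real.sin (α₂ * x.1 - α₁ * x.2 - b)) + D * Real.exp (α₁ * x.1 + α₂ * x.2 - a) ^ 2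

lemma contDiff_expModel (α₁ α₂ a b A B D : ℝ) :
    ContDiff ℝ (⊤ : ℕ∞) (expModel α₁ α₂ a b A B D) := by
  have h1 : ContDiff ℝ (⊤ : ℕ∞) fun x : ℝ × ℝ => α₁ * x.1 + α₂ * x.2 - a := by fun_prop
  have h2 : ContDiff ℝ (⊤ : ℕ∞) fun x : ℝ × ℝ => α₂ * x.1 - α₁ * x.2 - b := by fun_prop
  exact (h1.exp.mul ((contDiff_const.mul h2.cos).add (contDiff_const.mul h2.sin))).add
    (contDiff_const.mul (h1.exp.pow 2))

lemma hasFDerivAt_expModel (α₁ α₂ a b A B D : ℝ) (x : ℝ × ℝ) :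
    HasFDerivAt (expModel α₁ α₂ a b A B D)
      ((expModel α₁ α₂ a b (α₁ * A + α₂ * B) (α₁ * B - α₂ * A) (2 * α₁ * D) x) •
          ContinuousLinearMap.fst ℝ ℝ ℝ
        + (expModel α₁ α₂ a b (α₂ * A - α₁ * B) (α₂ * B + α₁ * A) (2 * α₂ * D) x) •
          ContinuousLinearMap.snd ℝ ℝ ℝ) x := by
  have hf : HasFDerivAt (fun y : ℝ × ℝ => y.1) (ContinuousLinearMap.fst ℝ ℝ ℝ) x := hasFDerivAt_fst
  have hs : HasFDerivAt (fun y : ℝ × ℝ => y.2) (ContinuousLinearMap.snd ℝ ℝ ℝ) x := hasFDerivAt_snd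
  have h1 := (((hf.const_mul α₁).add (hs.const_mul α₂)).sub_const a).exp
  have h2 := ((hf.const_mul α₂).sub (hs.const_mul α₁)).sub_const b
  refine ((h1.mul ((h2.cos.const_mul A).add (h2.sin.const_mul B))).add
    ((h1.pow 2).const_mul D)).congr_fderiv ?_
  ext
  · simp [expModel]; ring
  · simp [expModel]; ring

lemma pds_expModel (α₁ α₂ a b A B D : ℝ) : pds (expModel α₁ α₂ a b A B D)
    = expModel α₁ α₂ a b (α₁ * A + α₂ * B) (α₁ * B - α₂ * A) (2 * α₁ * D) := by
  ext x
  rw [(hasFDerivAt_expModel α₁ α₂ a b A B D x).pds_eq]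
  simp

lemma pdt_expModel (α₁ α₂ a b A B D : ℝ) : pdt (expModel α₁ α₂ a b A B D)
    = expModel α₁ α₂ a b (α₂ * A - α₁ * B) (α₂ * B + α₁ * A) (2 * α₂ * D) := by
  ext x
  rw [(hasFDerivAt_expModel α₁ α₂ a b A B D x).pdt_eq]
  simp

lemma levelOp_expModel (α₁ α₂ a b A B D : ℝ) (x : ℝ × ℝ) :
    levelOp α₁ α₂ (expModel α₁ α₂ a b A B D) x = 2 * D * (α₁ ^ 2 + α₂ ^ 2) ^ 2 *
      Real.exp (α₁ * x.1 + α₂ * x.2 - a) ^ 4 *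
      ((A + 2 * D * (Real.exp (α₁ * x.1 + α₂ * x.2 - a) * Real.cos (α₂ * x.1 - α₁ * x.2 - b))) ^ 2
      + (B + 2 * D *
        (Real.exp (α₁ * x.1 + α₂ * x.2 - a) * Real.sin (α₂ * x.1 - α₁ * x.2 - b))) ^ 2) := by
  simp only [levelOp, pds_expModel, pdt_expModel, expModel]
  set E := Real.exp (α₁ * x.1 + α₂ * x.2 - a)
  have hcs := Real.cos_sq_add_sin_sq (α₂ * x.1 - α₁ * x.2 - b)
  set c := Real.cos (α₂ * x.1 - α₁ * x.2 - b)
  set s := Real.sin (α₂ * x.1 - α₁ * x.2 - b)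
  have key : (A + 2 * D * (E * c)) ^ 2 + (B + 2 * D * (E * s)) ^ 2
      = (A * c + B * s + 2 * D * E) ^ 2 + (-A * s + B * c) ^ 2 := by
    linear_combination (4 * D ^ 2 * E ^ 2 - A ^ 2 - B ^ 2) * hcs
  rw [key]
  ring

/-- The exponential chart centred at `p`. -/
def expChart (hα : α₁ ^ 2 + α₂ ^ 2 ≠ 0) (p : ℂ) : OpenPartialHomeomorph (ℝ × ℝ) ℂ :=
  (logCoord hα p).toOpenPartialHomeomorph.trans Complex.expOpenPartialHomeomorph

lemma isFlatChart_expChart (hα : α₁ ^ 2 + α₂ ^ 2 ≠ 0) (p : ℂ) :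
    IsFlatChart α₁ α₂ (expChart hα p) := by
  intro A B D hD
  refine ⟨expModel α₁ α₂ p.re p.im A B D, contDiff_expModel _ _ _ _ _ _ _, fun x _ => ?_⟩
  have hre : (expChart hα p x).re = Real.exp (α₁ * x.1 + α₂ * x.2 - p.re)
      * Real.cos (α₂ * x.1 - α₁ * x.2 - p.im) := by
    rw [← logCoord_re hα, ← logCoord_im hα, ← Complex.exp_re]; rfl
  have him : (expChart hα p x).im = Real.exp (α₁ * x.1 + α₂ * x.2 - p.re)
      * Real.sin (α₂ * x.1 - α₁ * x.2 - p.im) := by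
    rw [← logCoord_re hα, ← logCoord_im hα, ← Complex.exp_im]; rfl
  rw [levelOp_expModel, hre, him, expModel]
  refine ⟨?_, fun h => ?_⟩
  · linear_combination (-D * Real.exp (α₁ * x.1 + α₂ * x.2 - p.re) ^ 2) *
      Real.cos_sq_add_sin_sq (α₂ * x.1 - α₁ * x.2 - p.im)
  · have : 0 < (α₁ ^ 2 + α₂ ^ 2) ^ 2 := by positivity
    refine mul_pos (by positivity) ?_
    rcases h with h | h
    · exact add_pos_of_pos_of_nonneg (by positivity) (by positivity)
    · exact add_pos_of_nonneg_of_pos (by positivity) (by positivity)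

/-- Connected pieces of the domain, seen in the logarithmic coordinate, span flat segments. -/
lemma PlanarTranslator.add_log_mem (h : PlanarTranslator α₁ α₂ γ Ω u)
    (hα : α₁ ^ 2 + α₂ ^ 2 ≠ 0) {C : Set ℂ} (hC : IsPreconnected C)
    (hCΩ : C ⊆ logCoord hα 0 '' Ω) {p q X : ℂ} (hp : p ∈ C) (hq : q ∈ C)
    (him : ∀ c ∈ C, |c.im - p.im| < π) (hX : X ∈ segment ℝ 1 (Complex.exp (q - p))) :
    p + Complex.log X ∈ logCoord hα 0 '' Ω := by
  set Z := logCoord hα 0 with hZ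
  have hZe : ∀ c : ℂ, expChart hα p (Z.symm c) = Complex.exp (c - p) := by
    intro c
    have : logCoord hα p (Z.symm c) = c - p := by
      rw [logCoord_eq_sub, ← hZ, Z.apply_symm_apply]
    rw [← this]; rfl
  have hone : expChart hα p (Z.symm p) = 1 := by rw [hZe, sub_self, Complex.exp_zero]
  have htar : (expChart hα p).target = Complex.slitPlane := by
    simp [expChart, Complex.expOpenPartialHomeomorph]
  have key := h.segment_subset_of_isPreconnected (isFlatChart_expChart hα p)
    (C := Z.symm '' C) (hC.image _ Z.symm.continuous.continuousOn) ?_ ?_ (p := Z.symm p)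
    (q := Z.symm q) ⟨p, hp, rfl⟩ ⟨q, hq, rfl⟩ ?_
  · rw [hone, hZe] at key
    have h2 := (key hX).2
    refine ⟨_, h2, ?_⟩
    have h3 : logCoord hα p ((expChart hα p).symm X) = Complex.log X := by
      change logCoord hα p ((logCoord hα p).symm (Complex.log X)) = _
      rw [Homeomorph.apply_symm_apply]
    rw [← h3, logCoord_eq_sub hα p, ← hZ]
    ring
  · rintro _ ⟨c, hc, rfl⟩
    have h1 : logCoord hα p (Z.symm c) ∈ Complex.expOpenPartialHomeomorph.source := by
      rw [logCoord_eq_sub, ← hZ, Z.apply_symm_apply]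
      simpa [Complex.expOpenPartialHomeomorph, abs_lt] using him c hc
    exact ⟨mem_univ _, h1⟩
  · rintro _ ⟨c, hc, rfl⟩
    obtain ⟨x, hx, rfl⟩ := hCΩ hc
    rwa [Z.symm_apply_apply]
  · rw [hone, htar]
    exact Complex.starConvex_one_slitPlane

lemma isFlatChart_zero : IsFlatChart 0 0
    (affineCoord 0 1 Complex.I (by simp)).toOpenPartialHomeomorph := by
  intro A B D hD
  have hd : ∀ a b c d : ℝ, ∀ x : ℝ × ℝ, HasFDerivAt
      (fun x : ℝ × ℝ => a * x.1 + b * x.2 + c + d * (x.1 ^ 2 + x.2 ^ 2))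
      ((a + 2 * d * x.1) • ContinuousLinearMap.fst ℝ ℝ ℝ
        + (b + 2 * d * x.2) • ContinuousLinearMap.snd ℝ ℝ ℝ) x := by
    intro a b c d x
    have hf : HasFDerivAt (fun y : ℝ × ℝ => y.1) (ContinuousLinearMap.fst ℝ ℝ ℝ) x :=
      hasFDerivAt_fst
    have hs : HasFDerivAt (fun y : ℝ × ℝ => y.2) (ContinuousLinearMap.snd ℝ ℝ ℝ) x :=
      hasFDerivAt_snd
    refine ((((hf.const_mul a).add (hs.const_mul b)).add_const c).add
      (((hf.pow 2).add (hs.pow 2)).const_mul d)).congr_fderiv ?_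
    ext <;> simp <;> ring
  have e1 : pds (fun x : ℝ × ℝ => A * x.1 + B * x.2 + 0 + D * (x.1 ^ 2 + x.2 ^ 2))
      = fun x : ℝ × ℝ => 2 * D * x.1 + 0 * x.2 + A + 0 * (x.1 ^ 2 + x.2 ^ 2) := by
    ext x; rw [(hd A B 0 D x).pds_eq]; simp; ring
  have e2 : pdt (fun x : ℝ × ℝ => A * x.1 + B * x.2 + 0 + D * (x.1 ^ 2 + x.2 ^ 2))
      = fun x : ℝ × ℝ => 0 * x.1 + 2 * D * x.2 + B + 0 * (x.1 ^ 2 + x.2 ^ 2) := by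
    ext x; rw [(hd A B 0 D x).pdt_eq]; simp; ring
  refine ⟨fun x => A * x.1 + B * x.2 + 0 + D * (x.1 ^ 2 + x.2 ^ 2), by fun_prop, fun x _ => ?_⟩
  have hre : ((affineCoord 0 1 Complex.I (by simp)).toOpenPartialHomeomorph x).re = x.1 := by
    change (affineCoord 0 1 Complex.I (by simp) x).re = x.1
    simp [affineCoord_apply]
  have him : ((affineCoord 0 1 Complex.I (by simp)).toOpenPartialHomeomorph x).im = x.2 := by
    change (affineCoord 0 1 Complex.I (by simp) x).im = x.2
    simp [affineCoord_apply]
  rw [hre, him]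
  refine ⟨by ring, fun h => ?_⟩
  rw [levelOp, e1, e2, (hd _ _ _ _ x).pds_eq, (hd _ _ _ _ x).pdt_eq, (hd _ _ _ _ x).pdt_eq]
  have : 0 < 2 * D * ((A + 2 * D * x.1) ^ 2 + (B + 2 * D * x.2) ^ 2) := by
    refine mul_pos (by positivity) ?_
    rcases h with h | h
    · exact add_pos_of_pos_of_nonneg (by positivity) (by positivity)
    · exact add_pos_of_nonneg_of_pos (by positivity) (by positivity)
  convert this using 1
  simp
  ring

/-- In the case of vertical velocity the domain is convex. -/
lemma PlanarTranslator.convex (h : PlanarTranslator 0 0 γ Ω u) : Convex ℝ Ω := by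
  rw [convex_iff_segment_subset]
  intro p hp q hq
  have key := h.segment_subset_of_isPreconnected isFlatChart_zero h.isConnected.isPreconnected
    (fun _ _ => mem_univ _) subset_rfl hp hq (by
      change StarConvex ℝ _ univ
      exact starConvex_univ _)
  rw [segment_eq_image']
  rintro _ ⟨τ, hτ, rfl⟩
  have h1 := (key (by rw [segment_eq_image']; exact ⟨τ, hτ, rfl⟩)).2
  change (affineCoord 0 1 Complex.I (by simp)).symm
    (affineCoord 0 1 Complex.I (by simp) p + τ • (affineCoord 0 1 Complex.I (by simp) q
      - affineCoord 0 1 Complex.I (by simp) p)) ∈ Ω at h1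
  convert h1 using 1
  rw [eq_comm, Homeomorph.symm_apply_eq]
  simp only [affineCoord_apply]
  apply Complex.ext <;> simp

end FlatCharts

section Connectivity

open Filter Topology Set

/-- Connected pieces of `U` span segments of the flat metric `e^{2 Re ζ}|dζ|²`. -/
def SpansSegments (U : Set ℂ) : Prop :=
  ∀ C : Set ℂ, IsPreconnected C → C ⊆ U → ∀ p ∈ C, ∀ q ∈ C, (∀ c ∈ C, |c.im - p.im| < π) →
    ∀ X ∈ segment ℝ 1 (Complex.exp (q - p)), p + Complex.log X ∈ U

/-- The segment from `p` to `q` of the flat metric `e^{2 Re ζ}|dζ|²`. -/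
def logSegment (p q : ℂ) : Set ℂ :=
  (fun X => p + Complex.log X) '' segment ℝ 1 (Complex.exp (q - p))

lemma exp_sub_mem_slitPlane {p q : ℂ} (h : |q.im - p.im| < π) :
    Complex.exp (q - p) ∈ Complex.slitPlane := by
  refine Complex.expOpenPartialHomeomorph.map_source ?_
  simpa [Complex.expOpenPartialHomeomorph, abs_lt] using h

lemma segment_subset_slitPlane {p q : ℂ} (h : |q.im - p.im| < π) :
    segment ℝ 1 (Complex.exp (q - p)) ⊆ Complex.slitPlane :=
  Complex.starConvex_one_slitPlane.segment_subset (exp_sub_mem_slitPlane h)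

lemma isPreconnected_logSegment {p q : ℂ} (h : |q.im - p.im| < π) :
    IsPreconnected (logSegment p q) :=
  (convex_segment _ _).isPreconnected.image _ fun _ hX =>
    (continuousAt_const.add (continuousAt_clog (segment_subset_slitPlane h hX))).continuousWithinAt

lemma left_mem_logSegment (p q : ℂ) : p ∈ logSegment p q :=
  ⟨1, left_mem_segment _ _ _, by simp⟩

lemma right_mem_logSegment {p q : ℂ} (h : |q.im - p.im| < π) : q ∈ logSegment p q := by
  refine ⟨_, right_mem_segment _ _ _, ?_⟩
  rw [abs_lt] at h
  simp only
  rw [Complex.log_exp (by simpa using h.1) (by simpa using h.2.le)]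
  ring

lemma logSegment_sin {p q ζ : ℂ} (h : |q.im - p.im| < π) (hζ : ζ ∈ logSegment p q) :
    |ζ.im - p.im| < π ∧ ∃ τ ∈ Icc (0 : ℝ) 1,
      Real.exp (ζ.re - p.re) * Real.sin (ζ.im - p.im)
        = τ * Real.exp (q.re - p.re) * Real.sin (q.im - p.im) ∧
      Real.exp (ζ.re - p.re) * Real.sin (q.im - p.im - (ζ.im - p.im))
        = (1 - τ) * Real.sin (q.im - p.im) := by
  obtain ⟨X, hX, rfl⟩ := hζ
  have hXs := segment_subset_slitPlane h hX
  have harg := (Complex.mem_slitPlane_iff_arg.1 hXs)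
  rw [segment_eq_image'] at hX
  obtain ⟨τ, hτ, hXτ⟩ := hX
  simp only at hXτ
  have hexp : Complex.exp (p + Complex.log X - p) = X := by
    rw [add_sub_cancel_left, Complex.exp_log harg.2]
  have e1 : Real.exp ((p + Complex.log X).re - p.re) * Real.cos ((p + Complex.log X).im - p.im)
      = X.re := by
    rw [← Complex.sub_re, ← Complex.sub_im, ← Complex.exp_re, hexp]
  have e2 : Real.exp ((p + Complex.log X).re - p.re) * Real.sin ((p + Complex.log X).im - p.im)
      = X.im := by
    rw [← Complex.sub_re, ← Complex.sub_im, ← Complex.exp_im, hexp]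
  have e3 : X.re = 1 + τ * (Real.exp (q.re - p.re) * Real.cos (q.im - p.im) - 1) := by
    rw [← hXτ, ← Complex.sub_re q, ← Complex.sub_im q, ← Complex.exp_re]
    simp
  have e4 : X.im = τ * (Real.exp (q.re - p.re) * Real.sin (q.im - p.im)) := by
    rw [← hXτ, ← Complex.sub_re q, ← Complex.sub_im q, ← Complex.exp_im]
    simp
  refine ⟨?_, τ, hτ, by rw [e2, e4]; ring, ?_⟩
  · have := Complex.arg_le_pi X
    have := Complex.neg_pi_lt_arg X
    simp only [Complex.add_im, Complex.log_im, add_sub_cancel_left]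
    exact abs_lt.2 ⟨by linarith, lt_of_le_of_ne (Complex.arg_le_pi X) harg.1⟩
  · rw [Real.sin_sub (q.im - p.im)]
    have : Real.exp ((p + Complex.log X).re - p.re) *
        (Real.sin (q.im - p.im) * Real.cos ((p + Complex.log X).im - p.im)
          - Real.cos (q.im - p.im) * Real.sin ((p + Complex.log X).im - p.im))
        = Real.sin (q.im - p.im) * X.re - Real.cos (q.im - p.im) * X.im := by
      rw [← e1, ← e2]; ring
    rw [this, e3, e4]
    ring

lemma nonneg_of_sin_nonneg {x : ℝ} (hx : |x| < π) (h : 0 ≤ Real.sin x) : 0 ≤ x := by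
  by_contra! hn
  linarith [Real.sin_neg_of_neg_of_neg_pi_lt hn (abs_lt.1 hx).1]

lemma im_mem_uIcc_of_mem_logSegment {p q ζ : ℂ} (h : |q.im - p.im| < π)
    (hζ : ζ ∈ logSegment p q) : ζ.im ∈ uIcc p.im q.im := by
  obtain ⟨hlt, τ, hτ, h1, h2⟩ := logSegment_sin h hζ
  have hE := Real.exp_pos (ζ.re - p.re)
  have hE' := Real.exp_pos (q.re - p.re)
  have hτ' : 0 ≤ 1 - τ := by linarith [hτ.2]
  set ψ := q.im - p.im with hψ
  set φ := ζ.im - p.im with hφ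
  rw [abs_lt] at h hlt
  rcases le_total 0 ψ with h0 | h0
  · have hs := Real.sin_nonneg_of_nonneg_of_le_pi h0 h.2.le
    have a1 : 0 ≤ φ := by
      refine nonneg_of_sin_nonneg (abs_lt.2 hlt) (nonneg_of_mul_nonneg_right ?_ hE)
      rw [h1]
      exact mul_nonneg (mul_nonneg hτ.1 hE'.le) hs
    have a2 : 0 ≤ ψ - φ := by
      refine nonneg_of_sin_nonneg (abs_lt.2 ⟨by linarith, by linarith⟩)
        (nonneg_of_mul_nonneg_right ?_ hE)
      rw [h2]
      exact mul_nonneg hτ' hs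
    rw [uIcc_of_le (by linarith)]
    exact ⟨by linarith, by linarith⟩
  · have hs := Real.sin_nonpos_of_nonpos_of_neg_pi_le h0 h.1.le
    have a1 : 0 ≤ -φ := by
      refine nonneg_of_sin_nonneg (abs_lt.2 ⟨by linarith, by linarith⟩)
        (nonneg_of_mul_nonneg_right ?_ hE)
      rw [Real.sin_neg, mul_neg, h1, ← mul_neg]
      exact mul_nonneg (mul_nonneg hτ.1 hE'.le) (neg_nonneg.2 hs)
    have a2 : 0 ≤ -(ψ - φ) := by
      refine nonneg_of_sin_nonneg (abs_lt.2 ⟨by linarith, by linarith⟩)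
        (nonneg_of_mul_nonneg_right ?_ hE)
      rw [Real.sin_neg, mul_neg, h2, ← mul_neg]
      exact mul_nonneg hτ' (neg_nonneg.2 hs)
    rw [uIcc_of_ge (by linarith)]
    exact ⟨by linarith, by linarith⟩

lemma SpansSegments.logSegment_subset {U C : Set ℂ} (hU : SpansSegments U) (hC : IsPreconnected C)
    (hCU : C ⊆ U) {p q : ℂ} (hp : p ∈ C) (hq : q ∈ C) (him : ∀ c ∈ C, |c.im - p.im| < π) :
    logSegment p q ⊆ U := by
  rintro _ ⟨X, hX, rfl⟩
  exact hU C hC hCU p hp q hq him X hX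

/-- A point of `U` joined inside `U` to a point at angular distance at least `π` is the origin of
a ray in `U` pointing to the apex of the flat metric. -/
lemma SpansSegments.ray {U : Set ℂ} (hU : SpansSegments U) (hUo : IsOpen U) {δ : ℝ → ℂ}
    (hδ : Continuous δ) (hδU : ∀ s ∈ Icc (0 : ℝ) 1, δ s ∈ U) (hfar : π ≤ |(δ 1).im - (δ 0).im|)
    {t : ℝ} (ht : 0 ≤ t) : δ 0 - t ∈ U := by
  set c := δ 0 with hc
  have hcU : c ∈ U := hδU 0 ⟨le_rfl, zero_le_one⟩
  obtain ⟨r, hr, hball⟩ := Metric.isOpen_iff.1 hUo c hcU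
  set σ₁ := min (r / 2) (π / 2) with hσ₁
  have hπ := Real.pi_pos
  have hσ₁0 : 0 < σ₁ := by positivity
  have hσ₁r : σ₁ < r := (min_le_left _ _).trans_lt (by linarith)
  have hσ₁π : σ₁ ≤ π / 2 := min_le_right _ _
  obtain ⟨σ₂, hσ₂, hσ₂π, hsin⟩ : ∃ σ₂ : ℝ, 0 < σ₂ ∧ σ₂ < π / 2 ∧
      Real.sin σ₂ < Real.exp (-t) * Real.sin (σ₁ + σ₂) := by
    have c1 : Continuous fun σ : ℝ => Real.exp (-t) * Real.sin (σ₁ + σ) - Real.sin σ := by fun_prop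
    have e1 : ∀ᶠ σ : ℝ in 𝓝 0, 0 < Real.exp (-t) * Real.sin (σ₁ + σ) - Real.sin σ := by
      refine (c1.tendsto 0).eventually_const_lt ?_
      rw [add_zero, Real.sin_zero, sub_zero]
      exact mul_pos (Real.exp_pos _) (Real.sin_pos_of_pos_of_lt_pi hσ₁0 (by linarith))
    have e2 : ∀ᶠ σ : ℝ in 𝓝 0, σ < π / 2 := eventually_lt_nhds (by linarith)
    obtain ⟨σ, ⟨h1, h2⟩, h3⟩ := (((e1.and e2).filter_mono
      (nhdsWithin_le_nhds (s := Set.Ioi 0))).and self_mem_nhdsWithin).exists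
    exact ⟨σ, h3, h2, by linarith⟩
  have hcont : Continuous fun s => |(δ s).im - c.im| :=
    ((Complex.continuous_im.comp hδ).sub continuous_const).abs
  set A := Icc (0 : ℝ) 1 ∩ {s | π - (σ₁ + σ₂) ≤ |(δ s).im - c.im|} with hA
  have hAc : IsCompact A := isCompact_Icc.inter_right (isClosed_le continuous_const hcont)
  have hAne : A.Nonempty :=
    ⟨1, ⟨zero_le_one, le_rfl⟩, by
      change π - (σ₁ + σ₂) ≤ |(δ 1).im - c.im|
      linarith⟩
  have hs₀ := hAc.sInf_mem hAne
  set s₀ := sInf A with hs₀def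
  have hbelow : ∀ s, 0 ≤ s → s < s₀ → |(δ s).im - c.im| < π - (σ₁ + σ₂) := by
    intro s h0 hs
    by_contra! hcon
    exact absurd (csInf_le hAc.bddBelow ⟨⟨h0, by linarith [hs₀.1.2]⟩, hcon⟩) (not_le.2 hs)
  have hs₀pos : 0 < s₀ := by
    refine lt_of_le_of_ne hs₀.1.1 fun h0 => ?_
    have h2 : π - (σ₁ + σ₂) ≤ |(δ s₀).im - c.im| := hs₀.2
    rw [← h0, ← hc, sub_self, abs_zero] at h2
    linarith
  have hle : ∀ s ∈ Icc 0 s₀, |(δ s).im - c.im| ≤ π - (σ₁ + σ₂) := by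
    have h1 : closure (Ico 0 s₀) ⊆ {s | |(δ s).im - c.im| ≤ π - (σ₁ + σ₂)} :=
      closure_minimal (fun s hs => (hbelow s hs.1 hs.2).le) (isClosed_le hcont continuous_const)
    rwa [closure_Ico hs₀pos.ne] at h1
  have heq : |(δ s₀).im - c.im| = π - (σ₁ + σ₂) := le_antisymm (hle s₀ ⟨hs₀pos.le, le_rfl⟩) hs₀.2
  obtain ⟨ε, hε, hεb⟩ : ∃ ε : ℝ, |ε| = 1 ∧ (δ s₀).im - c.im = ε * (π - (σ₁ + σ₂)) := by
    rcases le_total 0 ((δ s₀).im - c.im) with h0 | h0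
    · exact ⟨1, by simp, by rw [abs_of_nonneg h0] at heq; linarith⟩
    · exact ⟨-1, by simp, by rw [abs_of_nonpos h0] at heq; linarith⟩
  set c' : ℂ := ⟨c.re, c.im - ε * σ₁⟩ with hc'
  have hseg : segment ℝ c' c ⊆ Metric.ball c r := by
    refine (convex_ball c r).segment_subset ?_ (Metric.mem_ball_self hr)
    rw [Metric.mem_ball, dist_eq_norm]
    have : c' - c = ((-(ε * σ₁) : ℝ) : ℂ) * Complex.I := by
      apply Complex.ext <;> simp [hc']
    rw [this, norm_mul, Complex.norm_I, Complex.norm_real, Real.norm_eq_abs, abs_neg, abs_mul, hε,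
      abs_of_pos hσ₁0]
    linarith
  have hsegim : ∀ x ∈ segment ℝ c' c, |x.im - c.im| ≤ σ₁ ∧ |x.im - c'.im| ≤ σ₁ := by
    rw [segment_eq_image']
    rintro _ ⟨τ, ⟨h0, h1⟩, rfl⟩
    constructor
    · have : (c' + τ • (c - c')).im - c.im = -(1 - τ) * (ε * σ₁) := by simp [hc']; ring
      rw [this, abs_mul, abs_mul, hε, abs_neg, abs_of_pos hσ₁0, abs_of_nonneg (by linarith)]
      nlinarith
    · have : (c' + τ • (c - c')).im - c'.im = τ * (ε * σ₁) := by simp [hc']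
      rw [this, abs_mul, abs_mul, hε, abs_of_pos hσ₁0, abs_of_nonneg h0]
      nlinarith
  have hcc' : |c.im - c'.im| = σ₁ := by
    simp only [hc', sub_sub_cancel]
    rw [abs_mul, hε, abs_of_pos hσ₁0, one_mul]
  have hpre : IsPreconnected (segment ℝ c' c) := (convex_segment _ _).isPreconnected
  set b := δ s₀ with hb
  have hbim : b.im - c'.im = ε * (π - σ₂) := by
    have : b.im - c'.im = b.im - c.im + ε * σ₁ := by simp only [hc']; ring
    rw [this, hεb]; ring
  have hbabs : |b.im - c'.im| < π := by
    rw [hbim, abs_mul, hε, abs_of_pos (by linarith)]; linarith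
  have hgeo : logSegment c' b ⊆ U := by
    refine hU.logSegment_subset (C := segment ℝ c' c ∪ δ '' Icc 0 s₀) ?_ ?_
      (Or.inl (left_mem_segment _ _ _)) (Or.inr ⟨s₀, ⟨hs₀pos.le, le_rfl⟩, rfl⟩) ?_
    · exact hpre.union c (right_mem_segment _ _ _) ⟨0, ⟨le_rfl, hs₀pos.le⟩, rfl⟩
        (isPreconnected_Icc.image δ hδ.continuousOn)
    · rintro x (hx | ⟨s, hs, rfl⟩)
      · exact hball (hseg hx)
      · exact hδU s ⟨hs.1, hs.2.trans hs₀.1.2⟩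
    · rintro x (hx | ⟨s, hs, rfl⟩)
      · linarith [(hsegim x hx).2]
      · have h1 := hle s hs
        have h2 := abs_sub_le (δ s).im c.im c'.im
        linarith
  have hgc := isPreconnected_logSegment hbabs
  obtain ⟨ζ, hζ, hζim⟩ : ∃ ζ ∈ logSegment c' b, ζ.im = c.im := by
    have himg := hgc.image Complex.im Complex.continuous_im.continuousOn
    have h1 : uIcc c'.im b.im ⊆ Complex.im '' logSegment c' b :=
      himg.ordConnected.uIcc_subset ⟨c', left_mem_logSegment _ _, rfl⟩
        ⟨b, right_mem_logSegment hbabs, rfl⟩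
    have h2 : c.im ∈ uIcc c'.im b.im := by
      have hsig : 0 ≤ π - (σ₁ + σ₂) := by linarith
      rcases abs_eq (zero_le_one) |>.1 hε with rfl | rfl
      · rw [uIcc_of_le (by linarith)]
        simp only [hc'] at hbim ⊢
        exact ⟨by linarith, by linarith⟩
      · rw [uIcc_of_ge (by linarith)]
        simp only [hc'] at hbim ⊢
        exact ⟨by linarith, by linarith⟩
    exact h1 h2
  have hdepth : ζ.re ≤ c.re - t := by
    obtain ⟨-, τ, hτ, -, h2⟩ := logSegment_sin hbabs hζ
    have e1 : b.im - c'.im - (ζ.im - c'.im) = ε * (π - (σ₁ + σ₂)) := by rw [hζim]; linarith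
    have hsε : ∀ x, Real.sin (ε * x) = ε * Real.sin x := by
      intro x
      rcases abs_eq (zero_le_one) |>.1 hε with rfl | rfl <;> simp
    rw [e1, hbim, hsε, hsε, Real.sin_pi_sub, Real.sin_pi_sub] at h2
    have hε0 : ε ≠ 0 := by
      rintro rfl
      simp at hε
    have h3 : Real.exp (ζ.re - c'.re) * Real.sin (σ₁ + σ₂) = (1 - τ) * Real.sin σ₂ :=
      mul_left_cancel₀ hε0 (by linear_combination h2)
    have hs2 := Real.sin_pos_of_pos_of_lt_pi hσ₂ (by linarith)
    have hs12 := Real.sin_pos_of_pos_of_lt_pi (add_pos hσ₁0 hσ₂) (by linarith)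
    have h4 : Real.exp (ζ.re - c'.re) * Real.sin (σ₁ + σ₂)
        ≤ Real.exp (-t) * Real.sin (σ₁ + σ₂) := by
      rw [h3]
      have := mul_le_mul_of_nonneg_right (by linarith [hτ.1] : 1 - τ ≤ 1) hs2.le
      linarith
    have h5 := Real.exp_le_exp.1 (le_of_mul_le_mul_right h4 hs12)
    simp only [hc'] at h5
    linarith
  have hX : Complex.exp ((-t : ℝ) : ℂ) ∈ segment ℝ (1 : ℂ) (Complex.exp (ζ - c)) := by
    have e1 : ζ - c = ((ζ.re - c.re : ℝ) : ℂ) := by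
      apply Complex.ext <;> simp [hζim]
    rw [e1, ← Complex.ofReal_exp, ← Complex.ofReal_exp]
    set y := Real.exp (ζ.re - c.re) with hy
    set x := Real.exp (-t) with hx
    have hyx : y ≤ x := Real.exp_le_exp.2 (by linarith)
    have hx1 : x ≤ 1 := Real.exp_le_one_iff.2 (by linarith)
    have hseg1 : x ∈ segment ℝ (1 : ℝ) y := by
      rw [segment_symm, segment_eq_Icc (hyx.trans hx1)]
      exact ⟨hyx, hx1⟩
    obtain ⟨a, b', ha, hb', hab, hx'⟩ := hseg1
    refine ⟨a, b', ha, hb', hab, ?_⟩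
    rw [← hx']
    simp
  have hfin := hU (segment ℝ c' c ∪ logSegment c' b)
    (hpre.union c' (left_mem_segment _ _ _) (left_mem_logSegment _ _) hgc)
    (union_subset (hseg.trans hball) hgeo) c (Or.inl (right_mem_segment _ _ _)) ζ (Or.inr hζ) (by
      rintro x (hx | hx)
      · linarith [(hsegim x hx).1]
      · have h1 := im_mem_uIcc_of_mem_logSegment hbabs hx
        rcases abs_eq (zero_le_one) |>.1 hε with rfl | rfl
        · rw [uIcc_of_le (by linarith)] at h1
          simp only [hc'] at hbim h1
          exact abs_lt.2 ⟨by linarith [h1.1], by linarith [h1.2]⟩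
        · rw [uIcc_of_ge (by linarith)] at h1
          simp only [hc'] at hbim h1
          exact abs_lt.2 ⟨by linarith [h1.1], by linarith [h1.2]⟩) _ hX
  rw [← Complex.ofReal_exp, ← Complex.ofReal_log (Real.exp_pos _).le, Real.log_exp] at hfin
  simpa [sub_eq_add_neg] using hfin

/-- Points of `U` at angular distance less than `π` are joined in `U` within the sector they
span. -/
lemma SpansSegments.exists_isPreconnected {U : Set ℂ} (hU : SpansSegments U) (hUo : IsOpen U)
    (hUc : IsConnected U) {p q : ℂ} (hp : p ∈ U) (hq : q ∈ U) :
    ∃ C : Set ℂ, IsPreconnected C ∧ C ⊆ U ∧ p ∈ C ∧ q ∈ C ∧ ∀ c ∈ C, c.im ∈ uIcc p.im q.im := by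
  obtain ⟨γ, hγ⟩ := (hUo.isConnected_iff_isPathConnected.1 hUc).joinedIn p hp q hq
  set δ : ℝ → ℂ := ⇑γ.extend with hδdef
  have hδ : Continuous δ := γ.extend.continuous
  have hδU : ∀ s, δ s ∈ U := by
    intro s
    have : δ s ∈ range γ.extend := ⟨s, rfl⟩
    rw [γ.extend_range] at this
    obtain ⟨τ, hτ⟩ := this
    rw [← hτ]; exact hγ τ
  have hδ0 : δ 0 = p := γ.extend_zero
  have hδ1 : δ 1 = q := γ.extend_one
  have hΓ : IsPreconnected (δ '' Icc 0 1) := isPreconnected_Icc.image δ hδ.continuousOn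
  have hΓU : δ '' Icc 0 1 ⊆ U := by rintro _ ⟨s, -, rfl⟩; exact hδU s
  have hpΓ : p ∈ δ '' Icc 0 1 := ⟨0, ⟨le_rfl, zero_le_one⟩, hδ0⟩
  have hqΓ : q ∈ δ '' Icc 0 1 := ⟨1, ⟨zero_le_one, le_rfl⟩, hδ1⟩
  by_cases hA : ∃ s ∈ Icc (0 : ℝ) 1, (δ s).im ∈ uIcc p.im q.im ∧
      ∀ r ∈ Icc (0 : ℝ) 1, |(δ r).im - (δ s).im| < π
  · obtain ⟨s, hs, hsim, hsr⟩ := hA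
    have hnear : ∀ c ∈ δ '' Icc 0 1, |c.im - (δ s).im| < π := by
      rintro _ ⟨r, hr, rfl⟩; exact hsr r hr
    have hsΓ : δ s ∈ δ '' Icc 0 1 := ⟨s, hs, rfl⟩
    refine ⟨logSegment (δ s) p ∪ logSegment (δ s) q, ?_, ?_, ?_, ?_, ?_⟩
    · exact (isPreconnected_logSegment (hnear p hpΓ)).union (δ s) (left_mem_logSegment _ _)
        (left_mem_logSegment _ _) (isPreconnected_logSegment (hnear q hqΓ))
    · exact union_subset (hU.logSegment_subset hΓ hΓU hsΓ hpΓ hnear)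
        (hU.logSegment_subset hΓ hΓU hsΓ hqΓ hnear)
    · exact Or.inl (right_mem_logSegment (hnear p hpΓ))
    · exact Or.inr (right_mem_logSegment (hnear q hqΓ))
    · rintro c (hc | hc)
      · exact uIcc_subset_uIcc hsim left_mem_uIcc
          (im_mem_uIcc_of_mem_logSegment (hnear p hpΓ) hc)
      · exact uIcc_subset_uIcc hsim right_mem_uIcc
          (im_mem_uIcc_of_mem_logSegment (hnear q hqΓ) hc)
  · push Not at hA
    have hray : ∀ s ∈ Icc (0 : ℝ) 1, (δ s).im ∈ uIcc p.im q.im → ∀ t : ℝ, 0 ≤ t →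
        δ s - t ∈ U := by
      intro s hs hsim t ht
      obtain ⟨r, hr, hfar⟩ := hA s hs hsim
      have := hU.ray hUo (δ := fun x => δ (s + x * (r - s))) (by fun_prop) (fun x _ => hδU _)
        (by simpa using hfar) ht
      simpa using this
    obtain ⟨M, hM⟩ := isCompact_Icc.exists_bound_of_continuousOn (s := Icc (0 : ℝ) 1)
      (f := fun s => (δ s).re) (Complex.continuous_re.comp hδ).continuousOn
    have hlow : ∀ s ∈ Icc (0 : ℝ) 1, -M ≤ (δ s).re := fun s hs => by
      have := hM s hs
      rw [Real.norm_eq_abs] at this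
      linarith [neg_abs_le (δ s).re]
    have hvert : ∀ s ∈ Icc (0 : ℝ) 1, (δ s).im ∈ uIcc p.im q.im →
        segment ℝ (δ s) ⟨-M, (δ s).im⟩ ⊆ U := by
      intro s hs hsim
      rw [segment_eq_image']
      rintro _ ⟨τ, hτ, rfl⟩
      convert hray s hs hsim (τ * ((δ s).re + M))
        (mul_nonneg hτ.1 (by linarith [hlow s hs])) using 1
      apply Complex.ext
      · simp; ring
      · simp
    have h0 : (0 : ℝ) ∈ Icc (0 : ℝ) 1 := ⟨le_rfl, zero_le_one⟩
    have h1 : (1 : ℝ) ∈ Icc (0 : ℝ) 1 := ⟨zero_le_one, le_rfl⟩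
    have vp := hvert 0 h0 (by rw [hδ0]; exact left_mem_uIcc)
    have vq := hvert 1 h1 (by rw [hδ1]; exact right_mem_uIcc)
    rw [hδ0] at vp
    rw [hδ1] at vq
    have hconst : ∀ {x y z : ℂ}, x.im = y.im → z ∈ segment ℝ x y → z.im = x.im := by
      intro x y z hxy hz
      rw [segment_eq_image'] at hz
      obtain ⟨τ, -, rfl⟩ := hz
      simp [hxy]
    set H : Set ℂ := (fun θ : ℝ => (⟨-M, θ⟩ : ℂ)) '' uIcc p.im q.im with hH
    have hHc : IsPreconnected H := by
      refine isPreconnected_uIcc.image _ (Continuous.continuousOn ?_)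
      have : (fun θ : ℝ => (⟨-M, θ⟩ : ℂ)) = fun θ : ℝ => ((-M : ℝ) : ℂ) + θ * Complex.I := by
        ext θ; apply Complex.ext <;> simp
      rw [this]
      fun_prop
    have hHU : H ⊆ U := by
      rintro _ ⟨θ, hθ, rfl⟩
      have h2 : uIcc p.im q.im ⊆ Complex.im '' (δ '' Icc 0 1) :=
        (hΓ.image Complex.im Complex.continuous_im.continuousOn).ordConnected.uIcc_subset
          ⟨p, hpΓ, rfl⟩ ⟨q, hqΓ, rfl⟩
      obtain ⟨_, ⟨s, hs, rfl⟩, rfl⟩ := h2 hθ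
      exact hvert s hs hθ (right_mem_segment _ _ _)
    refine ⟨segment ℝ p ⟨-M, p.im⟩ ∪ H ∪ segment ℝ q ⟨-M, q.im⟩, ?_, ?_, ?_, ?_, ?_⟩
    · refine IsPreconnected.union ⟨-M, q.im⟩ (Or.inr ⟨_, right_mem_uIcc, rfl⟩)
        (right_mem_segment _ _ _) ?_ (convex_segment _ _).isPreconnected
      exact IsPreconnected.union ⟨-M, p.im⟩ (right_mem_segment _ _ _) ⟨_, left_mem_uIcc, rfl⟩
        (convex_segment _ _).isPreconnected hHc
    · exact union_subset (union_subset vp hHU) vq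
    · exact Or.inl (Or.inl (left_mem_segment _ _ _))
    · exact Or.inr (left_mem_segment _ _ _)
    · rintro c ((hc | ⟨θ, hθ, rfl⟩) | hc)
      · rw [hconst (by rfl) hc]; exact left_mem_uIcc
      · exact hθ
      · rw [hconst (by rfl) hc]; exact right_mem_uIcc

end Connectivity

section Hull

open Filter Topology Set

variable {α₁ α₂ γ : ℝ} {Ω : Set (ℝ × ℝ)} {u : ℝ × ℝ → ℝ}

/-- A compact subset of an open convex set lies in a polytope inside that set. -/
lemma IsCompact.exists_subset_convexHull_finset {E : Type*} [NormedAddCommGroup E]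
    [NormedSpace ℝ E] [FiniteDimensional ℝ E] {K V : Set E} (hK : IsCompact K) (hV : IsOpen V)
    (hc : Convex ℝ V) (hKV : K ⊆ V) :
    ∃ t : Finset E, K ⊆ convexHull ℝ t ∧ convexHull ℝ t ⊆ V := by
  classical
  have key : ∀ x ∈ K, ∃ t : Finset E, x ∈ interior (convexHull ℝ (t : Set E)) ∧
      convexHull ℝ t ⊆ V := by
    intro x hx
    obtain ⟨t, ht, htV⟩ :=
      (convex_singleton x).exists_subset_interior_convexHull_finset_of_isCompact
      isCompact_singleton (by simpa using hV.mem_nhds (hKV hx))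
    exact ⟨t, ht rfl, htV⟩
  choose! T hT hTV using key
  obtain ⟨F, hF⟩ := hK.elim_nhds_subcover' (fun x _ => convexHull ℝ (T x : Set E))
    fun x hx => mem_interior_iff_mem_nhds.1 (hT x hx)
  refine ⟨F.biUnion fun x => T x, fun x hx => ?_, ?_⟩
  · obtain ⟨y, hy, hxy⟩ := mem_iUnion₂.1 (hF hx)
    refine convexHull_mono ?_ hxy
    exact_mod_cast Finset.subset_biUnion_of_mem (fun x : K => T x) hy
  · refine convexHull_min ?_ hc
    intro y hy
    obtain ⟨x, hx, hxy⟩ := Finset.mem_biUnion.1 (Finset.mem_coe.1 hy)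
    exact hTV x x.2 (subset_convexHull ℝ _ hxy)

lemma abs_arg_sub_lt_pi {w₁ w₂ : ℂ} (h₁ : 0 < w₁.re) (h₂ : 0 < w₂.re) :
    |(Complex.log w₂).im - (Complex.log w₁).im| < π := by
  have a₁ := Complex.abs_arg_lt_pi_div_two_iff.2 (Or.inl h₁)
  have a₂ := Complex.abs_arg_lt_pi_div_two_iff.2 (Or.inl h₂)
  rw [Complex.log_im, Complex.log_im, abs_lt]
  rw [abs_lt] at a₁ a₂
  constructor <;> linarith [a₁.1, a₁.2, a₂.1, a₂.2]

/-- In the flat metric, the part of `U` in an open half-plane seen from infinity is convex. -/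
lemma SpansSegments.convex {U : Set ℂ} (hU : SpansSegments U) (hUo : IsOpen U)
    (hUc : IsConnected U) (p : ℂ) : Convex ℝ {w : ℂ | 0 < w.re ∧ p + Complex.log w ∈ U} := by
  rw [convex_iff_segment_subset]
  rintro w₁ ⟨h₁, hw₁⟩ w₂ ⟨h₂, hw₂⟩ w hw
  have hre : 0 < w.re :=
    (convex_halfSpace_re_gt 0).segment_subset (show w₁ ∈ {c : ℂ | 0 < c.re} from h₁)
      (show w₂ ∈ {c : ℂ | 0 < c.re} from h₂) hw
  refine ⟨hre, ?_⟩
  have h₁0 : w₁ ≠ 0 := by rintro rfl; simp at h₁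
  have h₂0 : w₂ ≠ 0 := by rintro rfl; simp at h₂
  have h0 : w ≠ 0 := by rintro rfl; simp at hre
  obtain ⟨C, hC, hCU, hpC, hqC, him⟩ := hU.exists_isPreconnected hUo hUc hw₁ hw₂
  have hexp : Complex.exp (p + Complex.log w₂ - (p + Complex.log w₁)) = w₂ / w₁ := by
    rw [add_sub_add_left_eq_sub, Complex.exp_sub, Complex.exp_log h₁0, Complex.exp_log h₂0]
  have hX : w / w₁ ∈ segment ℝ 1 (Complex.exp (p + Complex.log w₂ - (p + Complex.log w₁))) := by
    rw [hexp]
    obtain ⟨a, b, ha, hb, hab, rfl⟩ := hw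
    refine ⟨a, b, ha, hb, hab, ?_⟩
    simp only [Complex.real_smul]
    field_simp
  have hlt : ∀ c ∈ C, |c.im - (p + Complex.log w₁).im| < π := by
    intro c hc
    refine lt_of_le_of_lt (abs_sub_left_of_mem_uIcc (him c hc)) ?_
    simpa using abs_arg_sub_lt_pi h₁ h₂
  have := hU C hC hCU _ hpC _ hqC hlt _ hX
  have hlog : Complex.log (w / w₁) = Complex.log w - Complex.log w₁ := by
    have e : w / w₁ = Complex.exp (Complex.log w - Complex.log w₁) := by
      rw [Complex.exp_sub, Complex.exp_log h₁0, Complex.exp_log h0]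
    have hlt := abs_lt.1 (abs_arg_sub_lt_pi h₁ hre)
    rw [e, Complex.log_exp]
    · simpa using hlt.1
    · simpa using hlt.2.le
  rw [hlog] at this
  convert this using 1
  ring

lemma SpansSegments.isOpen_convexChart {U : Set ℂ} (hUo : IsOpen U) (p : ℂ) :
    IsOpen {w : ℂ | 0 < w.re ∧ p + Complex.log w ∈ U} := by
  have hc : ContinuousOn (fun w : ℂ => p + Complex.log w) {w : ℂ | 0 < w.re} := by
    refine continuousOn_const.add fun w hw => ?_
    exact (Complex.differentiableAt_log (Complex.mem_slitPlane_iff.2 (Or.inl hw))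
      ).continuousAt.continuousWithinAt
  exact hc.isOpen_inter_preimage (isOpen_lt continuous_const Complex.continuous_re) hUo

/-- The rotation with cosine `c` and sine `s` about `x₀`, precomposed with the shear
`(x, y) ↦ (x, y + g x)`. -/
def shearCoord (x₀ : ℝ × ℝ) (c s : ℝ) (g : ℝ → ℝ) (z : ℝ × ℝ) : ℝ × ℝ :=
  (x₀.1 + z.1 * c - (z.2 + g z.1) * s, x₀.2 + z.1 * s + (z.2 + g z.1) * c)

lemma mem_Icc_of_shearCoord {x₀ : ℝ × ℝ} {c s r : ℝ} {g : ℝ → ℝ} (hcs : c ^ 2 + s ^ 2 = 1)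
    (hr : 0 < r) {z : ℝ × ℝ}
    (hz : ((shearCoord x₀ c s g z).1 - x₀.1) ^ 2 + ((shearCoord x₀ c s g z).2 - x₀.2) ^ 2 ≤ r ^ 2) :
    z.1 ∈ Icc (-r) r ∧ |z.2 + g z.1| ≤ r := by
  have e : ((shearCoord x₀ c s g z).1 - x₀.1) ^ 2 + ((shearCoord x₀ c s g z).2 - x₀.2) ^ 2
      = (c ^ 2 + s ^ 2) * (z.1 ^ 2 + (z.2 + g z.1) ^ 2) := by
    simp only [shearCoord]; ring
  rw [e, hcs, one_mul] at hz
  refine ⟨abs_le.1 (abs_le_of_sq_le_sq (by nlinarith [sq_nonneg (z.2 + g z.1)]) hr.le),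
    abs_le_of_sq_le_sq (by nlinarith [sq_nonneg z.1]) hr.le⟩

/-- A compact region which is convex along the coordinate lines of a sheared rotation, contains
`K₀`, and is contained in the domain. -/
structure ShearHull (Ω K₀ : Set (ℝ × ℝ)) (x₀ : ℝ × ℝ) (r c s : ℝ) (g g' : ℝ → ℝ)
    (K : Set (ℝ × ℝ)) : Prop where
  sq_add_sq : c ^ 2 + s ^ 2 = 1
  measurable : Measurable g
  hasDerivAt : ∀ x ∈ Icc (-r) r, HasDerivAt g (g' x) x
  abs_deriv_le : ∀ x ∈ Icc (-r) r, |g' x| ≤ 2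
  continuousOn_deriv : ContinuousOn g' (Icc (-r) r)
  isCompact : IsCompact K
  subset_box : K ⊆ Icc (-r) r ×ˢ Icc (-(3 * r)) (3 * r)
  ordConnected_fst : ∀ y, OrdConnected {x | (x, y) ∈ K}
  ordConnected_snd : ∀ x, OrdConnected {y | (x, y) ∈ K}
  mem_domain : ∀ z ∈ K, shearCoord x₀ c s g z ∈ Ω
  mem_hull : ∀ z, shearCoord x₀ c s g z ∈ K₀ → z ∈ K

lemma exists_shearHull_of_convex {K₀ : Set (ℝ × ℝ)} (hΩ : IsOpen Ω) (hc : Convex ℝ Ω)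
    (hK : IsCompact K₀) (hKΩ : K₀ ⊆ Ω) (x₀ : ℝ × ℝ) {r : ℝ} (hr : 0 < r)
    (hKr : ∀ x ∈ K₀, (x.1 - x₀.1) ^ 2 + (x.2 - x₀.2) ^ 2 ≤ r ^ 2) :
    ∃ K, ShearHull Ω K₀ x₀ r 1 0 (fun _ => 0) (fun _ => 0) K := by
  obtain ⟨t, ht, htΩ⟩ := hK.exists_subset_convexHull_finset hΩ hc hKΩ
  set L := convexHull ℝ (t : Set (ℝ × ℝ)) with hL
  have hLc : IsCompact L := t.finite_toSet.isCompact_convexHull ℝ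
  have hΘ : ∀ z, shearCoord x₀ 1 0 (fun _ => 0) z = x₀ + z := by
    intro z; simp [shearCoord, Prod.ext_iff]
  have hcv : Convex ℝ {z : ℝ × ℝ | x₀ + z ∈ L} :=
    (convex_convexHull ℝ _).translate_preimage_right x₀
  refine ⟨(Icc (-r) r ×ˢ Icc (-(3 * r)) (3 * r)) ∩ {z | x₀ + z ∈ L}, by norm_num, measurable_const,
    fun x _ => hasDerivAt_const _ _, by simp, continuousOn_const, ?_, inter_subset_left, ?_, ?_,
    fun z hz => by rw [hΘ]; exact htΩ hz.2, fun z hz => ?_⟩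
  · exact (isCompact_Icc.prod isCompact_Icc).inter_right
      (hLc.isClosed.preimage (continuous_const.add continuous_id))
  · intro y
    refine Convex.ordConnected ?_
    have := ((convex_Icc (-r) r).prod (convex_Icc (-(3 * r)) (3 * r))).inter hcv
    intro x₁ h₁ x₂ h₂ a b ha hb hab
    have := this h₁ h₂ ha hb hab
    have e : ((a • x₁ + b • x₂, y) : ℝ × ℝ) = a • (x₁, y) + b • (x₂, y) := by
      ext <;> simp
      rw [← add_mul, hab, one_mul]
    have := mem_of_eq_of_mem e this
    exact this
  · intro y
    refine Convex.ordConnected ?_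
    have := ((convex_Icc (-r) r).prod (convex_Icc (-(3 * r)) (3 * r))).inter hcv
    intro x₁ h₁ x₂ h₂ a b ha hb hab
    have := this h₁ h₂ ha hb hab
    have e : ((y, a • x₁ + b • x₂) : ℝ × ℝ) = a • (y, x₁) + b • (y, x₂) := by
      ext <;> simp
      rw [← add_mul, hab, one_mul]
    have := mem_of_eq_of_mem e this
    exact this
  · have h := mem_Icc_of_shearCoord (by norm_num) hr (hKr _ hz)
    rw [hΘ] at hz
    refine ⟨⟨h.1, ?_⟩, ht hz⟩
    have := abs_le.1 h.2
    constructor <;> linarith [this.1, this.2]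

lemma half_le_cos {x : ℝ} (hx : |x| ≤ 1) : 1 / 2 ≤ Real.cos x := by
  have := Real.one_sub_sq_div_two_le_cos (x := x)
  have h2 : x ^ 2 ≤ 1 := by rw [← sq_abs]; nlinarith [abs_nonneg x]
  linarith

lemma abs_lt_pi_div_two {x : ℝ} (hx : |x| ≤ 1) : x ∈ Ioo (-(π / 2)) (π / 2) := by
  have := abs_le.1 hx
  have := Real.pi_gt_three
  constructor <;> linarith

/-- The profile of the translating curves (grim reapers) of speed `β`. -/
def grimReaper (β x : ℝ) : ℝ := -Real.log (Real.cos (β * x)) / β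

lemma abs_grimReaper_le {β x r : ℝ} (hβ : 0 < β) (hβ1 : β ≤ 1) (hr1 : r ≤ 1)
    (hx : x ∈ Icc (-r) r) : |grimReaper β x| ≤ r := by
  have hxr : |x| ≤ r := abs_le.2 hx
  have hr0 : 0 ≤ r := (abs_nonneg x).trans hxr
  have hbx : |β * x| ≤ 1 := by
    rw [abs_mul, abs_of_pos hβ]; nlinarith [abs_nonneg x]
  have hc := half_le_cos hbx
  have hlog : 0 ≤ -Real.log (Real.cos (β * x)) := by
    have := Real.log_nonpos (by linarith) (Real.cos_le_one (β * x)); linarith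
  have hle : -Real.log (Real.cos (β * x)) ≤ (β * x) ^ 2 := by
    have h1 := Real.one_sub_inv_le_log_of_pos (x := Real.cos (β * x)) (by linarith)
    have h2 := Real.one_sub_sq_div_two_le_cos (x := β * x)
    have h3 : (Real.cos (β * x))⁻¹ ≤ 1 + (β * x) ^ 2 := by
      rw [inv_le_iff_one_le_mul₀ (by linarith)]
      have : (β * x) ^ 2 ≤ 1 := by rw [← sq_abs]; nlinarith [abs_nonneg (β * x)]
      nlinarith [sq_nonneg (β * x)]
    linarith
  rw [grimReaper, abs_div, abs_of_nonneg hlog, abs_of_pos hβ, div_le_iff₀ hβ]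
  have hx2 : x ^ 2 ≤ r ^ 2 := by rw [← sq_abs]; nlinarith [abs_nonneg x]
  have h4 : (β * x) ^ 2 ≤ β ^ 2 * r ^ 2 := by rw [mul_pow]; gcongr
  have h5 : β ^ 2 * r ^ 2 ≤ r * β := by
    have : β * r ≤ 1 := by nlinarith
    nlinarith [mul_nonneg hβ.le hr0]
  linarith

lemma hasDerivAt_grimReaper {β x : ℝ} (hβ : 0 < β) (hx : Real.cos (β * x) ≠ 0) :
    HasDerivAt (grimReaper β) (Real.tan (β * x)) x := by
  have h1 : HasDerivAt (fun y => β * y) β x := by simpa using (hasDerivAt_id x).const_mul β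
  have h2 := ((h1.cos.log hx).neg).div_const β
  have e : Real.tan (β * x) = -(-Real.sin (β * x) * β / Real.cos (β * x)) / β := by
    rw [Real.tan_eq_sin_div_cos]; field_simp
  rw [e]; exact h2

lemma abs_tan_le_two {x : ℝ} (hx : |x| ≤ 1) : |Real.tan x| ≤ 2 := by
  have hc := half_le_cos hx
  rw [Real.tan_eq_sin_div_cos, abs_div, abs_of_pos (by linarith : 0 < Real.cos x),
    div_le_iff₀ (by linarith)]
  linarith [Real.abs_sin_le_one x]

/-- The flat coordinate at height `y` above the grim reaper. -/
def flatCoord (β : ℝ) (z : ℝ × ℝ) : ℂ :=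
  ⟨Real.exp (β * z.2), Real.exp (β * z.2) * Real.tan (β * z.1)⟩

lemma log_flatCoord {β : ℝ} (hβ : 0 < β) {z : ℝ × ℝ} (hz : |β * z.1| ≤ 1) :
    Complex.log (flatCoord β z) = ⟨β * (z.2 + grimReaper β z.1), β * z.1⟩ := by
  have hc : 0 < Real.cos (β * z.1) := by linarith [half_le_cos hz]
  have e : flatCoord β z = Complex.exp ⟨β * (z.2 + grimReaper β z.1), β * z.1⟩ := by
    have h1 : β * (z.2 + grimReaper β z.1) = β * z.2 - Real.log (Real.cos (β * z.1)) := by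
      rw [grimReaper]; field_simp; ring
    have h2 : Real.exp (β * z.2)
        = Real.exp (β * (z.2 + grimReaper β z.1)) * Real.cos (β * z.1) := by
      rw [h1, Real.exp_sub, Real.exp_log hc]; field_simp
    apply Complex.ext
    · rw [Complex.exp_re]; exact h2
    · rw [Complex.exp_im]
      simp only [flatCoord]
      rw [h2, mul_assoc, mul_comm (Real.cos _), Real.tan_mul_cos hc.ne']
  have hI := abs_lt_pi_div_two hz
  rw [e, Complex.log_exp]
  · simp only; linarith [hI.1, Real.pi_pos]
  · simp only; linarith [hI.2, Real.pi_pos]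

lemma exists_shearHull_of_ne_zero (h : PlanarTranslator α₁ α₂ γ Ω u)
    (hα : α₁ ^ 2 + α₂ ^ 2 ≠ 0) {K₀ : Set (ℝ × ℝ)}
    (hK : IsCompact K₀) (hKΩ : K₀ ⊆ Ω) (x₀ : ℝ × ℝ) {r : ℝ} (hr : 0 < r) (hr1 : r ≤ 1)
    (hKr : ∀ x ∈ K₀, (x.1 - x₀.1) ^ 2 + (x.2 - x₀.2) ^ 2 ≤ r ^ 2) :
    ∃ c s g g' K, ShearHull Ω K₀ x₀ r c s g g' K := by
  have hα0 : 0 < α₁ ^ 2 + α₂ ^ 2 := lt_of_le_of_ne (by positivity) hα.symm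
  set β := √(α₁ ^ 2 + α₂ ^ 2) with hβd
  have hβ : 0 < β := Real.sqrt_pos.2 hα0
  have hβ2 : β ^ 2 = α₁ ^ 2 + α₂ ^ 2 := Real.sq_sqrt hα0.le
  have hβ1 : β ≤ 1 := Real.sqrt_le_one.2 (by nlinarith [h.norm_le, sq_nonneg γ])
  set Z := logCoord hα 0 with hZ
  have hUo : IsOpen (Z '' Ω) := Z.isOpenMap _ h.isOpen
  have hUc : IsConnected (Z '' Ω) := h.isConnected.image _ Z.continuous.continuousOn
  have hU : SpansSegments (Z '' Ω) := fun C hC hCU p hp q hq him X hX =>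
    h.add_log_mem hα hC hCU hp hq him hX
  set p := Z x₀ with hp
  set g := grimReaper β with hg
  set Θ := shearCoord x₀ (α₂ / β) (-α₁ / β) g with hΘ
  have hcs : (α₂ / β) ^ 2 + (-α₁ / β) ^ 2 = 1 := by
    field_simp; rw [hβ2]; ring
  have hbx : ∀ x ∈ Icc (-r) r, |β * x| ≤ 1 := by
    intro x hx
    have : |x| ≤ 1 := (abs_le.2 hx).trans hr1
    rw [abs_mul, abs_of_pos hβ]; nlinarith [abs_nonneg x]
  have hZΘ : ∀ z : ℝ × ℝ, Z (Θ z) = p + ⟨β * (z.2 + g z.1), β * z.1⟩ := by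
    intro z
    apply Complex.ext
    · rw [hp, Complex.add_re, hZ, logCoord_re, logCoord_re]
      simp only [hΘ, shearCoord, Complex.zero_re]
      field_simp
      linear_combination (-(z.2 + g z.1)) * hβ2
    · rw [hp, Complex.add_im, hZ, logCoord_im, logCoord_im]
      simp only [hΘ, shearCoord, Complex.zero_im]
      field_simp
      linear_combination (-z.1) * hβ2
  have hlog : ∀ z : ℝ × ℝ, z.1 ∈ Icc (-r) r → p + Complex.log (flatCoord β z) = Z (Θ z) := by
    intro z hz
    rw [hZΘ, log_flatCoord hβ (hbx _ hz)]
  have hbox : ∀ z, Θ z ∈ K₀ → z ∈ Icc (-r) r ×ˢ Icc (-(3 * r)) (3 * r) := by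
    intro z hz
    have h1 := mem_Icc_of_shearCoord hcs hr (hKr _ hz)
    have h2 := abs_le.1 (abs_grimReaper_le hβ hβ1 hr1 h1.1)
    have h3 := abs_le.1 h1.2
    refine ⟨h1.1, ?_, ?_⟩ <;> linarith [h2.1, h2.2, h3.1, h3.2]
  have hΨre : ∀ z, 0 < (flatCoord β z).re := fun z => Real.exp_pos _
  have hW : ∀ x ∈ K₀, ∃ z, z.1 ∈ Icc (-r) r ∧ Θ z = x := by
    intro x hx
    have hcs' : α₂ ^ 2 + α₁ ^ 2 = β ^ 2 := by rw [hβ2]; ring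
    set X := ((x.1 - x₀.1) * α₂ - (x.2 - x₀.2) * α₁) / β with hX
    set Y := ((x.1 - x₀.1) * α₁ + (x.2 - x₀.2) * α₂) / β with hY
    have e : Θ (X, Y - g X) = x := by
      simp only [hΘ, shearCoord, sub_add_cancel]
      apply Prod.ext
      · simp only [hX, hY]
        field_simp
        linear_combination (x.1 - x₀.1) * hcs'
      · simp only [hX, hY]
        field_simp
        linear_combination (x.2 - x₀.2) * hcs'
    exact ⟨_, (hbox _ (by rw [e]; exact hx)).1, e⟩
  have hWC : (fun x => Complex.exp (Z x - p)) '' K₀ ⊆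
      {w : ℂ | 0 < w.re ∧ p + Complex.log w ∈ Z '' Ω} := by
    rintro _ ⟨x, hx, rfl⟩
    obtain ⟨z, hz, rfl⟩ := hW x hx
    have e : Complex.exp (Z (Θ z) - p) = flatCoord β z := by
      rw [← hlog z hz, add_sub_cancel_left, Complex.exp_log]
      intro h0
      have := hΨre z
      rw [h0] at this
      simp at this
    simp only [e]
    exact ⟨hΨre z, by rw [hlog z hz]; exact mem_image_of_mem _ (hKΩ hx)⟩
  obtain ⟨t, ht, htC⟩ := (hK.image (Complex.continuous_exp.comp
    (Z.continuous.sub continuous_const))).exists_subset_convexHull_finset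
    (SpansSegments.isOpen_convexChart hUo p) (hU.convex hUo hUc p) hWC
  set L := convexHull ℝ (t : Set ℂ) with hL
  have hLc : IsCompact L := t.finite_toSet.isCompact_convexHull ℝ
  have hcos : ∀ x ∈ Icc (-r) r, 0 < Real.cos (β * x) := fun x hx => by
    linarith [half_le_cos (hbx x hx)]
  have htan : ContinuousOn (fun x => Real.tan (β * x)) (Icc (-r) r) := fun x hx =>
    ((Real.continuousAt_tan.2 (hcos x hx).ne').comp
      (by fun_prop : ContinuousAt (fun y => β * y) x)).continuousWithinAt
  have hΨ : ContinuousOn (flatCoord β) (Icc (-r) r ×ˢ Icc (-(3 * r)) (3 * r)) := by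
    have h1 : ContinuousOn (fun z : ℝ × ℝ => Real.exp (β * z.2))
      (Icc (-r) r ×ˢ Icc (-(3 * r)) (3 * r)) := by fun_prop
    have h2 := h1.mul (htan.comp continuousOn_fst fun z hz => hz.1)
    have h3 : flatCoord β = fun z => ((Real.exp (β * z.2) : ℝ) : ℂ)
        + ((Real.exp (β * z.2) * Real.tan (β * z.1) : ℝ) : ℂ) * Complex.I := by
      funext z
      apply Complex.ext <;> simp only [flatCoord, Complex.add_re, Complex.add_im, Complex.ofReal_re,
        Complex.ofReal_im, Complex.re_ofReal_mul, Complex.im_ofReal_mul, Complex.I_re,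
        Complex.I_im] <;> ring
    rw [h3]
    exact (Complex.continuous_ofReal.comp_continuousOn h1).add
      ((Complex.continuous_ofReal.comp_continuousOn h2).mul continuousOn_const)
  have hmono : ∀ x₁ ∈ Icc (-r) r, ∀ x₂ ∈ Icc (-r) r, x₁ ≤ x₂ →
      Real.tan (β * x₁) ≤ Real.tan (β * x₂) := fun x₁ h₁ x₂ h₂ h12 =>
    Real.strictMonoOn_tan.monotoneOn (abs_lt_pi_div_two (hbx _ h₁)) (abs_lt_pi_div_two (hbx _ h₂))
      (mul_le_mul_of_nonneg_left h12 hβ.le)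
  have hLv : Convex ℝ L := convex_convexHull ℝ _
  refine ⟨α₂ / β, -α₁ / β, g, fun x => Real.tan (β * x),
    (Icc (-r) r ×ˢ Icc (-(3 * r)) (3 * r)) ∩ flatCoord β ⁻¹' L, hcs, ?_,
    fun x hx => hasDerivAt_grimReaper hβ (hcos x hx).ne', fun x hx => abs_tan_le_two (hbx x hx),
    htan, ?_, inter_subset_left, ?_, ?_, ?_, ?_⟩
  · exact ((Real.measurable_log.comp (Real.measurable_cos.comp
      (measurable_const.mul measurable_id))).neg).div_const β
  · exact (isCompact_Icc.prod isCompact_Icc).of_isClosed_subset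
      (hΨ.preimage_isClosed_of_isClosed (isClosed_Icc.prod isClosed_Icc) hLc.isClosed)
      inter_subset_left
  · intro y
    have hoc : OrdConnected {τ : ℝ | (⟨Real.exp (β * y), Real.exp (β * y) * τ⟩ : ℂ) ∈ L} := by
      refine Convex.ordConnected ?_
      intro a ha b hb m n hm hn hmn
      have := hLv ha hb hm hn hmn
      change (_ : ℂ) ∈ L
      refine mem_of_eq_of_mem ?_ this
      apply Complex.ext
      · simp [← add_mul, hmn]
      · simp; ring
    refine ⟨fun x₁ h₁ x₂ h₂ x hx => ?_⟩
    have hxr : x ∈ Icc (-r) r := ⟨h₁.1.1.1.trans hx.1, hx.2.trans h₂.1.1.2⟩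
    exact ⟨⟨hxr, h₁.1.2⟩, hoc.out h₁.2 h₂.2
      ⟨hmono _ h₁.1.1 _ hxr hx.1, hmono _ hxr _ h₂.1.1 hx.2⟩⟩
  · intro x
    have hoc : OrdConnected {τ : ℝ | (⟨τ, τ * Real.tan (β * x)⟩ : ℂ) ∈ L} := by
      refine Convex.ordConnected ?_
      intro a ha b hb m n hm hn hmn
      have := hLv ha hb hm hn hmn
      change (_ : ℂ) ∈ L
      refine mem_of_eq_of_mem ?_ this
      apply Complex.ext
      · simp
      · simp; ring
    refine ⟨fun y₁ h₁ y₂ h₂ y hy => ⟨⟨h₁.1.1, h₁.1.2.1.trans hy.1, hy.2.trans h₂.1.2.2⟩,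
      hoc.out h₁.2 h₂.2 ⟨?_, ?_⟩⟩⟩
    · exact Real.exp_le_exp.2 (mul_le_mul_of_nonneg_left hy.1 hβ.le)
    · exact Real.exp_le_exp.2 (mul_le_mul_of_nonneg_left hy.2 hβ.le)
  · rintro z ⟨hz, hzL⟩
    have := (htC hzL).2
    rw [hlog z hz.1] at this
    obtain ⟨x, hx, hxz⟩ := this
    exact mem_of_eq_of_mem (Z.injective hxz).symm hx
  · intro z hz
    refine ⟨hbox z hz, ht ⟨_, hz, ?_⟩⟩
    change Complex.exp (Z (Θ z) - p) = _
    rw [← hlog z (hbox z hz).1, add_sub_cancel_left, Complex.exp_log]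
    intro h0
    have := hΨre z
    rw [h0] at this
    simp at this

/-- Compact subsets of the domain of small diameter have sheared hulls in the domain. -/
lemma PlanarTranslator.exists_shearHull (h : PlanarTranslator α₁ α₂ γ Ω u) {K₀ : Set (ℝ × ℝ)}
    (hK : IsCompact K₀) (hKΩ : K₀ ⊆ Ω) (x₀ : ℝ × ℝ) {r : ℝ} (hr : 0 < r) (hr1 : r ≤ 1)
    (hKr : ∀ x ∈ K₀, (x.1 - x₀.1) ^ 2 + (x.2 - x₀.2) ^ 2 ≤ r ^ 2) :
    ∃ c s g g' K, ShearHull Ω K₀ x₀ r c s g g' K := by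
  by_cases hα : α₁ ^ 2 + α₂ ^ 2 = 0
  · have h1 : α₁ = 0 := by nlinarith [sq_nonneg α₁, sq_nonneg α₂]
    have h2 : α₂ = 0 := by nlinarith [sq_nonneg α₁, sq_nonneg α₂]
    subst h1 h2
    exact ⟨_, _, _, _, exists_shearHull_of_convex h.isOpen h.convex hK hKΩ x₀ hr hKr⟩
  · exact exists_shearHull_of_ne_zero h hα hK hKΩ x₀ hr hr1 hKr

end Hull

section BoxIntegral

open Filter Topology Set

lemma IsCompact.section_fst {K : Set (ℝ × ℝ)} (hK : IsCompact K) (y : ℝ) :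
    IsCompact {x | (x, y) ∈ K} :=
  (hK.image continuous_fst).of_isClosed_subset
    (hK.isClosed.preimage (continuous_id.prodMk continuous_const)) fun _ hx => ⟨_, hx, rfl⟩

/-- A horizontal derivative integrates to a boundary term over a compact set with convex
horizontal sections. -/
lemma abs_setIntegral_deriv_le {K : Set (ℝ × ℝ)} (hK : IsCompact K) {c d B : ℝ} (hcd : c ≤ d)
    (hB0 : 0 ≤ B) (hsub : ∀ z ∈ K, z.2 ∈ Icc c d) (hord : ∀ y, OrdConnected {x | (x, y) ∈ K})
    {P P' : ℝ × ℝ → ℝ} (hP : ∀ z ∈ K, HasDerivAt (fun x => P (x, z.2)) (P' z) z.1)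
    (hc : ContinuousOn P' K) (hB : ∀ z ∈ K, |P z| ≤ B) :
    |∫ z in K, P' z| ≤ 2 * B * (d - c) := by
  have hKint : Integrable (K.indicator P') (volume : Measure (ℝ × ℝ)) :=
    (integrable_indicator_iff hK.measurableSet).2 (hc.integrableOn_compact hK)
  have hsec : ∀ y, ‖∫ x, K.indicator P' (x, y)‖ ≤ (Icc c d).indicator (fun _ => 2 * B) y := by
    intro y
    set T := {x | (x, y) ∈ K} with hT
    have e : (fun x => K.indicator P' (x, y)) = T.indicator (fun x => P' (x, y)) := rfl
    have hTc : IsCompact T := hK.section_fst y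
    rw [e, integral_indicator hTc.measurableSet]
    rcases T.eq_empty_or_nonempty with h0 | hne
    · rw [h0]
      simp only [Measure.restrict_empty, integral_zero_measure, norm_zero]
      exact indicator_nonneg (fun _ _ => by positivity) _
    · obtain ⟨x₀, hx₀⟩ := hne
      rw [indicator_of_mem (hsub _ hx₀)]
      have hTI := eq_Icc_of_connected_compact ⟨⟨x₀, hx₀⟩, (hord y).isPreconnected⟩ hTc
      set m := sInf T
      set M := sSup T
      have hmM : m ≤ M := by
        rw [hTI] at hx₀; exact hx₀.1.trans hx₀.2
      have hm : (m, y) ∈ K := by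
        have : m ∈ T := by rw [hTI]; exact left_mem_Icc.2 hmM
        exact this
      have hM : (M, y) ∈ K := by
        have : M ∈ T := by rw [hTI]; exact right_mem_Icc.2 hmM
        exact this
      have hKI : ∀ x ∈ uIcc m M, (x, y) ∈ K := by
        intro x hx
        rw [uIcc_of_le hmM, ← hTI] at hx
        exact hx
      rw [hTI, integral_Icc_eq_integral_Ioc, ← intervalIntegral.integral_of_le hmM,
        intervalIntegral.integral_eq_sub_of_hasDerivAt (f := fun x => P (x, y))
          (fun x hx => hP _ (hKI x hx))]
      · calc ‖P (M, y) - P (m, y)‖ ≤ ‖P (M, y)‖ + ‖P (m, y)‖ := norm_sub_le _ _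
          _ ≤ B + B := add_le_add (hB _ hM) (hB _ hm)
          _ = 2 * B := by ring
      · refine ContinuousOn.intervalIntegrable ?_
        exact hc.comp (by fun_prop) fun x hx => hKI x hx
  rw [← integral_indicator hK.measurableSet, Measure.volume_eq_prod,
    integral_prod_symm _ (by rwa [← Measure.volume_eq_prod])]
  calc |∫ y, ∫ x, K.indicator P' (x, y)| ≤ ∫ y, (Icc c d).indicator (fun _ => 2 * B) y :=
        norm_integral_le_of_norm_le
          ((integrable_indicator_iff measurableSet_Icc).2 continuousOn_const.integrableOn_Icc)
          (Eventually.of_forall hsec)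
    _ = 2 * B * (d - c) := by
        rw [integral_indicator measurableSet_Icc, setIntegral_const]
        simp [hcd, mul_comm]

lemma abs_setIntegral_deriv_snd_le {K : Set (ℝ × ℝ)} (hK : IsCompact K) {c d B : ℝ} (hcd : c ≤ d)
    (hB0 : 0 ≤ B) (hsub : ∀ z ∈ K, z.1 ∈ Icc c d) (hord : ∀ x, OrdConnected {y | (x, y) ∈ K})
    {P P' : ℝ × ℝ → ℝ} (hP : ∀ z ∈ K, HasDerivAt (fun y => P (z.1, y)) (P' z) z.2)
    (hc : ContinuousOn P' K) (hB : ∀ z ∈ K, |P z| ≤ B) :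
    |∫ z in K, P' z| ≤ 2 * B * (d - c) := by
  have hswap : MeasurePreserving (Prod.swap : ℝ × ℝ → ℝ × ℝ) volume volume :=
    Measure.measurePreserving_swap
  have hK' : IsCompact (Prod.swap ⁻¹' K : Set (ℝ × ℝ)) := by
    rw [← Set.image_swap_eq_preimage_swap]; exact hK.image continuous_swap
  have := abs_setIntegral_deriv_le (P := P ∘ Prod.swap) (P' := P' ∘ Prod.swap) hK' hcd hB0
    (fun z hz => hsub _ hz) hord (fun z hz => hP _ hz)
    (hc.comp continuous_swap.continuousOn fun z hz => hz) (fun z hz => hB _ hz)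
  rwa [Function.comp_def, hswap.setIntegral_preimage_emb
    MeasurableEquiv.prodComm.measurableEmbedding] at this

/-- Sheared rotations preserve area. -/
lemma measurePreserving_shearCoord (x₀ : ℝ × ℝ) {c s : ℝ} (hcs : c ^ 2 + s ^ 2 = 1) {g : ℝ → ℝ}
    (hg : Measurable g) : MeasurePreserving (shearCoord x₀ c s g) volume volume := by
  have h1 : MeasurePreserving (fun z : ℝ × ℝ => (z.1, z.2 + g z.1)) volume volume := by
    refine (MeasurePreserving.id volume).skew_product (g := fun x y => y + g x) ?_ ?_
    · exact (measurable_snd.add (hg.comp measurable_fst))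
    · exact Eventually.of_forall fun x => (measurePreserving_add_right volume (g x)).map_eq
  set A : (ℝ × ℝ) →ₗ[ℝ] (ℝ × ℝ) :=
    Matrix.toLin (Module.Basis.finTwoProd ℝ) (Module.Basis.finTwoProd ℝ)
    !![c, -s; s, c] with hA
  have hdet : LinearMap.det A = 1 := by
    rw [hA, LinearMap.det_toLin, Matrix.det_fin_two_of]; linarith
  have h2 : MeasurePreserving A volume volume := by
    refine ⟨A.continuous_of_finiteDimensional.measurable, ?_⟩
    rw [Measure.map_linearMap_addHaar_eq_smul_addHaar _ (by rw [hdet]; exact one_ne_zero), hdet]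
    simp
  have h3 := ((measurePreserving_add_left volume x₀).comp h2).comp h1
  convert h3 using 1
  funext z
  simp only [shearCoord, hA, Function.comp, Matrix.toLin_finTwoProd_apply]
  ext <;> simp <;> ring

end BoxIntegral

section AreaEstimate

open Filter Topology Set

variable {α₁ α₂ γ : ℝ} {Ω : Set (ℝ × ℝ)} {u : ℝ × ℝ → ℝ}

lemma DifferentiableAt.hasDerivAt_pds {f : ℝ × ℝ → ℝ} {x : ℝ × ℝ} (h : DifferentiableAt ℝ f x) :
    HasDerivAt (fun t => f (t, x.2)) (pds f x) x.1 :=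
  h.hasFDerivAt.comp_hasDerivAt x.1 ((hasDerivAt_id x.1).prodMk (hasDerivAt_const x.1 x.2))

lemma DifferentiableAt.hasDerivAt_pdt {f : ℝ × ℝ → ℝ} {x : ℝ × ℝ} (h : DifferentiableAt ℝ f x) :
    HasDerivAt (fun t => f (x.1, t)) (pdt f x) x.2 :=
  h.hasFDerivAt.comp_hasDerivAt x.2 ((hasDerivAt_const x.2 x.1).prodMk (hasDerivAt_id x.2))

/-- The area element of the graph of `u`. -/
def areaElement (u : ℝ × ℝ → ℝ) (x : ℝ × ℝ) : ℝ := √(1 + pds u x ^ 2 + pdt u x ^ 2)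

lemma areaElement_pos (u : ℝ × ℝ → ℝ) (x : ℝ × ℝ) : 0 < areaElement u x :=
  Real.sqrt_pos.2 (by positivity)

lemma sq_areaElement (u : ℝ × ℝ → ℝ) (x : ℝ × ℝ) :
    areaElement u x ^ 2 = 1 + pds u x ^ 2 + pdt u x ^ 2 :=
  Real.sq_sqrt (by positivity)

lemma measurable_areaElement (u : ℝ × ℝ → ℝ) : Measurable (areaElement u) := by
  have h1 : Measurable (pds u) := measurable_fderiv_apply_const ℝ u _
  have h2 : Measurable (pdt u) := measurable_fderiv_apply_const ℝ u _
  exact (((h1.pow_const 2).const_add 1).add (h2.pow_const 2)).sqrt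

lemma PlanarTranslator.contDiffAt_pds (h : PlanarTranslator α₁ α₂ γ Ω u) {x : ℝ × ℝ}
    (hx : x ∈ Ω) : ContDiffAt ℝ (⊤ : ℕ∞) (pds u) x :=
  (h.contDiffAt hx).pds (by exact_mod_cast le_rfl)

lemma PlanarTranslator.contDiffAt_pdt (h : PlanarTranslator α₁ α₂ γ Ω u) {x : ℝ × ℝ}
    (hx : x ∈ Ω) : ContDiffAt ℝ (⊤ : ℕ∞) (pdt u) x :=
  (h.contDiffAt hx).pdt (by exact_mod_cast le_rfl)

lemma PlanarTranslator.contDiffAt_areaElement (h : PlanarTranslator α₁ α₂ γ Ω u) {x : ℝ × ℝ}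
    (hx : x ∈ Ω) : ContDiffAt ℝ (⊤ : ℕ∞) (areaElement u) x :=
  ((contDiffAt_const.add ((h.contDiffAt_pds hx).pow 2)).add ((h.contDiffAt_pdt hx).pow 2)).sqrt
    (by positivity)

lemma PlanarTranslator.contDiffAt_field (h : PlanarTranslator α₁ α₂ γ Ω u) {T : ℝ → ℝ}
    (hT : ContDiff ℝ (⊤ : ℕ∞) T) {x : ℝ × ℝ} (hx : x ∈ Ω) :
    ContDiffAt ℝ (⊤ : ℕ∞) (fun y => T (u y) * pds u y / areaElement u y) x ∧
      ContDiffAt ℝ (⊤ : ℕ∞) (fun y => T (u y) * pdt u y / areaElement u y) x := by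
  have h1 := hT.contDiffAt.comp x (h.contDiffAt hx)
  exact ⟨(h1.mul (h.contDiffAt_pds hx)).div (h.contDiffAt_areaElement hx) (areaElement_pos u x).ne',
    (h1.mul (h.contDiffAt_pdt hx)).div (h.contDiffAt_areaElement hx) (areaElement_pos u x).ne'⟩

lemma div_algebra {W T T' p q ps pt qs qt k : ℝ} (hW : W ≠ 0) (hD : W ^ 2 = 1 + p ^ 2 + q ^ 2)
    (hpde : (1 + q ^ 2) * ps - 2 * p * q * pt + (1 + p ^ 2) * qt = (1 + p ^ 2 + q ^ 2) * k)
    (hs : qs = pt) :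
    ((T' * p * p + T * ps) * W - T * p * ((2 * p * ps + 2 * q * qs) / (2 * W))) / W ^ 2
      + ((T' * q * q + T * qt) * W - T * q * ((2 * p * pt + 2 * q * qt) / (2 * W))) / W ^ 2
    = T' * (p ^ 2 + q ^ 2) / W + T * k / W := by
  subst hs
  field_simp
  rw [← hD] at hpde
  have : W ^ 2 * (T * k) = T * ((1 + q ^ 2) * ps - 2 * p * q * qs + (1 + p ^ 2) * qt) := by
    rw [hpde]; ring
  have e1 : W ^ 2 * ps = (1 + p ^ 2 + q ^ 2) * ps := by rw [hD]
  have e2 : W ^ 2 * qt = (1 + p ^ 2 + q ^ 2) * qt := by rw [hD]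
  linear_combination T * e1 + T * e2 - this

/-- The divergence of a truncated unit normal field of a translating graph. -/
lemma PlanarTranslator.div_field (h : PlanarTranslator α₁ α₂ γ Ω u) {T : ℝ → ℝ}
    (hT : ContDiff ℝ (⊤ : ℕ∞) T) {x : ℝ × ℝ} (hx : x ∈ Ω) :
    pds (fun y => T (u y) * pds u y / areaElement u y) x
      + pdt (fun y => T (u y) * pdt u y / areaElement u y) x
    = deriv T (u x) * (pds u x ^ 2 + pdt u x ^ 2) / areaElement u x
      + T (u x) * (γ - pds u x * α₁ - pdt u x * α₂) / areaElement u x := by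
  have hn : ((⊤ : ℕ∞) : WithTop ℕ∞) ≠ 0 := by simp
  have du := (h.contDiffAt hx).differentiableAt hn
  have dp := (h.contDiffAt_pds hx).differentiableAt hn
  have dq := (h.contDiffAt_pdt hx).differentiableAt hn
  have d1 := (h.contDiffAt_field hT hx).1.differentiableAt hn
  have d2 := (h.contDiffAt_field hT hx).2.differentiableAt hn
  have dT : HasDerivAt T (deriv T (u x)) (u x) := (hT.differentiable hn _).hasDerivAt
  have hpos : (1 : ℝ) + pds u x ^ 2 + pdt u x ^ 2 ≠ 0 := by positivity
  have hW := (areaElement_pos u x).ne'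
  have s1 := HasDerivAt.comp x.1 (h := fun t => u (t, x.2)) dT du.hasDerivAt_pds
  have t1 := HasDerivAt.comp x.2 (h := fun t => u (x.1, t)) dT du.hasDerivAt_pdt
  have s2 := (((dp.hasDerivAt_pds.pow 2).const_add 1).add (dq.hasDerivAt_pds.pow 2)).sqrt hpos
  have t2 := (((dp.hasDerivAt_pdt.pow 2).const_add 1).add (dq.hasDerivAt_pdt.pow 2)).sqrt hpos
  have s3 := (s1.mul dp.hasDerivAt_pds).div s2 hW
  have t3 := (t1.mul dq.hasDerivAt_pdt).div t2 hW
  have e1 := d1.hasDerivAt_pds.unique s3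
  have e2 := d2.hasDerivAt_pdt.unique t3
  have hc := pds_pdt_comm (by exact_mod_cast contDiffAt_infty.1 (h.contDiffAt hx) 2)
  rw [e1, e2, ← div_algebra hW (sq_areaElement u x) (h.pde x hx) hc]
  simp [areaElement]

lemma ContDiffOn.continuousOn_pds_pdt {f : ℝ × ℝ → ℝ} (hΩ : IsOpen Ω) (hf : ContDiffOn ℝ 1 f Ω) :
    ContinuousOn (pds f) Ω ∧ ContinuousOn (pdt f) Ω := by
  have := hf.continuousOn_fderiv_of_isOpen hΩ le_rfl
  exact ⟨this.clm_apply continuousOn_const, this.clm_apply continuousOn_const⟩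

lemma ShearHull.hasDerivAt_comp_fst {K₀ K : Set (ℝ × ℝ)} {x₀ : ℝ × ℝ} {r c s : ℝ} {g g' : ℝ → ℝ}
    (hK : ShearHull Ω K₀ x₀ r c s g g' K) {f : ℝ × ℝ → ℝ} {z : ℝ × ℝ} (hz : z ∈ K)
    (hf : DifferentiableAt ℝ f (shearCoord x₀ c s g z)) :
    HasDerivAt (fun x => f (shearCoord x₀ c s g (x, z.2)))
      ((c - g' z.1 * s) * pds f (shearCoord x₀ c s g z)
        + (s + g' z.1 * c) * pdt f (shearCoord x₀ c s g z)) z.1 := by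
  have hg := hK.hasDerivAt z.1 (hK.subset_box hz).1
  have h1 : HasDerivAt (fun x => shearCoord x₀ c s g (x, z.2))
      (c - g' z.1 * s, s + g' z.1 * c) z.1 := by
    have a :=
      (((hasDerivAt_id z.1).mul_const c).const_add x₀.1).sub ((hg.const_add z.2).mul_const s)
    have b :=
      (((hasDerivAt_id z.1).mul_const s).const_add x₀.2).add ((hg.const_add z.2).mul_const c)
    simpa [shearCoord] using a.prodMk b
  have := hf.hasFDerivAt.comp_hasDerivAt z.1 h1
  rwa [fderiv_apply_eq_pds_pdt] at this

lemma hasDerivAt_comp_shearCoord_snd {x₀ : ℝ × ℝ} {c s : ℝ} {g : ℝ → ℝ}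
    {f : ℝ × ℝ → ℝ} {z : ℝ × ℝ} (hf : DifferentiableAt ℝ f (shearCoord x₀ c s g z)) :
    HasDerivAt (fun y => f (shearCoord x₀ c s g (z.1, y)))
      (-s * pds f (shearCoord x₀ c s g z) + c * pdt f (shearCoord x₀ c s g z)) z.2 := by
  have h1 : HasDerivAt (fun y => shearCoord x₀ c s g (z.1, y)) (-s, c) z.2 := by
    have a := ((((hasDerivAt_id z.2).add_const (g z.1)).mul_const s)).const_sub (x₀.1 + z.1 * c)
    have b := ((((hasDerivAt_id z.2).add_const (g z.1)).mul_const c)).const_add (x₀.2 + z.1 * s)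
    simpa [shearCoord] using a.prodMk b
  have := hf.hasFDerivAt.comp_hasDerivAt z.2 h1
  rwa [fderiv_apply_eq_pds_pdt] at this

lemma ShearHull.continuousOn {K₀ K : Set (ℝ × ℝ)} {x₀ : ℝ × ℝ} {r c s : ℝ} {g g' : ℝ → ℝ}
    (hK : ShearHull Ω K₀ x₀ r c s g g' K) : ContinuousOn (shearCoord x₀ c s g) K := by
  have h1 : ContinuousOn (fun z : ℝ × ℝ => g z.1) K :=
    ContinuousOn.comp (g := g) (fun x hx => (hK.hasDerivAt x hx).continuousAt.continuousWithinAt)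
      continuousOn_fst fun z hz => (hK.subset_box hz).1
  have h2 : ContinuousOn (fun z : ℝ × ℝ => z.2 + g z.1) K := continuousOn_snd.add h1
  exact ((continuousOn_const.add (continuousOn_fst.mul continuousOn_const)).sub
    (h2.mul continuousOn_const)).prodMk
    ((continuousOn_const.add (continuousOn_fst.mul continuousOn_const)).add
    (h2.mul continuousOn_const))

/-- The flux of a bounded field through the boundary of a sheared hull is linear in its size. -/
lemma ShearHull.abs_integral_div_le {K₀ K : Set (ℝ × ℝ)} {x₀ : ℝ × ℝ} {r c s B : ℝ} {g g' : ℝ → ℝ}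
    (hK : ShearHull Ω K₀ x₀ r c s g g' K) (hΩ : IsOpen Ω) (hr : 0 < r) {f₁ f₂ : ℝ × ℝ → ℝ}
    (h₁ : ContDiffOn ℝ 1 f₁ Ω) (h₂ : ContDiffOn ℝ 1 f₂ Ω) (hB0 : 0 ≤ B)
    (hB : ∀ x ∈ Ω, f₁ x ^ 2 + f₂ x ^ 2 ≤ B ^ 2) :
    |∫ z in K, (pds f₁ (shearCoord x₀ c s g z) + pdt f₂ (shearCoord x₀ c s g z))| ≤ 24 * B * r := by
  set Θ := shearCoord x₀ c s g with hΘ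
  have hcs := hK.sq_add_sq
  have hΘc : ContinuousOn Θ K := hK.continuousOn
  have hmaps : MapsTo Θ K Ω := hK.mem_domain
  have d₁ : ∀ z ∈ K, DifferentiableAt ℝ f₁ (Θ z) := fun z hz =>
    (h₁.contDiffAt (hΩ.mem_nhds (hmaps hz))).differentiableAt one_ne_zero
  have d₂ : ∀ z ∈ K, DifferentiableAt ℝ f₂ (Θ z) := fun z hz =>
    (h₂.contDiffAt (hΩ.mem_nhds (hmaps hz))).differentiableAt one_ne_zero
  obtain ⟨c₁s, c₁t⟩ := h₁.continuousOn_pds_pdt hΩ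
  obtain ⟨c₂s, c₂t⟩ := h₂.continuousOn_pds_pdt hΩ
  replace c₁s : ContinuousOn (fun z => pds f₁ (Θ z)) K := c₁s.comp hΘc hmaps
  replace c₁t : ContinuousOn (fun z => pdt f₁ (Θ z)) K := c₁t.comp hΘc hmaps
  replace c₂s : ContinuousOn (fun z => pds f₂ (Θ z)) K := c₂s.comp hΘc hmaps
  replace c₂t : ContinuousOn (fun z => pdt f₂ (Θ z)) K := c₂t.comp hΘc hmaps
  have cg : ContinuousOn (fun z : ℝ × ℝ => g' z.1) K :=
    hK.continuousOn_deriv.comp continuousOn_fst fun z hz => (hK.subset_box hz).1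
  have hN : ∀ z ∈ K, |c * f₁ (Θ z) + s * f₂ (Θ z)| ≤ B ∧ |-s * f₁ (Θ z) + c * f₂ (Θ z)| ≤ B := by
    intro z hz
    have hb := hB _ (hmaps hz)
    have e : (c * f₁ (Θ z) + s * f₂ (Θ z)) ^ 2 + (-s * f₁ (Θ z) + c * f₂ (Θ z)) ^ 2 ≤ B ^ 2 := by
      have : (c * f₁ (Θ z) + s * f₂ (Θ z)) ^ 2 + (-s * f₁ (Θ z) + c * f₂ (Θ z)) ^ 2
          = (c ^ 2 + s ^ 2) * (f₁ (Θ z) ^ 2 + f₂ (Θ z) ^ 2) := by ring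
      rwa [this, hcs, one_mul]
    constructor <;> refine abs_le_of_sq_le_sq (le_trans ?_ e) hB0
    · exact le_add_of_nonneg_right (sq_nonneg _)
    · exact le_add_of_nonneg_left (sq_nonneg _)
  set P₁ : ℝ × ℝ → ℝ := fun z =>
    (c * ((c - g' z.1 * s) * pds f₁ (Θ z) + (s + g' z.1 * c) * pdt f₁ (Θ z))
    + s * ((c - g' z.1 * s) * pds f₂ (Θ z) + (s + g' z.1 * c) * pdt f₂ (Θ z))) with hP₁
  set P₂ : ℝ × ℝ → ℝ := fun z => (-s * (-s * pds f₁ (Θ z) + c * pdt f₁ (Θ z))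
      + c * (-s * pds f₂ (Θ z) + c * pdt f₂ (Θ z)))
    - g' z.1 * (c * (-s * pds f₁ (Θ z) + c * pdt f₁ (Θ z))
      + s * (-s * pds f₂ (Θ z) + c * pdt f₂ (Θ z))) with hP₂
  have cc : ∀ m : ℝ, ContinuousOn (fun _ : ℝ × ℝ => m) K := fun m => continuousOn_const
  have hc₁ : ContinuousOn P₁ K :=
    ((cc c).mul ((((cc c).sub (cg.mul (cc s))).mul c₁s).add
      (((cc s).add (cg.mul (cc c))).mul c₁t))).add
    ((cc s).mul ((((cc c).sub (cg.mul (cc s))).mul c₂s).add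
      (((cc s).add (cg.mul (cc c))).mul c₂t)))
  have hd₁ : ContinuousOn (fun z => -s * pds f₁ (Θ z) + c * pdt f₁ (Θ z)) K :=
    ((cc (-s)).mul c₁s).add ((cc c).mul c₁t)
  have hd₂ : ContinuousOn (fun z => -s * pds f₂ (Θ z) + c * pdt f₂ (Θ z)) K :=
    ((cc (-s)).mul c₂s).add ((cc c).mul c₂t)
  have hc₂ : ContinuousOn P₂ K :=
    (((cc (-s)).mul hd₁).add ((cc c).mul hd₂)).sub
      (cg.mul (((cc c).mul hd₁).add ((cc s).mul hd₂)))
  have b₁ := abs_setIntegral_deriv_le (P := fun z => c * f₁ (Θ z) + s * f₂ (Θ z)) (P' := P₁)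
    hK.isCompact (c := -(3 * r)) (d := 3 * r) (by linarith) hB0
    (fun z hz => (hK.subset_box hz).2) hK.ordConnected_fst
    (fun z hz => ((hK.hasDerivAt_comp_fst hz (d₁ z hz)).const_mul c).add
      ((hK.hasDerivAt_comp_fst hz (d₂ z hz)).const_mul s)) hc₁ (fun z hz => (hN z hz).1)
  have b₂ := abs_setIntegral_deriv_snd_le (P := fun z => (-s * f₁ (Θ z) + c * f₂ (Θ z))
      - g' z.1 * (c * f₁ (Θ z) + s * f₂ (Θ z))) (P' := P₂) (B := 3 * B)
    hK.isCompact (c := -r) (d := r) (by linarith) (by positivity)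
    (fun z hz => (hK.subset_box hz).1) hK.ordConnected_snd
    (fun z hz => (((hasDerivAt_comp_shearCoord_snd (d₁ z hz)).const_mul (-s)).add
      ((hasDerivAt_comp_shearCoord_snd (d₂ z hz)).const_mul c)).sub
      ((((hasDerivAt_comp_shearCoord_snd (d₁ z hz)).const_mul c).add
      ((hasDerivAt_comp_shearCoord_snd (d₂ z hz)).const_mul s)).const_mul (g' z.1))) hc₂ (by
      intro z hz
      obtain ⟨n1, n2⟩ := hN z hz
      have hg := hK.abs_deriv_le z.1 (hK.subset_box hz).1
      refine (abs_sub _ _).trans ?_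
      rw [abs_mul]
      nlinarith [mul_le_mul hg n1 (abs_nonneg _) (by norm_num)])
  have e : ∀ z, pds f₁ (Θ z) + pdt f₂ (Θ z) = P₁ z + P₂ z := by
    intro z
    simp only [hP₁, hP₂]
    linear_combination (-(pds f₁ (Θ z) + pdt f₂ (Θ z))) * hcs
  simp_rw [e]
  rw [integral_add (hc₁.integrableOn_compact hK.isCompact) (hc₂.integrableOn_compact hK.isCompact)]
  refine (abs_add_le _ _).trans ?_
  linarith

/-- A smooth truncation at scale `r` of the height above `k`. -/
def truncation (r k y : ℝ) : ℝ := r * Real.arctan ((y - k) / r)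

lemma contDiff_truncation (r k : ℝ) : ContDiff ℝ (⊤ : ℕ∞) (truncation r k) :=
  contDiff_const.mul (Real.contDiff_arctan.comp ((contDiff_id.sub contDiff_const).div_const r))

lemma deriv_truncation {r : ℝ} (hr : 0 < r) (k y : ℝ) :
    deriv (truncation r k) y = 1 / (1 + ((y - k) / r) ^ 2) := by
  have h := ((((hasDerivAt_id y).sub_const k).div_const r).arctan).const_mul r
  have e : r * (1 / (1 + ((id y - k) / r) ^ 2) * (1 / r)) = 1 / (1 + ((y - k) / r) ^ 2) := by
    simp only [id]; field_simp
  rw [e] at h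
  exact h.deriv

lemma abs_truncation_le {r : ℝ} (hr : 0 < r) (k y : ℝ) : |truncation r k y| ≤ 2 * r := by
  have h : |Real.arctan ((y - k) / r)| ≤ 2 := by
    have h1 := Real.arctan_lt_pi_div_two ((y - k) / r)
    have h2 := Real.neg_pi_div_two_lt_arctan ((y - k) / r)
    have := Real.pi_lt_four
    rw [abs_le]; constructor <;> linarith
  rw [truncation, abs_mul, abs_of_pos hr]
  nlinarith

lemma abs_normal_velocity_le {γ p q W : ℝ} (hW : 0 < W) (hD : W ^ 2 = 1 + p ^ 2 + q ^ 2)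
    (hα : α₁ ^ 2 + α₂ ^ 2 + γ ^ 2 ≤ 1) : |γ - p * α₁ - q * α₂| ≤ W := by
  refine abs_le_of_sq_le_sq ?_ hW.le
  have h1 : (γ - p * α₁ - q * α₂) ^ 2 ≤ (α₁ ^ 2 + α₂ ^ 2 + γ ^ 2) * (1 + p ^ 2 + q ^ 2) := by
    nlinarith [sq_nonneg (γ * p + α₁), sq_nonneg (γ * q + α₂), sq_nonneg (p * α₂ - q * α₁)]
  rw [hD]
  nlinarith [sq_nonneg p, sq_nonneg q]

/-- Area bound for a translating graph in a cylinder of radius and height comparable to `r`. -/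
lemma PlanarTranslator.lintegral_areaElement_le (h : PlanarTranslator α₁ α₂ γ Ω u)
    {K₀ : Set (ℝ × ℝ)} (hK₀ : IsCompact K₀) (hKΩ : K₀ ⊆ Ω) (x₀ : ℝ × ℝ) {r : ℝ} (hr : 0 < r)
    (hr1 : r ≤ 1) (hKr : ∀ x ∈ K₀, (x.1 - x₀.1) ^ 2 + (x.2 - x₀.2) ^ 2 ≤ r ^ 2) (k : ℝ)
    (hKu : ∀ x ∈ K₀, |u x - k| ≤ r) :
    ∫⁻ x in K₀, ENNReal.ofReal (areaElement u x) ≤ ENNReal.ofReal (156 * r ^ 2) := by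
  obtain ⟨c, s, g, g', K, hK⟩ := h.exists_shearHull hK₀ hKΩ x₀ hr hr1 hKr
  set Θ := shearCoord x₀ c s g with hΘ
  have hmp : MeasurePreserving Θ volume volume :=
    measurePreserving_shearCoord x₀ hK.sq_add_sq hK.measurable
  have hΘc : ContinuousOn Θ K := hK.continuousOn
  have hmaps : MapsTo Θ K Ω := hK.mem_domain
  set T := truncation r k with hT
  have hTs : ContDiff ℝ (⊤ : ℕ∞) T := contDiff_truncation r k
  set f₁ : ℝ × ℝ → ℝ := fun y => T (u y) * pds u y / areaElement u y with hf₁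
  set f₂ : ℝ × ℝ → ℝ := fun y => T (u y) * pdt u y / areaElement u y with hf₂
  set φ : ℝ × ℝ → ℝ := fun x =>
    deriv T (u x) * (pds u x ^ 2 + pdt u x ^ 2) / areaElement u x with hφ
  set ψ : ℝ × ℝ → ℝ := fun x =>
    T (u x) * (γ - pds u x * α₁ - pdt u x * α₂) / areaElement u x with hψ
  have h₁ : ContDiffOn ℝ 1 f₁ Ω := fun x hx =>
    ((h.contDiffAt_field hTs hx).1.of_le (by exact_mod_cast le_top)).contDiffWithinAt
  have h₂ : ContDiffOn ℝ 1 f₂ Ω := fun x hx =>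
    ((h.contDiffAt_field hTs hx).2.of_le (by exact_mod_cast le_top)).contDiffWithinAt
  have hflux := hK.abs_integral_div_le h.isOpen hr h₁ h₂ (B := 2 * r) (by positivity) (by
    intro x hx
    have hW := areaElement_pos u x
    have hT2 : T (u x) ^ 2 ≤ (2 * r) ^ 2 := sq_le_sq' (abs_le.1 (abs_truncation_le hr k _)).1
      (abs_le.1 (abs_truncation_le hr k _)).2
    have e : f₁ x ^ 2 + f₂ x ^ 2
        = T (u x) ^ 2 * ((areaElement u x ^ 2 - 1) / areaElement u x ^ 2) := by
      simp only [hf₁, hf₂]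
      field_simp
      rw [sq_areaElement]; ring
    rw [e]
    have : (areaElement u x ^ 2 - 1) / areaElement u x ^ 2 ≤ 1 := by
      rw [div_le_one (by positivity)]; linarith
    exact (mul_le_of_le_one_right (sq_nonneg _) this).trans hT2)
  have cW : ContinuousOn (areaElement u) Ω := fun x hx =>
    (h.contDiffAt_areaElement hx).continuousAt.continuousWithinAt
  have cp : ContinuousOn (pds u) Ω := fun x hx =>
    (h.contDiffAt_pds hx).continuousAt.continuousWithinAt
  have cq : ContinuousOn (pdt u) Ω := fun x hx =>
    (h.contDiffAt_pdt hx).continuousAt.continuousWithinAt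
  have hn : ∀ x ∈ Ω, areaElement u x ≠ 0 := fun x _ => (areaElement_pos u x).ne'
  have cφ : ContinuousOn φ Ω :=
    (((hTs.continuous_deriv (by simp)).comp_continuousOn h.continuousOn).mul
      ((cp.pow 2).add (cq.pow 2))).div cW hn
  have cψ : ContinuousOn ψ Ω :=
    ((hTs.continuous.comp_continuousOn h.continuousOn).mul
      ((continuousOn_const.sub (cp.mul continuousOn_const)).sub (cq.mul continuousOn_const))).div
        cW hn
  have iφ : IntegrableOn (fun z => φ (Θ z)) K :=
    (cφ.comp hΘc hmaps).integrableOn_compact hK.isCompact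
  have iψ : IntegrableOn (fun z => ψ (Θ z)) K :=
    (cψ.comp hΘc hmaps).integrableOn_compact hK.isCompact
  have hdiv : ∫ z in K, (pds f₁ (Θ z) + pdt f₂ (Θ z))
      = (∫ z in K, φ (Θ z)) + ∫ z in K, ψ (Θ z) := by
    rw [← integral_add iφ iψ]
    exact setIntegral_congr_fun hK.isCompact.measurableSet fun z hz => h.div_field hTs (hmaps hz)
  have hvol : volume.real K ≤ 12 * r ^ 2 := by
    have hbox : IsCompact (Icc (-r) r ×ˢ Icc (-(3 * r)) (3 * r)) := isCompact_Icc.prod isCompact_Icc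
    have h1 := measureReal_mono (μ := volume) hK.subset_box hbox.measure_lt_top.ne
    refine h1.trans (le_of_eq ?_)
    rw [Measure.volume_eq_prod, measureReal_prod_prod, Real.volume_real_Icc_of_le (by linarith),
      Real.volume_real_Icc_of_le (by linarith)]
    ring
  have hψb : |∫ z in K, ψ (Θ z)| ≤ 2 * r * volume.real K := by
    have hKlt : (volume : Measure (ℝ × ℝ)) K < ⊤ := hK.isCompact.measure_lt_top
    rw [← Real.norm_eq_abs]
    refine norm_setIntegral_le_of_norm_le_const hKlt fun z hz => ?_
    have hW := areaElement_pos u (Θ z)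
    simp only [hψ, Real.norm_eq_abs]
    rw [abs_div, abs_mul, abs_of_pos hW, div_le_iff₀ hW]
    exact mul_le_mul (abs_truncation_le hr k _)
      (abs_normal_velocity_le hW (sq_areaElement u _) h.norm_le) (abs_nonneg _) (by positivity)
  have hφi : ∫ z in K, φ (Θ z) ≤ 72 * r ^ 2 := by
    rw [hdiv] at hflux
    have a := (abs_le.1 hflux).2
    have b := (abs_le.1 hψb).1
    have c : 2 * r * volume.real K ≤ 2 * r * (12 * r ^ 2) := by gcongr
    have d : r * r ^ 2 ≤ 1 * r ^ 2 := by gcongr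
    linarith
  have hφ0 : ∀ x, 0 ≤ φ x := by
    intro x
    have := areaElement_pos u x
    simp only [hφ, hT, deriv_truncation hr]
    positivity
  have hWφ : ∀ x ∈ K₀, areaElement u x ≤ 1 + 2 * φ x := by
    intro x hx
    have hW := areaElement_pos u x
    have hW1 : 1 ≤ areaElement u x := by
      rw [areaElement]
      exact Real.one_le_sqrt.2 (by nlinarith [sq_nonneg (pds u x), sq_nonneg (pdt u x)])
    have hT' : 1 / 2 ≤ deriv T (u x) := by
      rw [hT, deriv_truncation hr]
      have : ((u x - k) / r) ^ 2 ≤ 1 := by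
        rw [div_pow, div_le_one (by positivity)]
        exact sq_le_sq' (abs_le.1 (hKu x hx)).1 (abs_le.1 (hKu x hx)).2
      exact one_div_le_one_div_of_le (by positivity) (by linarith)
    have e : pds u x ^ 2 + pdt u x ^ 2 = areaElement u x ^ 2 - 1 := by rw [sq_areaElement]; ring
    have : (areaElement u x - 1) / 2 ≤ φ x := by
      simp only [hφ]
      rw [e, le_div_iff₀ hW]
      have : 1 / 2 * (areaElement u x ^ 2 - 1) ≤ deriv T (u x) * (areaElement u x ^ 2 - 1) := by
        gcongr
        nlinarith
      nlinarith
    linarith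
  have i1 : Integrable (fun _ : ℝ × ℝ => (1 : ℝ)) (volume.restrict K) :=
    (continuousOn_const (c := (1 : ℝ))).integrableOn_compact hK.isCompact
  calc ∫⁻ x in K₀, ENNReal.ofReal (areaElement u x)
      = ∫⁻ z in Θ ⁻¹' K₀, ENNReal.ofReal (areaElement u (Θ z)) :=
        (hmp.setLIntegral_comp_preimage hK₀.measurableSet
          (measurable_areaElement u).ennreal_ofReal).symm
    _ ≤ ∫⁻ z in Θ ⁻¹' K₀, ENNReal.ofReal (1 + 2 * φ (Θ z)) :=
        setLIntegral_mono' (hmp.measurable hK₀.measurableSet) fun z hz =>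
          ENNReal.ofReal_le_ofReal (hWφ _ hz)
    _ ≤ ∫⁻ z in K, ENNReal.ofReal (1 + 2 * φ (Θ z)) :=
        lintegral_mono_set fun z hz => hK.mem_hull z hz
    _ = ENNReal.ofReal (∫ z in K, (1 + 2 * φ (Θ z))) := by
        rw [ofReal_integral_eq_lintegral_ofReal]
        · exact i1.add (iφ.const_mul 2)
        · exact Eventually.of_forall fun z => by
            have := hφ0 (Θ z)
            simp only [Pi.zero_apply]
            positivity
    _ ≤ ENNReal.ofReal (156 * r ^ 2) := by
        refine ENNReal.ofReal_le_ofReal ?_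
        rw [integral_add i1 (iφ.const_mul 2),
          setIntegral_const, integral_const_mul]
        simp only [smul_eq_mul, mul_one]
        linarith

end AreaEstimate

section HausdorffArea

open Filter Topology Set

lemma hausdorffMeasure_image_le_of_edist_le {X Y Z : Type*} [EMetricSpace X]
    [MeasurableSpace X] [BorelSpace X] [EMetricSpace Y] [MeasurableSpace Y] [BorelSpace Y]
    {f : Z → X} {g : Z → Y} {A : Set Z} (K : ℝ≥0) {d : ℝ} (hd : 0 ≤ d)
    (h : ∀ x ∈ A, ∀ y ∈ A, edist (f x) (f y) ≤ K * edist (g x) (g y)) :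
    μH[d] (f '' A) ≤ (K : ℝ≥0∞) ^ d * μH[d] (g '' A) := by
  rcases A.eq_empty_or_nonempty with rfl | ⟨z, hz⟩
  · simp
  have : Nonempty Z := ⟨z⟩
  have key : ∀ x ∈ A, Function.invFunOn g A (g x) ∈ A ∧ g (Function.invFunOn g A (g x)) = g x :=
    fun x hx => ⟨Function.invFunOn_mem ⟨x, hx, rfl⟩, Function.invFunOn_eq ⟨x, hx, rfl⟩⟩
  have e : f '' A = (f ∘ Function.invFunOn g A) '' (g '' A) := by
    rw [image_image]
    refine image_congr fun x hx => ?_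
    have := h x hx _ (key x hx).1
    rw [(key x hx).2, edist_self, mul_zero, nonpos_iff_eq_zero, edist_eq_zero] at this
    exact this
  rw [e]
  refine LipschitzOnWith.hausdorffMeasure_image_le ?_ hd
  rintro _ ⟨x, hx, rfl⟩ _ ⟨y, hy, rfl⟩
  have := h _ (key x hx).1 _ (key y hy).1
  rwa [(key x hx).2, (key y hy).2] at this

/-- A linear map of the plane with the metric of the graph of `η ↦ p η₁ + q η₂`. -/
lemma exists_linearMap_graph_metric (p q : ℝ) :
    ∃ M : ℝ × ℝ →ₗ[ℝ] ℝ × ℝ, |LinearMap.det M| = √(1 + p ^ 2 + q ^ 2) ∧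
      ∀ η : ℝ × ℝ, η.1 ^ 2 + η.2 ^ 2 + (p * η.1 + q * η.2) ^ 2 = (M η).1 ^ 2 + (M η).2 ^ 2 := by
  have h1 : 0 < 1 + p ^ 2 := by positivity
  have hc : 0 < √(1 + p ^ 2) := Real.sqrt_pos.2 h1
  have hc2 : √(1 + p ^ 2) ^ 2 = 1 + p ^ 2 := Real.sq_sqrt h1.le
  have hW2 : √(1 + p ^ 2 + q ^ 2) ^ 2 = 1 + p ^ 2 + q ^ 2 := Real.sq_sqrt (by positivity)
  refine ⟨Matrix.toLin (Module.Basis.finTwoProd ℝ) (Module.Basis.finTwoProd ℝ)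
    !![√(1 + p ^ 2), p * q / √(1 + p ^ 2); 0, √(1 + p ^ 2 + q ^ 2) / √(1 + p ^ 2)], ?_, ?_⟩
  · rw [LinearMap.det_toLin, Matrix.det_fin_two_of, mul_zero, sub_zero,
      mul_div_cancel₀ _ hc.ne', abs_of_nonneg (Real.sqrt_nonneg _)]
  · intro η
    rw [Matrix.toLin_finTwoProd_apply]
    simp only [zero_mul, zero_add]
    have : (√(1 + p ^ 2) * η.1 + p * q / √(1 + p ^ 2) * η.2) ^ 2
        + (√(1 + p ^ 2 + q ^ 2) / √(1 + p ^ 2) * η.2) ^ 2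
        = √(1 + p ^ 2) ^ 2 * η.1 ^ 2 + 2 * p * q * η.1 * η.2
          + (p ^ 2 * q ^ 2 + √(1 + p ^ 2 + q ^ 2) ^ 2) / √(1 + p ^ 2) ^ 2 * η.2 ^ 2 := by
      field_simp
      ring
    rw [this, hW2, hc2]
    field_simp
    ring

/-- The parametrization of the graph of `u` with respect to the basis `(a, b, v)`. -/
def graphMap (a b v : E3) (u : ℝ × ℝ → ℝ) (x : ℝ × ℝ) : E3 := x.1 • a + x.2 • b + u x • v

lemma norm_sq_combination {a b v : E3} (ha : ‖a‖ = 1) (hb : ‖b‖ = 1) (hv : ‖v‖ = 1)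
    (hab : ⟪a, b⟫ = 0) (hav : ⟪a, v⟫ = 0) (hbv : ⟪b, v⟫ = 0) (s t c : ℝ) :
    ‖s • a + t • b + c • v‖ ^ 2 = s ^ 2 + t ^ 2 + c ^ 2 := by
  rw [norm_add_sq_real, norm_add_sq_real]
  simp only [inner_add_left, inner_smul_left, inner_smul_right, hab, hav, hbv, norm_smul, ha, hb,
    hv, Real.norm_eq_abs, mul_one, sq_abs, mul_zero, add_zero]

variable {a b v : E3} {u : ℝ × ℝ → ℝ}

lemma hasStrictFDerivAt_graphMap {x : ℝ × ℝ} (hu : ContDiffAt ℝ (⊤ : ℕ∞) u x) :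
    HasStrictFDerivAt (graphMap a b v u)
      ((ContinuousLinearMap.fst ℝ ℝ ℝ).smulRight a + (ContinuousLinearMap.snd ℝ ℝ ℝ).smulRight b
        + (fderiv ℝ u x).smulRight v) x := by
  have h := hu.hasStrictFDerivAt (by simp)
  exact ((hasStrictFDerivAt_fst.smul_const a).add (hasStrictFDerivAt_snd.smul_const b)).add
    (h.smul_const v)

lemma sq_norm_le_sq_add_sq (η : ℝ × ℝ) : ‖η‖ ^ 2 ≤ η.1 ^ 2 + η.2 ^ 2 := by
  rw [Prod.norm_def]
  rcases max_choice ‖η.1‖ ‖η.2‖ with h | h <;> rw [h, Real.norm_eq_abs, sq_abs]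
  · linarith [sq_nonneg η.2]
  · linarith [sq_nonneg η.1]

lemma sq_add_sq_le_two_mul_sq_norm (η : ℝ × ℝ) : η.1 ^ 2 + η.2 ^ 2 ≤ 2 * ‖η‖ ^ 2 := by
  have h1 : η.1 ^ 2 ≤ ‖η‖ ^ 2 := by
    rw [← sq_abs, ← Real.norm_eq_abs]; gcongr; exact norm_fst_le η
  have h2 : η.2 ^ 2 ≤ ‖η‖ ^ 2 := by
    rw [← sq_abs, ← Real.norm_eq_abs]; gcongr; exact norm_snd_le η
  linarith

/-- Near a point, the parametrization of a graph increases areas by at most a constant multiple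
of the area element at this point. -/
lemma exists_nhds_hausdorffMeasure_graphMap_le (ha : ‖a‖ = 1) (hb : ‖b‖ = 1) (hv : ‖v‖ = 1)
    (hab : ⟪a, b⟫ = 0) (hav : ⟪a, v⟫ = 0) (hbv : ⟪b, v⟫ = 0) {x : ℝ × ℝ}
    (hu : ContDiffAt ℝ (⊤ : ℕ∞) u x) :
    ∃ N ∈ 𝓝 x, ∀ A ⊆ N, μH[2] (graphMap a b v u '' A)
      ≤ 9 * ENNReal.ofReal (areaElement u x) * volume A := by
  obtain ⟨M, hdet, hM⟩ := exists_linearMap_graph_metric (pds u x) (pdt u x)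
  obtain ⟨N, hN, happ⟩ := (hasStrictFDerivAt_graphMap (a := a) (b := b) (v := v) hu)
    |>.approximates_deriv_on_nhds (c := 1) (Or.inr one_pos)
  refine ⟨N, hN, fun A hA => ?_⟩
  have key : ∀ y ∈ A, ∀ z ∈ A, edist (graphMap a b v u y) (graphMap a b v u z)
      ≤ (3 : ℝ≥0) * edist (M y) (M z) := by
    intro y hy z hz
    set η := y - z with hη
    have hf : ‖η.1 • a + η.2 • b + (fderiv ℝ u x η) • v‖ ^ 2 = (M η).1 ^ 2 + (M η).2 ^ 2 := by
      rw [norm_sq_combination ha hb hv hab hav hbv, ← hM, fderiv_apply_eq_pds_pdt]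
      ring
    have happ' := happ y (hA hy) z (hA hz)
    simp only [add_apply, ContinuousLinearMap.smulRight_apply,
      ContinuousLinearMap.coe_fst', ContinuousLinearMap.coe_snd', NNReal.coe_one, one_mul,
      ← hη] at happ'
    set F := η.1 • a + η.2 • b + (fderiv ℝ u x η) • v
    have h1 : ‖η‖ ≤ ‖F‖ := by
      refine le_of_sq_le_sq ?_ (norm_nonneg _)
      rw [hf, ← hM]
      linarith [sq_norm_le_sq_add_sq η, sq_nonneg (pds u x * η.1 + pdt u x * η.2)]
    have h2 : ‖F‖ ≤ 3 / 2 * ‖M η‖ := by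
      refine le_of_sq_le_sq ?_ (by positivity)
      rw [hf]
      nlinarith [sq_add_sq_le_two_mul_sq_norm (M η), sq_nonneg ‖M η‖]
    have h3 : ‖graphMap a b v u y - graphMap a b v u z‖ ≤ 3 * ‖M y - M z‖ := by
      rw [← map_sub, ← hη]
      have := norm_le_norm_add_norm_sub' (graphMap a b v u y - graphMap a b v u z) F
      linarith
    rw [edist_dist, edist_dist, dist_eq_norm, dist_eq_norm,
      ← ENNReal.ofReal_coe_nnreal, ← ENNReal.ofReal_mul (by positivity)]
    exact ENNReal.ofReal_le_ofReal h3
  refine (hausdorffMeasure_image_le_of_edist_le 3 zero_le_two key).trans_eq ?_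
  rw [hausdorffMeasure_prod_real, Measure.addHaar_image_linearMap, hdet, ← mul_assoc,
    ENNReal.rpow_two]
  congr 2
  norm_num

/-- The area of a graph over a compact set, up to a constant. -/
lemma hausdorffMeasure_graphMap_le (ha : ‖a‖ = 1) (hb : ‖b‖ = 1) (hv : ‖v‖ = 1)
    (hab : ⟪a, b⟫ = 0) (hav : ⟪a, v⟫ = 0) (hbv : ⟪b, v⟫ = 0) {K : Set (ℝ × ℝ)}
    (hK : IsCompact K) (hu : ∀ x ∈ K, ContDiffAt ℝ (⊤ : ℕ∞) u x) :
    μH[2] (graphMap a b v u '' K) ≤ 18 * ∫⁻ x in K, ENNReal.ofReal (areaElement u x) := by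
  have hloc : ∃ T, MeasurableSet T ∧ K ⊆ T ∧ ∀ A ⊆ T, MeasurableSet A →
      μH[2] (graphMap a b v u '' A) ≤ 18 * ∫⁻ x in A, ENNReal.ofReal (areaElement u x) := by
    refine hK.induction_on (p := fun s => ∃ T, MeasurableSet T ∧ s ⊆ T ∧ ∀ A ⊆ T, MeasurableSet A →
      μH[2] (graphMap a b v u '' A) ≤ 18 * ∫⁻ x in A, ENNReal.ofReal (areaElement u x))
      ⟨∅, .empty, subset_rfl, fun A hA _ => by simp [subset_empty_iff.1 hA]⟩
      (fun s t hst ⟨T, hT, htT, h⟩ => ⟨T, hT, hst.trans htT, h⟩) ?_ ?_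
    · rintro s t ⟨T, hT, hsT, h⟩ ⟨T', hT', htT', h'⟩
      refine ⟨T ∪ T', hT.union hT', union_subset_union hsT htT', fun A hA hAm => ?_⟩
      calc μH[2] (graphMap a b v u '' A)
          = μH[2] (graphMap a b v u '' (A ∩ T) ∪ graphMap a b v u '' (A \ T)) := by
            rw [← image_union, inter_union_sdiff]
        _ ≤ _ := measure_union_le _ _
        _ ≤ _ := add_le_add (h _ inter_subset_right (hAm.inter hT))
            (h' _ (fun x hx => (hA hx.1).resolve_left hx.2) (hAm.diff hT))
        _ = _ := by rw [← mul_add, lintegral_inter_add_sdiff _ _ hT]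
    · intro x hx
      obtain ⟨N, hN, h⟩ :=
        exists_nhds_hausdorffMeasure_graphMap_le ha hb hv hab hav hbv (hu x hx)
      have hW := areaElement_pos u x
      have hc : ∀ᶠ y in 𝓝 x, areaElement u x < 2 * areaElement u y := by
        have : ContinuousAt (fun y => 2 * areaElement u y) x := by
          have h1 := ((hu x hx).pds (m := (⊤ : ℕ∞)) (by exact_mod_cast le_rfl)).continuousAt
          have h2 := ((hu x hx).pdt (m := (⊤ : ℕ∞)) (by exact_mod_cast le_rfl)).continuousAt
          exact continuousAt_const.mul (((continuousAt_const.add (h1.pow 2)).add (h2.pow 2)).sqrt)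
        exact this.eventually_const_lt (by linarith)
      obtain ⟨T, hTN, hTo, hxT⟩ := _root_.mem_nhds_iff.1 (inter_mem hN hc)
      refine ⟨T, mem_nhdsWithin_of_mem_nhds (hTo.mem_nhds hxT), T, hTo.measurableSet, subset_rfl,
        fun A hA hAm => (h A (hA.trans (hTN.trans inter_subset_left))).trans ?_⟩
      calc 9 * ENNReal.ofReal (areaElement u x) * volume A
          = 9 * ∫⁻ _ in A, ENNReal.ofReal (areaElement u x) := by
            rw [setLIntegral_const, mul_assoc]
        _ ≤ 9 * ∫⁻ y in A, 2 * ENNReal.ofReal (areaElement u y) := by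
            gcongr 9 * ?_
            refine setLIntegral_mono' hAm fun y hy => ?_
            have h2 : areaElement u x < 2 * areaElement u y := (hTN (hA hy)).2
            calc ENNReal.ofReal (areaElement u x) ≤ ENNReal.ofReal (2 * areaElement u y) :=
                  ENNReal.ofReal_le_ofReal h2.le
              _ = 2 * ENNReal.ofReal (areaElement u y) := by
                  rw [ENNReal.ofReal_mul zero_le_two]; norm_num
        _ = 18 * ∫⁻ y in A, ENNReal.ofReal (areaElement u y) := by
            rw [lintegral_const_mul _ (measurable_areaElement u).ennreal_ofReal, ← mul_assoc]
            norm_num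
  obtain ⟨T, -, hKT, h⟩ := hloc
  exact h K hKT hK.measurableSet

end HausdorffArea

section AreaGrowth

open Filter Topology Set

lemma sum_sq_inner_le {a b v : E3} (ha : ‖a‖ = 1) (hb : ‖b‖ = 1) (hv : ‖v‖ = 1)
    (hab : ⟪a, b⟫ = 0) (hav : ⟪a, v⟫ = 0) (hbv : ⟪b, v⟫ = 0) (q : E3) :
    ⟪q, a⟫ ^ 2 + ⟪q, b⟫ ^ 2 + ⟪q, v⟫ ^ 2 ≤ ‖q‖ ^ 2 := by
  have h := norm_sub_sq_real q (⟪q, a⟫ • a + ⟪q, b⟫ • b + ⟪q, v⟫ • v)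
  rw [norm_sq_combination ha hb hv hab hav hbv] at h
  simp only [inner_add_right, inner_smul_right] at h
  nlinarith [sq_nonneg ‖q - (⟪q, a⟫ • a + ⟪q, b⟫ • b + ⟪q, v⟫ • v)‖]

/-- The coordinates of a point in the plane of `a` and `b`. -/
def planeCoord (a b : E3) (q : E3) : ℝ × ℝ := (⟪q, a⟫, ⟪q, b⟫)

lemma continuous_planeCoord (a b : E3) : Continuous (planeCoord a b) :=
  (continuous_id.inner continuous_const).prodMk (continuous_id.inner continuous_const)

namespace IsTranslatingGraph

variable {a b v : E3} {Ω : Set (ℝ × ℝ)} {u : ℝ × ℝ → ℝ} {S : Set E3}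

lemma planeCoord_graphMap (h : IsTranslatingGraph a b v Ω u S) (x : ℝ × ℝ) :
    planeCoord a b (graphMap a b v u x) = x := by
  have hba : ⟪b, a⟫ = 0 := by rw [real_inner_comm, h.inner_ab]
  have hva : ⟪v, a⟫ = 0 := by rw [real_inner_comm, h.inner_av]
  have hvb : ⟪v, b⟫ = 0 := by rw [real_inner_comm, h.inner_bv]
  ext <;> simp [planeCoord, graphMap, inner_add_left, inner_smul_left,
    h.norm_a, h.norm_b, h.inner_ab, hba, hva, hvb]

lemma inner_graphMap (h : IsTranslatingGraph a b v Ω u S) (x : ℝ × ℝ) :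
    ⟪graphMap a b v u x, v⟫ = u x := by
  simp [graphMap, inner_add_left, inner_smul_left,
    h.norm_v, h.inner_av, h.inner_bv]

lemma mem_iff (h : IsTranslatingGraph a b v Ω u S) {q : E3} :
    q ∈ S ↔ ∃ x ∈ Ω, q = graphMap a b v u x := by
  rw [h.graph_eq]; rfl

/-- The part of a translating graph in a compact set is parametrized by a compact set. -/
lemma isCompact_preimage (h : IsTranslatingGraph a b v Ω u S) (hS : IsClosed S) {B : Set E3}
    (hB : IsCompact B) : IsCompact {x | x ∈ Ω ∧ graphMap a b v u x ∈ B} := by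
  convert (hB.inter_left hS).image (continuous_planeCoord a b) using 1
  ext x
  constructor
  · rintro ⟨hx, hxB⟩
    exact ⟨_, ⟨h.mem_iff.2 ⟨x, hx, rfl⟩, hxB⟩, h.planeCoord_graphMap x⟩
  · rintro ⟨q, ⟨hq, hqB⟩, rfl⟩
    obtain ⟨x, hx, rfl⟩ := h.mem_iff.1 hq
    rw [h.planeCoord_graphMap]
    exact ⟨hx, hqB⟩

lemma planarTranslator (h : IsTranslatingGraph a b v Ω u S) (hS : IsClosed S) :
    PlanarTranslator ⟪e3, a⟫ ⟪e3, b⟫ ⟪e3, v⟫ Ω u where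
  isOpen := h.isOpen_dom
  isConnected := h.isConnected_dom
  smooth := h.smooth
  pde := h.pde
  norm_le := by
    have := sum_sq_inner_le h.norm_a h.norm_b h.norm_v h.inner_ab h.inner_av h.inner_bv e3
    simpa [e3] using this
  isCompact_slice K hK t l := by
    obtain ⟨M, hM⟩ := hK.exists_bound_of_continuousOn continuousOn_id
    have hcont : Continuous fun q : E3 => |⟪q, v⟫ - t| :=
      ((continuous_id.inner continuous_const).sub continuous_const).abs
    have hcl : IsClosed {q : E3 | planeCoord a b q ∈ K ∧ |⟪q, v⟫ - t| ≤ l} :=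
      (hK.isClosed.preimage (continuous_planeCoord a b)).inter
        (isClosed_le hcont continuous_const)
    have hcp : IsCompact (closedBall (0 : E3) (M + M + (|t| + l)) ∩
        {q : E3 | planeCoord a b q ∈ K ∧ |⟪q, v⟫ - t| ≤ l}) :=
      (isCompact_closedBall _ _).inter_right hcl
    convert h.isCompact_preimage hS hcp using 1
    ext x
    simp only [Set.mem_ofPred_eq, mem_inter_iff, h.planeCoord_graphMap, h.inner_graphMap,
      mem_closedBall_zero_iff]
    refine ⟨fun ⟨hxK, hxΩ, hxu⟩ => ⟨hxΩ, ?_, hxK, hxu⟩, fun ⟨hxΩ, _, hxK, hxu⟩ => ⟨hxK, hxΩ, hxu⟩⟩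
    have hM' : ‖x‖ ≤ M := hM x hxK
    have hu : |u x| ≤ |t| + l := by
      have := abs_add_le (u x - t) t
      rw [sub_add_cancel] at this
      linarith
    have h1 := (norm_fst_le x).trans hM'
    have h2 := (norm_snd_le x).trans hM'
    refine (norm_add₃_le).trans ?_
    rw [norm_smul, norm_smul, norm_smul, h.norm_a, h.norm_b, h.norm_v, Real.norm_eq_abs (u x)]
    linarith

/-- Area bound for complete translating graphs in balls of radius at most `1`. -/
lemma hausdorffMeasure_inter_ball_le_of_le_one (h : IsTranslatingGraph a b v Ω u S)
    (hS : IsClosed S) (p : E3) {r : ℝ} (hr : 0 < r) (hr1 : r ≤ 1) :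
    μH[2] (S ∩ ball p r) ≤ ENNReal.ofReal (2808 * r ^ 2) := by
  set K₀ : Set (ℝ × ℝ) := {x | x ∈ Ω ∧ graphMap a b v u x ∈ closedBall p r}
  have hP := h.planarTranslator hS
  have hK₀ : IsCompact K₀ := h.isCompact_preimage hS (isCompact_closedBall p r)
  have hKΩ : K₀ ⊆ Ω := fun x hx => hx.1
  have hcoord : ∀ x ∈ K₀, (x.1 - ⟪p, a⟫) ^ 2 + (x.2 - ⟪p, b⟫) ^ 2 + (u x - ⟪p, v⟫) ^ 2
      ≤ r ^ 2 := by
    intro x hx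
    have h0 := sum_sq_inner_le h.norm_a h.norm_b h.norm_v h.inner_ab h.inner_av h.inner_bv
      (graphMap a b v u x - p)
    have h1 : ⟪graphMap a b v u x, a⟫ = x.1 := congrArg Prod.fst (h.planeCoord_graphMap x)
    have h2 : ⟪graphMap a b v u x, b⟫ = x.2 := congrArg Prod.snd (h.planeCoord_graphMap x)
    rw [inner_sub_left, inner_sub_left, inner_sub_left, h1, h2, h.inner_graphMap] at h0
    have hd : ‖graphMap a b v u x - p‖ ≤ r := mem_closedBall_iff_norm.1 hx.2
    exact h0.trans (pow_le_pow_left₀ (norm_nonneg _) hd 2)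
  have harea := hP.lintegral_areaElement_le hK₀ hKΩ (⟪p, a⟫, ⟪p, b⟫) hr hr1
    (fun x hx => by
      have := hcoord x hx
      dsimp only
      linarith [sq_nonneg (u x - ⟪p, v⟫)]) ⟪p, v⟫
    (fun x hx => abs_le_of_sq_le_sq (by
      have := hcoord x hx
      linarith [sq_nonneg (x.1 - ⟪p, a⟫), sq_nonneg (x.2 - ⟪p, b⟫)]) hr.le)
  calc μH[2] (S ∩ ball p r) ≤ μH[2] (graphMap a b v u '' K₀) := by
        refine measure_mono ?_
        rintro q ⟨hq, hqp⟩
        obtain ⟨x, hx, rfl⟩ := h.mem_iff.1 hq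
        exact ⟨x, ⟨hx, ball_subset_closedBall hqp⟩, rfl⟩
    _ ≤ 18 * ∫⁻ x in K₀, ENNReal.ofReal (areaElement u x) :=
        hausdorffMeasure_graphMap_le h.norm_a h.norm_b h.norm_v h.inner_ab h.inner_av h.inner_bv
          hK₀ fun x hx => hP.contDiffAt hx.1
    _ ≤ 18 * ENNReal.ofReal (156 * r ^ 2) := by gcongr
    _ = ENNReal.ofReal (2808 * r ^ 2) := by
        rw [← ENNReal.ofReal_ofNat, ← ENNReal.ofReal_mul (by norm_num)]
        congr 1
        ring

end IsTranslatingGraph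

lemma card_Icc_floor_le {s t : ℝ} (hst : s ≤ t) :
    ((Finset.Icc ⌊s⌋ ⌊t⌋).card : ℝ) ≤ t - s + 2 := by
  have h : ⌊s⌋ ≤ ⌊t⌋ := Int.floor_le_floor hst
  rw [Int.card_Icc, ← Int.cast_natCast, Int.toNat_of_nonneg (by linarith)]
  push_cast
  linarith [Int.floor_le t, Int.lt_floor_add_one s]

lemma abs_sub_floor_two_mul_div_le (t : ℝ) : |t - (⌊2 * t⌋ : ℝ) / 2| ≤ 1 / 2 := by
  rw [abs_le]
  constructor <;> linarith [Int.floor_le (2 * t), Int.lt_floor_add_one (2 * t)]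

/-- A measure on a slab which is bounded on unit balls has quadratic growth at scales above
`1`. -/
lemma measure_inter_ball_le_of_slab (μ : Measure E3) {S : Set E3} {w A : ℝ} (hw : 0 < w)
    (hA : 0 ≤ A) (hS : S ⊆ {q : E3 | |q 0| ≤ w})
    (hunit : ∀ c : E3, μ (S ∩ ball c 1) ≤ ENNReal.ofReal A) (p : E3) {R : ℝ} (hR : 1 ≤ R) :
    μ (S ∩ ball p R) ≤ ENNReal.ofReal ((4 * w + 2) * 36 * A * R ^ 2) := by
  set I := Finset.Icc ⌊2 * (-w)⌋ ⌊2 * w⌋ with hI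
  set J := Finset.Icc ⌊2 * (p 1 - R)⌋ ⌊2 * (p 1 + R)⌋ with hJ
  set L := Finset.Icc ⌊2 * (p 2 - R)⌋ ⌊2 * (p 2 + R)⌋ with hL
  let c : ℤ × ℤ × ℤ → E3 := fun i => !₂[(i.1 : ℝ) / 2, (i.2.1 : ℝ) / 2, (i.2.2 : ℝ) / 2]
  have hcover : S ∩ ball p R ⊆ ⋃ i ∈ I ×ˢ J ×ˢ L, S ∩ ball (c i) 1 := by
    rintro q ⟨hqS, hq⟩
    have h0 := abs_le.1 (show |q 0| ≤ w from hS hqS)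
    have hcoord : ∀ m : Fin 3, |q m - p m| ≤ R := fun m => by
      rw [mem_ball_iff_norm] at hq
      exact (PiLp.norm_apply_le (q - p) m).trans hq.le
    have h1 := abs_le.1 (hcoord 1)
    have h2 := abs_le.1 (hcoord 2)
    have mem : ∀ {s t x : ℝ}, s ≤ x → x ≤ t → ⌊2 * x⌋ ∈ Finset.Icc ⌊2 * s⌋ ⌊2 * t⌋ :=
      fun hs ht => Finset.mem_Icc.2
        ⟨Int.floor_le_floor (by linarith), Int.floor_le_floor (by linarith)⟩
    refine mem_iUnion₂.2 ⟨(⌊2 * q 0⌋, ⌊2 * q 1⌋, ⌊2 * q 2⌋), ?_, hqS, ?_⟩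
    · simp only [Finset.mem_product]
      exact ⟨mem h0.1 h0.2, mem (by linarith) (by linarith), mem (by linarith) (by linarith)⟩
    · have sq : ∀ t : ℝ, (t - (⌊2 * t⌋ : ℝ) / 2) ^ 2 ≤ 1 / 4 := fun t => by
        rw [← sq_abs]
        nlinarith [abs_sub_floor_two_mul_div_le t, abs_nonneg (t - (⌊2 * t⌋ : ℝ) / 2)]
      rw [mem_ball, EuclideanSpace.dist_eq, Real.sqrt_lt' one_pos, Fin.sum_univ_three]
      simp only [Real.dist_eq, sq_abs]
      have e0 := sq (q 0)
      have e1 := sq (q 1)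
      have e2 := sq (q 2)
      simp only [c, Matrix.cons_val]
      linarith
  have cI : (I.card : ℝ) ≤ 4 * w + 2 := (card_Icc_floor_le (by linarith)).trans (by linarith)
  have cJ : (J.card : ℝ) ≤ 6 * R := (card_Icc_floor_le (by linarith)).trans (by linarith)
  have cL : (L.card : ℝ) ≤ 6 * R := (card_Icc_floor_le (by linarith)).trans (by linarith)
  calc μ (S ∩ ball p R) ≤ ∑ i ∈ I ×ˢ J ×ˢ L, μ (S ∩ ball (c i) 1) :=
        (measure_mono hcover).trans (measure_biUnion_finset_le _ _)
    _ ≤ ∑ _i ∈ I ×ˢ J ×ˢ L, ENNReal.ofReal A := Finset.sum_le_sum fun i _ => hunit (c i)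
    _ = ENNReal.ofReal (I.card * (J.card * L.card) * A) := by
        rw [Finset.sum_const, Finset.card_product, Finset.card_product, nsmul_eq_mul,
          ENNReal.ofReal_mul (by positivity), ← Nat.cast_mul, ← Nat.cast_mul,
          ENNReal.ofReal_natCast]
    _ ≤ ENNReal.ofReal ((4 * w + 2) * 36 * A * R ^ 2) := by
        refine ENNReal.ofReal_le_ofReal ?_
        calc (I.card : ℝ) * (J.card * L.card) * A ≤ (4 * w + 2) * ((6 * R) * (6 * R)) * A := by
              gcongr
          _ = _ := by ring

lemma summable_exp_neg_sq_div_four_mul_sq :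
    Summable fun k : ℕ => Real.exp (-(k : ℝ) ^ 2 / 4) * ((k : ℝ) + 1) ^ 2 := by
  have h := ((summable_nat_add_iff 1).2
    (Real.summable_pow_mul_exp_neg_nat_mul 2 one_pos)).mul_left (Real.exp 2)
  refine h.of_nonneg_of_le (fun k => by positivity) fun k => ?_
  have e : Real.exp (-(k : ℝ) ^ 2 / 4) ≤ Real.exp 2 * Real.exp (-1 * ((k + 1 : ℕ) : ℝ)) := by
    rw [← Real.exp_add, Real.exp_le_exp]
    push_cast
    nlinarith [sq_nonneg ((k : ℝ) / 2 - 1)]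
  calc Real.exp (-(k : ℝ) ^ 2 / 4) * ((k : ℝ) + 1) ^ 2
      ≤ Real.exp 2 * Real.exp (-1 * ((k + 1 : ℕ) : ℝ)) * ((k : ℝ) + 1) ^ 2 := by gcongr
    _ = _ := by push_cast; ring

/-- Gaussian integrals of a measure of quadratic growth. -/
lemma inv_mul_lintegral_exp_le (μ : Measure E3) {C : ℝ} (hC : 0 ≤ C) (x : E3)
    (hμ : ∀ R : ℝ, 0 < R → μ (ball x R) ≤ ENNReal.ofReal (C * R ^ 2)) {s : ℝ} (hs : 0 < s) :
    (ENNReal.ofReal (4 * π * s))⁻¹ *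
        ∫⁻ q, ENNReal.ofReal (Real.exp (-‖q - x‖ ^ 2 / (4 * s))) ∂μ
      ≤ ENNReal.ofReal (C * ∑' k : ℕ, Real.exp (-(k : ℝ) ^ 2 / 4) * ((k : ℝ) + 1) ^ 2) := by
  set ρ := √s
  have hρ : 0 < ρ := Real.sqrt_pos.2 hs
  have hρ2 : ρ ^ 2 = s := Real.sq_sqrt hs.le
  have hpt : ∀ q, ENNReal.ofReal (Real.exp (-‖q - x‖ ^ 2 / (4 * s)))
      ≤ ∑' k : ℕ, (ball x (((k : ℝ) + 1) * ρ)).indicator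
        (fun _ => ENNReal.ofReal (Real.exp (-(k : ℝ) ^ 2 / 4))) q := by
    intro q
    set k := ⌊‖q - x‖ / ρ⌋₊
    have hk1 : (k : ℝ) ≤ ‖q - x‖ / ρ := Nat.floor_le (by positivity)
    have hk2 : ‖q - x‖ / ρ < k + 1 := Nat.lt_floor_add_one _
    refine le_trans ?_ (ENNReal.le_tsum k)
    rw [indicator_of_mem (by rw [mem_ball_iff_norm]; exact (div_lt_iff₀ hρ).1 hk2)]
    refine ENNReal.ofReal_le_ofReal (Real.exp_le_exp.2 ?_)
    have : (k : ℝ) ^ 2 ≤ ‖q - x‖ ^ 2 / s := by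
      rw [← hρ2, ← div_pow]; gcongr
    have e : -‖q - x‖ ^ 2 / (4 * s) = -(‖q - x‖ ^ 2 / s) / 4 := by field_simp
    rw [e]
    linarith
  have h4 : ENNReal.ofReal (4 * π * s) ≠ 0 := (ENNReal.ofReal_pos.2 (by positivity)).ne'
  rw [ENNReal.inv_mul_le_iff h4 ENNReal.ofReal_ne_top]
  calc ∫⁻ q, ENNReal.ofReal (Real.exp (-‖q - x‖ ^ 2 / (4 * s))) ∂μ
      ≤ ∫⁻ q, ∑' k : ℕ, (ball x (((k : ℝ) + 1) * ρ)).indicator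
        (fun _ => ENNReal.ofReal (Real.exp (-(k : ℝ) ^ 2 / 4))) q ∂μ := lintegral_mono hpt
    _ = ∑' k : ℕ, ENNReal.ofReal (Real.exp (-(k : ℝ) ^ 2 / 4))
          * μ (ball x (((k : ℝ) + 1) * ρ)) := by
        rw [lintegral_tsum fun k => (measurable_const.indicator measurableSet_ball).aemeasurable]
        simp_rw [lintegral_indicator_const measurableSet_ball]
    _ ≤ ∑' k : ℕ, ENNReal.ofReal (C * s * (Real.exp (-(k : ℝ) ^ 2 / 4) * ((k : ℝ) + 1) ^ 2)) := by
        refine ENNReal.tsum_le_tsum fun k => ?_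
        refine (mul_le_mul_right (hμ _ (by positivity)) _).trans_eq ?_
        rw [← ENNReal.ofReal_mul (Real.exp_pos _).le, mul_pow, hρ2]
        congr 1
        ring
    _ = ENNReal.ofReal (C * s * ∑' k : ℕ, Real.exp (-(k : ℝ) ^ 2 / 4) * ((k : ℝ) + 1) ^ 2) := by
        rw [← tsum_mul_left, ENNReal.ofReal_tsum_of_nonneg (fun k => by positivity)
          (summable_exp_neg_sq_div_four_mul_sq.mul_left _)]
    _ ≤ ENNReal.ofReal (4 * π * s) * _ := by
        rw [← ENNReal.ofReal_mul (by positivity)]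
        refine ENNReal.ofReal_le_ofReal ?_
        have hB : 0 ≤ ∑' k : ℕ, Real.exp (-(k : ℝ) ^ 2 / 4) * ((k : ℝ) + 1) ^ 2 :=
          tsum_nonneg fun k => by positivity
        have hπ : 1 ≤ 4 * π := by linarith [Real.two_le_pi]
        calc C * s * _ ≤ 4 * π * (C * s * _) := le_mul_of_one_le_left (by positivity) hπ
          _ = _ := by ring

end AreaGrowth

/-- A complete connected translating graph contained in a slab `{|x| ≤ w}` has
quadratic area growth with a constant depending only on `w`; in particular its entropy is
finite. -/
theorem stmt1 (w : ℝ) (hw : 0 < w) :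
    ∃ C : ℝ, 0 < C ∧
      ∀ (a b v : E3) (Ω : Set (ℝ × ℝ)) (u : ℝ × ℝ → ℝ) (S : Set E3),
        IsTranslatingGraph a b v Ω u S → IsClosed S → S ⊆ {q : E3 | |q 0| ≤ w} →
          (∀ (p : E3) (R : ℝ), 0 < R →
            μH[2] (S ∩ Metric.ball p R) ≤ ENNReal.ofReal (C * R ^ 2)) ∧
          entropy S ≠ ⊤ := by
  refine ⟨(4 * w + 2) * 36 * 2808, by positivity, fun a b v Ω u S h hS hSw => ?_⟩
  have hgrowth : ∀ (p : E3) (R : ℝ), 0 < R →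
      μH[2] (S ∩ Metric.ball p R) ≤ ENNReal.ofReal ((4 * w + 2) * 36 * 2808 * R ^ 2) := by
    intro p R hR
    rcases le_total R 1 with hR1 | hR1
    · refine (h.hausdorffMeasure_inter_ball_le_of_le_one hS p hR hR1).trans
        (ENNReal.ofReal_le_ofReal ?_)
      gcongr
      linarith
    · refine measure_inter_ball_le_of_slab μH[2] hw (by norm_num) hSw (fun c => ?_) p hR1
      exact (h.hausdorffMeasure_inter_ball_le_of_le_one hS c one_pos le_rfl).trans_eq (by norm_num)
  have hgauss : ∀ (x : E3) (s : ℝ), 0 < s → (ENNReal.ofReal (4 * π * s))⁻¹ *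
      ∫⁻ q in S, ENNReal.ofReal (Real.exp (-‖q - x‖ ^ 2 / (4 * s))) ∂(μH[2]) ≤ _ :=
    fun x s hs => inv_mul_lintegral_exp_le (μH[2].restrict S)
      (C := (4 * w + 2) * 36 * 2808) (by positivity) x (fun R hR => by
        rw [Measure.restrict_apply measurableSet_ball, Set.inter_comm]
        exact hgrowth x R hR) hs
  exact ⟨hgrowth, ne_top_of_le_ne_top ENNReal.ofReal_ne_top
    (iSup_le fun x => iSup_le fun s => iSup_le fun hs => hgauss x s hs)⟩
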